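/- Let 𝔐 be a B-admissible weight matrix, let U ⊆ ℝ^d be open, and let j be a positive integer. If f : U → ℂ is a function such that f^j and f^{j+1} belong to the Beurling class E^{(𝔐)}(U), then f belongs to E^{(𝔐)}(U). -/

import Mathlib

open Set Filter Topology Metric
open scoped ENNReal NNReal Topology

noncomputable section

namespace JorisPaper

/-- The sequence `m` with `m_k = M_k / k!`. -/
def lc (M : ℕ → ℝ) (k : ℕ) : ℝ := M k / (Nat.factorial k : ℝ)

/-- A weight sequence: positive, log-convex, `M_0 = 1 ≤ M_1`, `M_k^{1/k} → ∞`. -/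
structure IsWeightSeq (M : ℕ → ℝ) : Prop where
  pos : ∀ k, 0 < M k
  first : M 0 = 1
  one_le : 1 ≤ M 1
  logconvex : ∀ k, 1 ≤ k → M k ^ 2 ≤ M (k - 1) * M (k + 1)
  root : Filter.Tendsto (fun k : ℕ => M k ^ ((1 : ℝ) / (k : ℝ))) atTop atTop

/-- `m_k^{1/k} → ∞`. -/
def RootsTendsto (m : ℕ → ℝ) : Prop :=
  Filter.Tendsto (fun k : ℕ => m k ^ ((1 : ℝ) / (k : ℝ))) atTop atTop

/-- `h_m(t) = inf_k m_k t^k` for `t > 0`, and `0` for `t ≤ 0`. -/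
def hfn (m : ℕ → ℝ) (t : ℝ) : ℝ := if t ≤ 0 then 0 else ⨅ k : ℕ, m k * t ^ k

/-- `Γ̄_m(t) = min {k | h_m(t) = m_k t^k}`. -/
def GammaUpper (m : ℕ → ℝ) (t : ℝ) : ℕ := sInf {k : ℕ | hfn m t = m k * t ^ k}

/-- `Γ̲_m(t) = min {k | m_{k+1}/m_k ≥ 1/t}`. -/
def GammaLower (m : ℕ → ℝ) (t : ℝ) : ℕ := sInf {k : ℕ | 1 / t ≤ m (k + 1) / m k}

/-- `mg(M,N) = sup_{j+k ≥ 1} (M_{j+k}/(N_j N_k))^{1/(j+k)}`, as an extended real. -/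
def mg (M N : ℕ → ℝ) : ℝ≥0∞ :=
  ⨆ (j : ℕ) (k : ℕ) (_ : 1 ≤ j + k),
    ENNReal.ofReal ((M (j + k) / (N j * N k)) ^ (((j : ℝ) + (k : ℝ))⁻¹))

/-- A weight matrix: a totally ordered (pointwise) family of weight sequences. -/
structure IsWeightMatrix (W : Set (ℕ → ℝ)) : Prop where
  weight : ∀ M ∈ W, IsWeightSeq M
  ordered : ∀ M ∈ W, ∀ N ∈ W, (∀ k, M k ≤ N k) ∨ (∀ k, N k ≤ M k)

/-- R-admissible weight matrix. -/
structure RAdmissible (W : Set (ℕ → ℝ)) : Prop where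
  matrix : IsWeightMatrix W
  roots : ∀ M ∈ W, RootsTendsto (lc M)
  gamma : ∀ M ∈ W, ∃ N ∈ W, ∃ C : ℝ, 1 ≤ C ∧
    ∀ t : ℝ, 0 < t → GammaUpper (lc N) (C * t) ≤ GammaLower (lc M) t
  mgrowth : ∀ M ∈ W, ∃ N ∈ W, mg M N < ⊤

/-- B-admissible weight matrix. -/
structure BAdmissible (W : Set (ℕ → ℝ)) : Prop where
  matrix : IsWeightMatrix W
  roots : ∀ M ∈ W, RootsTendsto (lc M)
  gamma : ∀ M ∈ W, ∃ N ∈ W, ∃ C : ℝ, 1 ≤ C ∧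
    ∀ t : ℝ, 0 < t → GammaUpper (lc M) (C * t) ≤ GammaLower (lc N) t
  mgrowth : ∀ M ∈ W, ∃ N ∈ W, mg N M < ⊤

/-- `‖f‖^M_{K,ρ} < ∞` (derivatives taken within `U`). -/
def SeqBoundedOn {E F : Type*} [NormedAddCommGroup E] [NormedSpace ℝ E]
    [NormedAddCommGroup F] [NormedSpace ℝ F]
    (M : ℕ → ℝ) (ρ : ℝ) (f : E → F) (U K : Set E) : Prop :=
  ∃ C : ℝ, ∀ x ∈ K, ∀ k : ℕ, ‖iteratedFDerivWithin ℝ k f U x‖ ≤ C * ρ ^ k * M k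

/-- `f ∈ B^M_ρ(V)`: smooth on `V` with global bounds `‖f‖^M_{V,ρ} < ∞`. -/
def GlobalClass {E F : Type*} [NormedAddCommGroup E] [NormedSpace ℝ E]
    [NormedAddCommGroup F] [NormedSpace ℝ F]
    (M : ℕ → ℝ) (ρ : ℝ) (f : E → F) (V : Set E) : Prop :=
  ContDiffOn ℝ (⊤ : ℕ∞) f V ∧ SeqBoundedOn M ρ f V V

/-- The Roumieu class `E^{{W}}(U)`. -/
def Roumieu {E F : Type*} [NormedAddCommGroup E] [NormedSpace ℝ E]
    [NormedAddCommGroup F] [NormedSpace ℝ F]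
    (W : Set (ℕ → ℝ)) (U : Set E) (f : E → F) : Prop :=
  ContDiffOn ℝ (⊤ : ℕ∞) f U ∧
    ∀ K ⊆ U, IsCompact K → ∃ M ∈ W, ∃ ρ : ℝ, 0 < ρ ∧ SeqBoundedOn M ρ f U K

/-- The Beurling class `E^{(W)}(U)`. -/
def Beurling {E F : Type*} [NormedAddCommGroup E] [NormedSpace ℝ E]
    [NormedAddCommGroup F] [NormedSpace ℝ F]
    (W : Set (ℕ → ℝ)) (U : Set E) (f : E → F) : Prop :=
  ContDiffOn ℝ (⊤ : ℕ∞) f U ∧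
    ∀ K ⊆ U, IsCompact K → ∀ M ∈ W, ∀ ρ : ℝ, 0 < ρ → SeqBoundedOn M ρ f U K

/-- The open ellipse `Ω_ε` with vertices `±cosh ε` and co-vertices `±i sinh ε`. -/
def Omega (ε : ℝ) : Set ℂ :=
  {z : ℂ | (z.re / Real.cosh ε) ^ 2 + (z.im / Real.sinh ε) ^ 2 < 1}

/-- `V_U = ⋃_{x ∈ U} (x + 𝔹)`. -/
def VU {E : Type*} [NormedAddCommGroup E] [NormedSpace ℝ E] (U : Set E) : Set E :=
  ⋃ x ∈ U, Metric.closedBall x 1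

/-- A weight function in the sense of Braun–Meise–Taylor. -/
structure IsWeightFunction (ω : ℝ → ℝ) : Prop where
  cont : ContinuousOn ω (Ici 0)
  mono : MonotoneOn ω (Ici 0)
  nonneg : ∀ t, 0 ≤ t → 0 ≤ ω t
  bigO : (fun t => ω (2 * t)) =O[atTop] ω
  littleO : ω =o[atTop] (fun t => t)
  logLittleO : Real.log =o[atTop] ω
  convex : ConvexOn ℝ (Ici 0) (fun t => ω (Real.exp t))

/-- The Young conjugate `φ*_ω(s) = sup_{t ≥ 0} (s t - ω(e^t))`. -/
def youngConj (ω : ℝ → ℝ) (s : ℝ) : ℝ :=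
  sSup {y : ℝ | ∃ t : ℝ, 0 ≤ t ∧ y = s * t - ω (Real.exp t)}

/-- The Roumieu class `E^{{ω}}(U)` for a weight function `ω`. -/
def RoumieuW {E F : Type*} [NormedAddCommGroup E] [NormedSpace ℝ E]
    [NormedAddCommGroup F] [NormedSpace ℝ F]
    (ω : ℝ → ℝ) (U : Set E) (f : E → F) : Prop :=
  ContDiffOn ℝ (⊤ : ℕ∞) f U ∧
    ∀ K ⊆ U, IsCompact K → ∃ C : ℝ, 0 < C ∧ ∃ ρ : ℝ, 0 < ρ ∧
      ∀ x ∈ K, ∀ k : ℕ, ‖iteratedFDerivWithin ℝ k f U x‖ ≤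
        C * Real.exp ((1 / ρ) * youngConj ω (ρ * k))

/-- The Beurling class `E^{(ω)}(U)` for a weight function `ω`. -/
def BeurlingW {E F : Type*} [NormedAddCommGroup E] [NormedSpace ℝ E]
    [NormedAddCommGroup F] [NormedSpace ℝ F]
    (ω : ℝ → ℝ) (U : Set E) (f : E → F) : Prop :=
  ContDiffOn ℝ (⊤ : ℕ∞) f U ∧
    ∀ K ⊆ U, IsCompact K → ∀ ρ : ℝ, 0 < ρ → ∃ C : ℝ, 0 < C ∧
      ∀ x ∈ K, ∀ k : ℕ, ‖iteratedFDerivWithin ℝ k f U x‖ ≤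
        C * Real.exp ((1 / ρ) * youngConj ω (ρ * k))

/-- A Bernstein–Walsh type inequality: growth of polynomials bounded on `[-1, 1]`. -/
theorem norm_eval_le_of_norm_eval_real_le {N : ℕ} {p : Polynomial ℂ} (hdeg : p.natDegree ≤ N)
    {ε : ℝ} (h : ∀ x : ℝ, |x| ≤ 1 → ‖p.eval (x : ℂ)‖ ≤ ε) {z : ℂ} (hz : ‖z‖ ≤ 10) :
    ‖p.eval z‖ ≤ ε * 21 ^ N := by
  have hε : 0 ≤ ε := (norm_nonneg _).trans (h 0 (by simp))
  set H : ℂ → ℂ := fun w => ∑ k ∈ Finset.range (N + 1),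
    p.coeff k * (w ^ (N - k) * ((w ^ 2 + 1) / 2) ^ k) with hH
  have hHeq : ∀ w : ℂ, w ≠ 0 → H w = w ^ N * p.eval ((w + w⁻¹) / 2) := by
    intro w hw
    rw [Polynomial.eval_eq_sum_range' (Nat.lt_succ_of_le hdeg), Finset.mul_sum, hH]
    refine Finset.sum_congr rfl fun k hk => ?_
    have hk : k ≤ N := Nat.lt_succ_iff.mp (Finset.mem_range.mp hk)
    have : w ^ N = w ^ (N - k) * w ^ k := by rw [← pow_add, Nat.sub_add_cancel hk]
    have h2 : (w ^ 2 + 1) / 2 = w * ((w + w⁻¹) / 2) := by field_simp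
    rw [this, h2, mul_pow]; ring
  have hHd : Differentiable ℂ H := by
    rw [hH]; fun_prop
  have hHb : ∀ w ∈ closedBall (0 : ℂ) 1, ‖H w‖ ≤ ε := by
    intro w hw
    refine Complex.norm_le_of_forall_mem_frontier_norm_le (U := ball (0 : ℂ) 1) isBounded_ball
      hHd.diffContOnCl ?_ (by rwa [closure_ball _ one_ne_zero])
    intro w hw
    rw [frontier_ball _ one_ne_zero, mem_sphere_zero_iff_norm] at hw
    have hw0 : w ≠ 0 := by rintro rfl; simp at hw
    have hre : (w + w⁻¹) / 2 = (w.re : ℂ) := by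
      rw [Complex.inv_def, Complex.normSq_eq_norm_sq, hw]
      simp [Complex.add_conj]
    rw [hHeq w hw0, hre, norm_mul, norm_pow, hw, one_pow, one_mul]
    exact h _ (hw ▸ Complex.abs_re_le_norm w)
  obtain ⟨d, hd⟩ := IsAlgClosed.exists_pow_nat_eq (z ^ 2 - 1) (n := 2) (by norm_num)
  obtain ⟨w, hw1, hwz⟩ : ∃ w : ℂ, ‖w‖ ≤ 1 ∧ w * (2 * z - w) = 1 := by
    have hprod : (z + d) * (z - d) = 1 := by linear_combination -hd
    by_cases h1 : ‖z + d‖ ≤ 1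
    · exact ⟨z + d, h1, by linear_combination hprod⟩
    · refine ⟨z - d, ?_, by linear_combination hprod⟩
      have := congrArg norm hprod
      rw [norm_mul, norm_one] at this
      by_contra! h2
      push Not at h1
      nlinarith
  have hw0 : w ≠ 0 := by rintro rfl; simp at hwz
  have hinv : w⁻¹ = 2 * z - w := by field_simp; linear_combination -hwz
  have hlow : ‖w⁻¹‖ ≤ 21 := by
    rw [hinv]
    calc ‖2 * z - w‖ ≤ ‖2 * z‖ + ‖w‖ := norm_sub_le _ _
      _ ≤ 2 * 10 + 1 := by
        rw [norm_mul]; simp only [Complex.norm_ofNat]; linarith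
      _ = 21 := by norm_num
  have key := hHeq w hw0
  have hz' : (w + w⁻¹) / 2 = z := by rw [hinv]; ring
  rw [hz'] at key
  have : p.eval z = H w * w⁻¹ ^ N := by
    rw [key, inv_pow]; field_simp
  rw [this, norm_mul, norm_pow]
  exact mul_le_mul (hHb w (by simpa using hw1)) (pow_le_pow_left₀ (norm_nonneg _) hlow _)
    (by positivity) hε

theorem norm_multiset_prod_map {ι : Type*} (s : Multiset ι) (f : ι → ℂ) :
    ‖(s.map f).prod‖ = (s.map fun i => ‖f i‖).prod := by
  induction s using Multiset.induction with
  | empty => simp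
  | cons a s ih => simp [ih]

/-- A minimum modulus estimate: if a polynomial of degree at most `N` is not small at `x₀`, then
it is not small on some circle around `x₀`. -/
theorem exists_circle_norm_eval_ge {N : ℕ} {p : Polynomial ℂ} (hdeg : p.natDegree ≤ N)
    (x₀ : ℂ) {a : ℝ} (ha : 0 ≤ a) (ha4 : a ≤ 4) :
    ∃ s ∈ Icc a (a + 1), ∀ z ∈ sphere x₀ s, ‖p.eval x₀‖ / 22 ^ N ≤ ‖p.eval z‖ := by
  by_cases hp : p.eval x₀ = 0
  · exact ⟨a, ⟨le_rfl, by linarith⟩, fun z _ => by simp [hp]⟩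
  have hp0 : p ≠ 0 := by rintro rfl; simp at hp
  rcases Nat.eq_zero_or_pos N with rfl | hN
  · refine ⟨a, ⟨le_rfl, by linarith⟩, fun z _ => ?_⟩
    rw [Polynomial.eq_C_of_natDegree_le_zero hdeg]
    simp
  set b : Polynomial ℂ := (p.roots.map fun w =>
    (1 - Polynomial.C ((‖x₀ - w‖ : ℂ)⁻¹) *
      (Polynomial.C (1 / 2 : ℂ) * Polynomial.X + Polynomial.C ((a : ℂ) + 1 / 2)))).prod with hb
  have hbeval : ∀ y : ℂ, b.eval y =
      (p.roots.map fun w => 1 - (‖x₀ - w‖ : ℂ)⁻¹ * (1 / 2 * y + (a + 1 / 2))).prod := by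
    intro y
    rw [hb, Polynomial.eval_multiset_prod, Multiset.map_map]
    congr 1
    refine Multiset.map_congr rfl fun w _ => ?_
    simp
  have hbdeg : b.natDegree ≤ N := by
    refine (Polynomial.natDegree_multiset_prod_le _).trans ?_
    rw [Multiset.map_map]
    have : (Multiset.map (Polynomial.natDegree ∘ fun w : ℂ =>
        (1 - Polynomial.C ((‖x₀ - w‖ : ℂ)⁻¹) *
      (Polynomial.C (1 / 2 : ℂ) * Polynomial.X + Polynomial.C ((a : ℂ) + 1 / 2)))) p.roots).sum
        ≤ Multiset.card p.roots • 1 := by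
      refine (Multiset.sum_le_card_nsmul _ 1 ?_).trans (by simp)
      intro n hn
      obtain ⟨w, -, rfl⟩ := Multiset.mem_map.mp hn
      simp only [Function.comp]
      compute_degree
    have h2 := p.card_roots'
    rw [smul_eq_mul, mul_one] at this
    exact this.trans (h2.trans hdeg)
  by_contra! hcon
  have hall : ∀ x : ℝ, |x| ≤ 1 → ‖b.eval (x : ℂ)‖ ≤ 1 / 22 ^ N := by
    intro x hx
    rw [abs_le] at hx
    set s : ℝ := 1 / 2 * x + (a + 1 / 2) with hs
    obtain ⟨z, hz, hlt⟩ := hcon s ⟨by rw [hs]; linarith, by rw [hs]; linarith⟩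
    have hroots : ∀ w ∈ p.roots, ‖x₀ - w‖ ≠ 0 := by
      intro w hw h0
      rw [norm_eq_zero, sub_eq_zero] at h0
      exact hp (by rw [h0]; exact (Polynomial.mem_roots hp0).mp hw)
    have e1 : ‖p.eval z‖ = ‖p.leadingCoeff‖ * (p.roots.map fun w => ‖z - w‖).prod := by
      rw [(IsAlgClosed.splits p).eval_eq_prod_roots, norm_mul, norm_multiset_prod_map]
    have e2 : ‖p.eval x₀‖ = ‖p.leadingCoeff‖ * (p.roots.map fun w => ‖x₀ - w‖).prod := by
      rw [(IsAlgClosed.splits p).eval_eq_prod_roots, norm_mul, norm_multiset_prod_map]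
    have e3 : ‖b.eval (x : ℂ)‖ * ‖p.eval x₀‖ ≤ ‖p.eval z‖ := by
      rw [hbeval, norm_multiset_prod_map, e1, e2, mul_left_comm,
        ← Multiset.prod_map_mul]
      refine mul_le_mul_of_nonneg_left ?_ (norm_nonneg _)
      refine Multiset.prod_map_le_prod_map₀ _ _ (fun w _ => by positivity) fun w hw => ?_
      have h0 := hroots w hw
      have : (1 - (‖x₀ - w‖ : ℂ)⁻¹ * (1 / 2 * (x : ℂ) + (a + 1 / 2)))
          = ((1 - ‖x₀ - w‖⁻¹ * s : ℝ) : ℂ) := by rw [hs]; push_cast; ring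
      rw [this, Complex.norm_real, Real.norm_eq_abs]
      have h3 : |1 - ‖x₀ - w‖⁻¹ * s| * ‖x₀ - w‖ = |‖x₀ - w‖ - s| := by
        conv_lhs => rw [← abs_of_nonneg (norm_nonneg (x₀ - w)), ← abs_mul, abs_norm]
        congr 1; field_simp
      rw [h3]
      rw [mem_sphere_iff_norm] at hz
      have : z - w = (x₀ - w) - (x₀ - z) := by ring
      rw [this, ← hz, norm_sub_rev z x₀]
      exact abs_norm_sub_norm_le _ _
    have hpos : 0 < ‖p.eval x₀‖ := norm_pos_iff.mpr hp
    rw [le_div_iff₀ (by positivity)]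
    rw [lt_div_iff₀ (by positivity)] at hlt
    have : ‖b.eval (x : ℂ)‖ * ‖p.eval x₀‖ * 22 ^ N ≤ ‖p.eval z‖ * 22 ^ N :=
      mul_le_mul_of_nonneg_right e3 (by positivity)
    nlinarith
  have hfin := norm_eval_le_of_norm_eval_real_le hbdeg hall (z := ((-(2 * a + 1) : ℝ) : ℂ)) (by
    rw [Complex.norm_real, Real.norm_eq_abs, abs_neg, abs_of_nonneg (by linarith)]; linarith)
  have h1 : b.eval ((-(2 * a + 1) : ℝ) : ℂ) = 1 := by
    rw [hbeval]
    have : ∀ w : ℂ, 1 - (‖x₀ - w‖ : ℂ)⁻¹ *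
        (1 / 2 * ((-(2 * a + 1) : ℝ) : ℂ) + (a + 1 / 2)) = 1 := by
      intro w; push_cast; ring
    simp only [this]
    simp
  rw [h1, norm_one, one_div, ← div_eq_inv_mul, one_le_div (by positivity)] at hfin
  exact absurd hfin (not_le.mpr (pow_lt_pow_left₀ (by norm_num) (by norm_num) hN.ne'))

theorem norm_eval_derivative_le {p : Polynomial ℂ} {M : ℝ}
    (h : ∀ z ∈ closedBall (0 : ℂ) 10, ‖p.eval z‖ ≤ M) {z : ℂ} (hz : z ∈ closedBall (0 : ℂ) 9) :
    ‖p.derivative.eval z‖ ≤ M := by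
  rw [← Polynomial.deriv]
  have := Complex.norm_deriv_le_of_forall_mem_sphere_norm_le (c := z) (R := 1) (C := M)
    (f := fun x => p.eval x) one_pos p.differentiable.diffContOnCl (fun w hw => h w ?_)
  · simpa using this
  · rw [mem_sphere_iff_norm] at hw
    rw [mem_closedBall_zero_iff] at hz ⊢
    calc ‖w‖ = ‖(w - z) + z‖ := by simp
      _ ≤ ‖w - z‖ + ‖z‖ := norm_add_le _ _
      _ ≤ 10 := by linarith

/-- Evaluation, up to an error coming from the interior pole `w`, of a Cauchy-type integral with
the two simple poles `w` and `ζ`. -/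
theorem norm_circleIntegral_two_poles_sub_le {q : ℂ → ℂ} (hq : Differentiable ℂ q) {c ζ w : ℂ}
    {s B : ℝ} (hζ : ζ ∈ ball c s) (hw : w ∉ sphere c s) (hwζ : w ≠ ζ) (hB : 0 ≤ B)
    (hqw : w ∈ ball c s → ‖q w / (w - ζ)‖ ≤ B) :
    ‖(2 * Real.pi * Complex.I : ℂ)⁻¹ * (∮ z in C(c, s), (z - w)⁻¹ * (q z / (z - ζ)))
      - q ζ * (ζ - w)⁻¹‖ ≤ B := by
  have hs : 0 < s := dist_nonneg.trans_lt hζ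
  have hpi : (2 * Real.pi * Complex.I : ℂ) ≠ 0 := Complex.two_pi_I_ne_zero
  have h0 : w - ζ ≠ 0 := sub_ne_zero.mpr hwζ
  have h0' : ζ - w ≠ 0 := sub_ne_zero.mpr hwζ.symm
  by_cases hin : w ∈ ball c s
  · have e1 : (∮ z in C(c, s), (z - w)⁻¹ * (q z / (z - ζ)))
        = ∮ z in C(c, s), ((w - ζ)⁻¹ * ((z - w)⁻¹ • q z) - (w - ζ)⁻¹ * ((z - ζ)⁻¹ • q z)) := by
      refine circleIntegral.integral_congr hs.le fun z hz => ?_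
      have hzw : z - w ≠ 0 := sub_ne_zero.mpr (by rintro rfl; exact hw hz)
      have hzζ : z - ζ ≠ 0 := sub_ne_zero.mpr (by
        rintro rfl; rw [mem_sphere] at hz; rw [mem_ball] at hζ; linarith)
      simp only [smul_eq_mul]
      field_simp
      ring
    have hInt : ∀ v ∈ ball c s, CircleIntegrable (fun z => (w - ζ)⁻¹ * ((z - v)⁻¹ • q z)) c s := by
      intro v hv
      refine ContinuousOn.circleIntegrable hs.le ?_
      refine continuousOn_const.mul ((ContinuousOn.inv₀ (f := fun z => z - v) (by fun_prop) ?_).smul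
        hq.continuous.continuousOn)
      intro z hz h
      rw [sub_eq_zero] at h
      rw [h, mem_sphere] at hz; rw [mem_ball] at hv; linarith
    have hc : ∀ v ∈ ball c s, (∮ z in C(c, s), (z - v)⁻¹ • q z) = (2 * Real.pi * Complex.I) * q v := by
      intro v hv
      rw [hq.diffContOnCl.circleIntegral_sub_inv_smul hv, smul_eq_mul]
    rw [e1, circleIntegral.integral_sub (hInt w hin) (hInt ζ hζ), circleIntegral.integral_const_mul,
      circleIntegral.integral_const_mul, hc w hin, hc ζ hζ]
    have : (2 * Real.pi * Complex.I : ℂ)⁻¹ * ((w - ζ)⁻¹ * (2 * Real.pi * Complex.I * q w)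
        - (w - ζ)⁻¹ * (2 * Real.pi * Complex.I * q ζ)) - q ζ * (ζ - w)⁻¹ = q w / (w - ζ) := by
      have : (ζ - w)⁻¹ = -(w - ζ)⁻¹ := by rw [← neg_sub, inv_neg]
      rw [this]
      field_simp
      ring
    rw [this]
    exact hqw hin
  · have hcl : ∀ z ∈ closedBall c s, z - w ≠ 0 := by
      intro z hz h
      rw [sub_eq_zero] at h
      subst h
      rw [mem_closedBall] at hz
      rw [mem_ball] at hin
      rw [mem_sphere] at hw
      exact hw (le_antisymm hz (not_lt.mp hin))
    have hd : DifferentiableOn ℂ (fun z => (z - w)⁻¹ * q z) (closedBall c s) := by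
      intro z hz
      exact (((differentiableAt_id.sub_const w).inv (hcl z hz)).mul (hq z)).differentiableWithinAt
    have e1 : (∮ z in C(c, s), (z - w)⁻¹ * (q z / (z - ζ)))
        = ∮ z in C(c, s), (z - ζ)⁻¹ • ((z - w)⁻¹ * q z) := by
      congr 1; ext z; rw [smul_eq_mul, div_eq_mul_inv]; ring
    rw [e1, (hd.diffContOnCl_ball subset_rfl).circleIntegral_sub_inv_smul hζ, smul_eq_mul]
    have : (2 * Real.pi * Complex.I : ℂ)⁻¹ * (2 * Real.pi * Complex.I * ((ζ - w)⁻¹ * q ζ))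
        - q ζ * (ζ - w)⁻¹ = 0 := by
      rw [inv_mul_cancel_left₀ hpi]; ring
    rw [this, norm_zero]
    exact hB

theorem norm_circleIntegral_multiset_poles_sub_le {q : ℂ → ℂ} (hq : Differentiable ℂ q) {c ζ : ℂ}
    {s B : ℝ} (hζ : ζ ∈ ball c s) (hB : 0 ≤ B) (Z : Multiset ℂ) (hZ : ∀ w ∈ Z, w ∉ sphere c s ∧ w ≠ ζ ∧
      (w ∈ ball c s → ‖q w / (w - ζ)‖ ≤ B)) :
    CircleIntegrable (fun z => (Z.map fun w => (z - w)⁻¹).sum * (q z / (z - ζ))) c s ∧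
    ‖(2 * Real.pi * Complex.I : ℂ)⁻¹ *
        (∮ z in C(c, s), (Z.map fun w => (z - w)⁻¹).sum * (q z / (z - ζ)))
      - q ζ * (Z.map fun w => (ζ - w)⁻¹).sum‖ ≤ Multiset.card Z * B := by
  have hs : 0 < s := dist_nonneg.trans_lt hζ
  induction Z using Multiset.induction with
  | empty => simp [circleIntegral, CircleIntegrable]
  | cons w Z ih =>
    obtain ⟨hw1, hw2, hw3⟩ := hZ w (Multiset.mem_cons_self _ _)
    obtain ⟨ih1, ih2⟩ := ih fun w' hw' => hZ w' (Multiset.mem_cons_of_mem hw')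
    have h1 : CircleIntegrable (fun z => (z - w)⁻¹ * (q z / (z - ζ))) c s := by
      refine ContinuousOn.circleIntegrable hs.le ?_
      refine (ContinuousOn.inv₀ (by fun_prop) ?_).mul
        (hq.continuous.continuousOn.div (by fun_prop) ?_)
      · intro z hz h
        rw [sub_eq_zero] at h; exact hw1 (h ▸ hz)
      · intro z hz h
        rw [sub_eq_zero] at h
        rw [h, mem_sphere] at hz; rw [mem_ball] at hζ; linarith
    have h2 := norm_circleIntegral_two_poles_sub_le hq hζ hw1 hw2 hB hw3
    simp only [Multiset.map_cons, Multiset.sum_cons, Multiset.card_cons, add_mul]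
    refine ⟨h1.add ih1, ?_⟩
    rw [circleIntegral.integral_add h1 ih1]
    calc _ = ‖((2 * Real.pi * Complex.I : ℂ)⁻¹ * (∮ z in C(c, s), (z - w)⁻¹ * (q z / (z - ζ)))
          - q ζ * (ζ - w)⁻¹) + ((2 * Real.pi * Complex.I : ℂ)⁻¹ *
        (∮ z in C(c, s), (Z.map fun w => (z - w)⁻¹).sum * (q z / (z - ζ)))
      - q ζ * (Z.map fun w => (ζ - w)⁻¹).sum)‖ := by congr 1; ring
      _ ≤ _ := (norm_add_le _ _).trans (add_le_add h2 ih2)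
      _ = _ := by push_cast; ring

/-- A quantitative residue theorem for `q p' / p`. -/
theorem norm_circleIntegral_logDeriv_sub_le {p : Polynomial ℂ} {N : ℕ} (hdeg : p.natDegree ≤ N)
    {q : ℂ → ℂ} (hq : Differentiable ℂ q) {c ζ : ℂ}
    {s B : ℝ} (hζ : ζ ∈ ball c s) (hB : 0 ≤ B) (hpζ : p.eval ζ ≠ 0)
    (hps : ∀ z ∈ sphere c s, p.eval z ≠ 0)
    (hroot : ∀ w ∈ ball c s, p.eval w = 0 → ‖q w / (w - ζ)‖ ≤ B) :
    CircleIntegrable (fun z => p.derivative.eval z / p.eval z * (q z / (z - ζ))) c s ∧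
    ‖(2 * Real.pi * Complex.I : ℂ)⁻¹ *
        (∮ z in C(c, s), p.derivative.eval z / p.eval z * (q z / (z - ζ)))
      - q ζ * (p.derivative.eval ζ / p.eval ζ)‖ ≤ N * B := by
  have hs : 0 < s := dist_nonneg.trans_lt hζ
  have hp0 : p ≠ 0 := by rintro rfl; simp at hpζ
  have hform : ∀ z, p.eval z ≠ 0 →
      p.derivative.eval z / p.eval z = (p.roots.map fun w => (z - w)⁻¹).sum := by
    intro z hz
    rw [(IsAlgClosed.splits p).eval_derivative_div_eval_of_ne_zero hz]
    simp only [one_div]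
  obtain ⟨h1, h2⟩ := norm_circleIntegral_multiset_poles_sub_le hq hζ hB p.roots (by
    intro w hw
    have hw0 : p.eval w = 0 := (Polynomial.mem_roots hp0).mp hw
    exact ⟨fun h => hps w h hw0, fun h => hpζ (h ▸ hw0), fun h => hroot w h hw0⟩)
  refine ⟨?_, ?_⟩
  · refine ContinuousOn.circleIntegrable hs.le ?_
    refine (p.derivative.continuous.continuousOn.div p.continuous.continuousOn hps).mul
        (hq.continuous.continuousOn.div (by fun_prop) ?_)
    intro z hz h
    rw [sub_eq_zero] at h
    rw [h, mem_sphere] at hz; rw [mem_ball] at hζ; linarith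
  · rw [hform ζ hpζ]
    have : (∮ z in C(c, s), p.derivative.eval z / p.eval z * (q z / (z - ζ))) =
        ∮ z in C(c, s), (p.roots.map fun w => (z - w)⁻¹).sum * (q z / (z - ζ)) :=
      circleIntegral.integral_congr hs.le fun z hz => by simp only [hform z (hps z hz)]
    rw [this]
    refine h2.trans (mul_le_mul_of_nonneg_right ?_ hB)
    exact_mod_cast p.card_roots'.trans hdeg

theorem mem_closedBall_of_mem_closedBall_of_norm_le {x₀ z : ℂ} (hx₀ : ‖x₀‖ ≤ 1) {s : ℝ} (hs : s ≤ 5)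
    (hz : z ∈ closedBall x₀ s) : ‖z‖ ≤ 6 := by
  rw [mem_closedBall_iff_norm] at hz
  calc ‖z‖ = ‖(z - x₀) + x₀‖ := by simp
    _ ≤ ‖z - x₀‖ + ‖x₀‖ := norm_add_le _ _
    _ ≤ 6 := by linarith

/-- There is a holomorphic function on a large disc that approximates `Q P' / P ^ 2` on a smaller
circle, provided `Q` is small where `P` is small. -/
theorem exists_holomorphic_near_kernel {N : ℕ} {P Q : Polynomial ℂ} (hdeg : P.natDegree ≤ N)
    (hP : ∀ z ∈ closedBall (0 : ℂ) 10, ‖P.eval z‖ ≤ 1)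
    (hQ : ∀ z ∈ closedBall (0 : ℂ) 10, ‖Q.eval z‖ ≤ 1)
    {x₀ : ℂ} (hx₀ : ‖x₀‖ ≤ 1) {s₂ s₁ ρ r σ : ℝ} (hs₂ : s₂ ∈ Icc (2 : ℝ) 3)
    (hs₁ : s₁ ∈ Icc (4 : ℝ) 5) (hρ : 0 < ρ)
    (hρ₁ : ∀ z ∈ sphere x₀ s₁, ρ ≤ ‖P.eval z‖) (hρ₂ : ∀ z ∈ sphere x₀ s₂, ρ ≤ ‖P.eval z‖)
    (hr : 0 < r) (hrρ : r ≤ ρ / 2) (hσ0 : 0 ≤ σ)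
    (hσ : ∀ z ∈ closedBall (0 : ℂ) 10, ‖P.eval z‖ ≤ r → ‖Q.eval z‖ ≤ r * σ) :
    ∃ K : ℂ → ℂ, DifferentiableOn ℂ K (ball x₀ s₁) ∧ ∀ ζ ∈ sphere x₀ s₂,
      ‖K ζ - Q.eval ζ * P.derivative.eval ζ / P.eval ζ ^ 2‖ ≤ 12 * r / ρ ^ 3 + 4 * N * σ / ρ := by
  have hs₁0 : 0 < s₁ := by linarith [hs₁.1]
  have hP' : ∀ z : ℂ, ‖z‖ ≤ 6 → ‖P.derivative.eval z‖ ≤ 1 := fun z hz =>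
    norm_eval_derivative_le hP (by rw [mem_closedBall_zero_iff]; linarith)
  have hP0 : ∀ z ∈ sphere x₀ s₁, P.eval z ≠ 0 := fun z hz h => by
    have := hρ₁ z hz; rw [h, norm_zero] at this; linarith
  have hPr : ∀ z : ℂ, ρ ≤ ‖P.eval z‖ → ρ / 2 ≤ ‖P.eval z - r‖ := by
    intro z hz
    have := norm_sub_norm_le (P.eval z) (r : ℂ)
    rw [Complex.norm_real, Real.norm_of_nonneg hr.le] at this
    linarith
  have hne : ∀ z : ℂ, ρ ≤ ‖P.eval z‖ → P.eval z ≠ 0 ∧ P.eval z - r ≠ 0 := by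
    intro z hz
    refine ⟨norm_pos_iff.mp (by linarith), norm_pos_iff.mp (by linarith [hPr z hz])⟩
  -- the common pointwise estimate
  have hpt : ∀ z : ℂ, ‖z‖ ≤ 6 → ρ ≤ ‖P.eval z‖ →
      ‖r * (Q.eval z * P.derivative.eval z) / (P.eval z ^ 2 * (P.eval z - r))‖ ≤ 2 * r / ρ ^ 3 := by
    intro z hz hz'
    rw [norm_div, norm_mul, norm_mul, norm_mul, norm_pow, Complex.norm_real,
      Real.norm_of_nonneg hr.le]
    have h1 : ‖Q.eval z‖ * ‖P.derivative.eval z‖ ≤ 1 :=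
      mul_le_one₀ (hQ z (by rw [mem_closedBall_zero_iff]; linarith)) (norm_nonneg _) (hP' z hz)
    have h2 : ρ ^ 2 * (ρ / 2) ≤ ‖P.eval z‖ ^ 2 * ‖P.eval z - r‖ :=
      mul_le_mul (pow_le_pow_left₀ hρ.le hz' 2) (hPr z hz') (by positivity) (by positivity)
    calc _ ≤ r * 1 / (ρ ^ 2 * (ρ / 2)) := by gcongr
      _ = 2 * r / ρ ^ 3 := by field_simp
  set φ : ℂ → ℂ := fun z => Q.eval z * P.derivative.eval z / P.eval z ^ 2 with hφ
  have hφc : ContinuousOn φ (sphere x₀ s₁) := by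
    refine (Q.continuous.mul P.derivative.continuous).continuousOn.div
      (P.continuous.pow 2).continuousOn fun z hz => pow_ne_zero _ (hP0 z hz)
  have hφi : CircleIntegrable φ x₀ s₁ := hφc.circleIntegrable hs₁0.le
  refine ⟨fun w => (2 * Real.pi * Complex.I : ℂ)⁻¹ • ∮ z in C(x₀, s₁), (z - w)⁻¹ • φ z, ?_, ?_⟩
  · have hs : ((s₁.toNNReal : ℝ≥0) : ℝ) = s₁ := Real.coe_toNNReal s₁ hs₁0.le
    have := (hasFPowerSeriesOn_cauchy_integral (R := s₁.toNNReal) (by rwa [hs])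
      (Real.toNNReal_pos.mpr hs₁0)).differentiableOn
    rw [hs] at this
    exact this.mono (by rw [← ENNReal.ofReal, Metric.eball_ofReal])
  intro ζ hζ
  have hζρ := hρ₂ ζ hζ
  have hζn : ‖ζ‖ ≤ 6 := mem_closedBall_of_mem_closedBall_of_norm_le hx₀ (by linarith [hs₂.2])
    (sphere_subset_closedBall hζ)
  have hζb : ζ ∈ ball x₀ s₁ := by
    rw [mem_sphere] at hζ; rw [mem_ball]; linarith [hs₂.2, hs₁.1]
  have hζd : ∀ z ∈ sphere x₀ s₁, 1 ≤ ‖z - ζ‖ := by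
    intro z hz
    rw [mem_sphere_iff_norm] at hz hζ
    have := norm_sub_norm_le (z - x₀) (ζ - x₀)
    rw [sub_sub_sub_cancel_right] at this
    linarith [hs₂.2, hs₁.1]
  have hzζ : ∀ z ∈ sphere x₀ s₁, z - ζ ≠ 0 := fun z hz =>
    norm_pos_iff.mp (zero_lt_one.trans_le (hζd z hz))
  have hres : ∀ l : ℝ, (l = 0 ∨ l = r) →
      CircleIntegrable (fun z => P.derivative.eval z / (P.eval z - l) *
        (Q.eval z / (z - ζ))) x₀ s₁ ∧
      ‖(2 * Real.pi * Complex.I : ℂ)⁻¹ * (∮ z in C(x₀, s₁),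
          P.derivative.eval z / (P.eval z - l) * (Q.eval z / (z - ζ)))
        - Q.eval ζ * (P.derivative.eval ζ / (P.eval ζ - l))‖ ≤ N * (2 * r * σ / ρ) := by
    intro l hl
    have hl0 : 0 ≤ l := by rcases hl with rfl | rfl <;> linarith
    have hlr : l ≤ r := by rcases hl with rfl | rfl <;> linarith
    have hnel : ∀ z : ℂ, ρ ≤ ‖P.eval z‖ → P.eval z - l ≠ 0 := by
      intro z hz
      rcases hl with rfl | rfl
      · simpa using (hne z hz).1
      · exact (hne z hz).2
    have := norm_circleIntegral_logDeriv_sub_le (p := P - Polynomial.C (l : ℂ)) (N := N)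
      (q := fun z => Q.eval z) (c := x₀) (ζ := ζ) (s := s₁) (B := 2 * r * σ / ρ)
      ((Polynomial.natDegree_sub_C).trans_le hdeg) Q.differentiable hζb (by positivity)
      (by simpa using hnel ζ hζρ) (fun z hz => by simpa using hnel z (hρ₁ z hz)) (by
        intro w hw hw0
        have hPw : P.eval w = l := by simpa [sub_eq_zero] using hw0
        have hw6 := mem_closedBall_of_mem_closedBall_of_norm_le hx₀ hs₁.2 (ball_subset_closedBall hw)
        have hPwr : ‖P.eval w‖ ≤ r := by
          rw [hPw, Complex.norm_real, Real.norm_of_nonneg hl0]; exact hlr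
        have hQw := hσ w (by rw [mem_closedBall_zero_iff]; linarith) hPwr
        have hdist : ρ / 2 ≤ ‖w - ζ‖ := by
          have h1 : ‖P.eval ζ - P.eval w‖ ≤ 1 * ‖ζ - w‖ :=
            (convex_closedBall (0 : ℂ) 6).norm_image_sub_le_of_norm_deriv_le
              (f := fun z => P.eval z) (fun z _ => P.differentiable z)
              (fun z hz => by
                rw [Polynomial.deriv]; exact hP' z (by simpa using hz))
              (by simpa using hw6) (by simpa using hζn)
          have h2 := norm_sub_norm_le (P.eval ζ) (P.eval w)
          rw [norm_sub_rev w ζ]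
          linarith
        rw [norm_div]
        calc _ ≤ r * σ / (ρ / 2) := by gcongr
          _ = 2 * r * σ / ρ := by field_simp)
    simpa using this
  obtain ⟨i0, b0⟩ := hres 0 (Or.inl rfl)
  obtain ⟨ir, br⟩ := hres r (Or.inr rfl)
  simp only [Complex.ofReal_zero, sub_zero] at i0 b0
  have hrc : (r : ℂ) ≠ 0 := Complex.ofReal_ne_zero.mpr hr.ne'
  set I0 := ∮ z in C(x₀, s₁), P.derivative.eval z / P.eval z * (Q.eval z / (z - ζ)) with hI0
  set Ir := ∮ z in C(x₀, s₁), P.derivative.eval z / (P.eval z - r) * (Q.eval z / (z - ζ)) with hIr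
  set S := ∮ z in C(x₀, s₁), (z - ζ)⁻¹ • φ z with hS
  have hSi : CircleIntegrable (fun z => (z - ζ)⁻¹ • φ z) x₀ s₁ := by
    refine ContinuousOn.circleIntegrable hs₁0.le ?_
    exact (ContinuousOn.inv₀ (f := fun z => z - ζ) (by fun_prop) hzζ).smul hφc
  set c : ℂ := (2 * Real.pi * Complex.I : ℂ)⁻¹ with hc
  have hdi : CircleIntegrable (fun z => (r : ℂ)⁻¹ *
        (P.derivative.eval z / (P.eval z - r) * (Q.eval z / (z - ζ)) -
          P.derivative.eval z / P.eval z * (Q.eval z / (z - ζ)))) x₀ s₁ :=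
    (ir.sub i0).const_smul (a := (r : ℂ)⁻¹)
  have hfirst : ‖c * (S - (r : ℂ)⁻¹ * (Ir - I0))‖ ≤ 5 * (2 * r / ρ ^ 3) := by
    have : S - (r : ℂ)⁻¹ * (Ir - I0) = ∮ z in C(x₀, s₁), ((z - ζ)⁻¹ • φ z - (r : ℂ)⁻¹ *
        (P.derivative.eval z / (P.eval z - r) * (Q.eval z / (z - ζ)) -
          P.derivative.eval z / P.eval z * (Q.eval z / (z - ζ)))) := by
      rw [circleIntegral.integral_sub hSi hdi,
        circleIntegral.integral_const_mul, circleIntegral.integral_sub ir i0]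
    rw [this, ← smul_eq_mul]
    refine (circleIntegral.norm_two_pi_i_inv_smul_integral_le_of_norm_le_const hs₁0.le
      (C := 2 * r / ρ ^ 3) ?_).trans ?_
    · intro z hz
      have h1 := hpt z (mem_closedBall_of_mem_closedBall_of_norm_le hx₀ hs₁.2
        (sphere_subset_closedBall hz)) (hρ₁ z hz)
      obtain ⟨n1, n2⟩ := hne z (hρ₁ z hz)
      have n3 := hzζ z hz
      have : (z - ζ)⁻¹ • φ z - (r : ℂ)⁻¹ *
        (P.derivative.eval z / (P.eval z - r) * (Q.eval z / (z - ζ)) -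
          P.derivative.eval z / P.eval z * (Q.eval z / (z - ζ))) =
          -((z - ζ)⁻¹ *
            (r * (Q.eval z * P.derivative.eval z) / (P.eval z ^ 2 * (P.eval z - r)))) := by
        rw [hφ, smul_eq_mul]
        field_simp
        ring
      rw [this, norm_neg, norm_mul, norm_inv]
      calc _ ≤ 1 * (2 * r / ρ ^ 3) := by
            refine mul_le_mul (inv_le_one_of_one_le₀ (hζd z hz)) h1 (norm_nonneg _) zero_le_one
        _ = _ := one_mul _
    · gcongr; exact hs₁.2
  have hsecond : ‖(r : ℂ)⁻¹ * (Q.eval ζ * (P.derivative.eval ζ / (P.eval ζ - r)) -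
      Q.eval ζ * (P.derivative.eval ζ / P.eval ζ)) - φ ζ‖ ≤ 2 * r / ρ ^ 3 := by
    obtain ⟨n1, n2⟩ := hne ζ hζρ
    have : (r : ℂ)⁻¹ * (Q.eval ζ * (P.derivative.eval ζ / (P.eval ζ - r)) -
      Q.eval ζ * (P.derivative.eval ζ / P.eval ζ)) - φ ζ =
        r * (Q.eval ζ * P.derivative.eval ζ) / (P.eval ζ ^ 2 * (P.eval ζ - r)) := by
      rw [hφ]
      field_simp
      ring
    rw [this]
    exact hpt ζ hζn hζρ
  have hthird : ∀ a b : ℂ, ‖a‖ ≤ N * (2 * r * σ / ρ) → ‖b‖ ≤ N * (2 * r * σ / ρ) →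
      ‖(r : ℂ)⁻¹ * (a - b)‖ ≤ 4 * N * σ / ρ := by
    intro a b ha hb
    rw [norm_mul, norm_inv, Complex.norm_real, Real.norm_of_nonneg hr.le]
    calc _ ≤ r⁻¹ * (N * (2 * r * σ / ρ) + N * (2 * r * σ / ρ)) := by
          gcongr; exact (norm_sub_le _ _).trans (add_le_add ha hb)
      _ = _ := by field_simp; ring
  have h3 := hthird _ _ br b0
  calc ‖c • S - φ ζ‖ = ‖c * (S - (r : ℂ)⁻¹ * (Ir - I0)) +
        (((r : ℂ)⁻¹ * (Q.eval ζ * (P.derivative.eval ζ / (P.eval ζ - r)) -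
      Q.eval ζ * (P.derivative.eval ζ / P.eval ζ)) - φ ζ) +
        (r : ℂ)⁻¹ * ((c * Ir - Q.eval ζ * (P.derivative.eval ζ / (P.eval ζ - r))) -
          (c * I0 - Q.eval ζ * (P.derivative.eval ζ / P.eval ζ))))‖ := by
        rw [smul_eq_mul]; congr 1; ring
    _ ≤ 5 * (2 * r / ρ ^ 3) + (2 * r / ρ ^ 3 + 4 * N * σ / ρ) :=
        (norm_add_le _ _).trans (add_le_add hfirst
          ((norm_add_le _ _).trans (add_le_add hsecond h3)))
    _ = _ := by ring

/-- A function on a circle with small derivative, vanishing at one point, is small. -/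
theorem norm_le_on_circle_of_norm_deriv_le {H H' : ℂ → ℂ} {c : ℂ} {s δ : ℝ} (hs : 0 ≤ s)
    (hs3 : s ≤ 3) (hd : ∀ z ∈ sphere c s, HasDerivAt H (H' z) z)
    (hδ : ∀ z ∈ sphere c s, ‖H' z‖ ≤ δ) (h0 : H (c + s) = 0) :
    ∀ z ∈ sphere c s, ‖H z‖ ≤ 20 * δ := by
  intro z hz
  have hδ0 : 0 ≤ δ := (norm_nonneg _).trans (hδ z hz)
  have hz' : z ∈ circleMap c s '' Ioc 0 (2 * Real.pi) := by
    rw [image_circleMap_Ioc, abs_of_nonneg hs]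
    exact hz
  obtain ⟨t, ht, rfl⟩ := hz'
  have hmem : ∀ t, circleMap c s t ∈ sphere c s := fun t => circleMap_mem_sphere c hs t
  have := (convex_univ (𝕜 := ℝ)).norm_image_sub_le_of_norm_hasDerivWithin_le
    (f := fun t : ℝ => H (circleMap c s t)) (C := δ * s) (x := 0) (y := t)
    (fun t _ => (HasDerivAt.comp t (hd _ (hmem t)) (hasDerivAt_circleMap c s t)).hasDerivWithinAt)
    (fun t _ => by
      rw [norm_mul]
      refine mul_le_mul (hδ _ (hmem t)) ?_ (norm_nonneg _) hδ0
      simp [abs_of_nonneg hs]) (mem_univ _) (mem_univ _)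
  rw [show circleMap c s 0 = c + s by simp [circleMap], h0, sub_zero, sub_zero, Real.norm_eq_abs,
    abs_of_nonneg ht.1.le] at this
  refine this.trans ?_
  have hpi := Real.pi_lt_d2
  have : t ≤ 6.3 := by linarith [ht.2]
  calc δ * s * t ≤ δ * 3 * 6.3 := by gcongr; exact ht.1.le
    _ ≤ 20 * δ := by linarith

theorem exists_holomorphic_near_quotient {j N : ℕ} (hj : 1 ≤ j) {P Q : Polynomial ℂ}
    (hdeg : P.natDegree ≤ N)
    (hP : ∀ z ∈ closedBall (0 : ℂ) 10, ‖P.eval z‖ ≤ 1)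
    (hQ : ∀ z ∈ closedBall (0 : ℂ) 10, ‖Q.eval z‖ ≤ 1)
    {x₀ : ℂ} (hx₀ : ‖x₀‖ ≤ 1) {s₂ s₁ ρ r σ η : ℝ} (hs₂ : s₂ ∈ Icc (2 : ℝ) 3)
    (hs₁ : s₁ ∈ Icc (4 : ℝ) 5) (hρ : 0 < ρ)
    (hρ₁ : ∀ z ∈ sphere x₀ s₁, ρ ≤ ‖P.eval z‖) (hρ₂ : ∀ z ∈ sphere x₀ s₂, ρ ≤ ‖P.eval z‖)
    (hr : 0 < r) (hrρ : r ≤ ρ / 2) (hσ0 : 0 ≤ σ)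
    (hσ : ∀ z ∈ closedBall (0 : ℂ) 10, ‖P.eval z‖ ≤ r → ‖Q.eval z‖ ≤ r * σ)
    (hη : ∀ z ∈ closedBall (0 : ℂ) 10, ‖(Q ^ j - P ^ (j + 1)).eval z‖ ≤ η)
    (hηρ : η ≤ ρ ^ (j + 1) / 2) :
    ∃ F : ℂ → ℂ, DifferentiableOn ℂ F (ball x₀ s₁) ∧ ∀ ζ ∈ sphere x₀ s₂,
      ‖F ζ - Q.eval ζ / P.eval ζ‖ ≤
        20 * (12 * r / ρ ^ 3 + 4 * N * σ / ρ + 2 * (j + 2) * η / ρ ^ (j + 3)) := by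
  obtain ⟨K, hKd, hK⟩ := exists_holomorphic_near_kernel hdeg hP hQ hx₀ hs₂ hs₁ hρ hρ₁ hρ₂ hr hrρ
    hσ0 hσ
  have hs₂0 : 0 ≤ s₂ := by linarith [hs₂.1]
  have hjc : (j : ℂ) ≠ 0 := by exact_mod_cast (by omega : j ≠ 0)
  obtain ⟨F, hF0, hF⟩ := (hKd.const_mul (j : ℂ)⁻¹).isExactOn_ball.with_val_at (x₀ + s₂)
    ((Q.eval (x₀ + s₂)) / P.eval (x₀ + s₂))
  have hsub : sphere x₀ s₂ ⊆ ball x₀ s₁ := fun z hz => by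
    rw [mem_sphere] at hz; rw [mem_ball]; linarith [hs₂.2, hs₁.1]
  have hPne : ∀ z ∈ sphere x₀ s₂, P.eval z ≠ 0 := fun z hz =>
    norm_pos_iff.mp (hρ.trans_le (hρ₂ z hz))
  refine ⟨F, fun z hz => (hF z hz).differentiableAt.differentiableWithinAt, ?_⟩
  refine norm_le_on_circle_of_norm_deriv_le (H := fun ζ => F ζ - Q.eval ζ / P.eval ζ)
    (H' := fun z => (j : ℂ)⁻¹ * K z -
      (Q.derivative.eval z * P.eval z - Q.eval z * P.derivative.eval z) / P.eval z ^ 2)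
    hs₂0 hs₂.2 (fun z hz => (hF z (hsub hz)).sub
      ((Q.hasDerivAt z).div (P.hasDerivAt z) (hPne z hz))) (fun z hz => ?_) (by simp [hF0])
  have hz6 : ‖z‖ ≤ 6 := mem_closedBall_of_mem_closedBall_of_norm_le hx₀ (by linarith [hs₂.2])
    (sphere_subset_closedBall hz)
  have hz10 : z ∈ closedBall (0 : ℂ) 10 := by rw [mem_closedBall_zero_iff]; linarith
  have hz9 : z ∈ closedBall (0 : ℂ) 9 := by rw [mem_closedBall_zero_iff]; linarith
  have hη0 : 0 ≤ η := (norm_nonneg _).trans (hη z hz10)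
  have hPz := hPne z hz
  set R := Q ^ j - P ^ (j + 1) with hR
  -- lower bound for `Q`
  have hQlow : ρ ^ (j + 1) / 2 ≤ ‖Q.eval z‖ ^ (j - 1) := by
    have h1 : ‖P.eval z‖ ^ (j + 1) - η ≤ ‖Q.eval z‖ ^ j := by
      have := hη z hz10
      rw [hR, Polynomial.eval_sub, Polynomial.eval_pow, Polynomial.eval_pow] at this
      have h2 := norm_sub_norm_le (P.eval z ^ (j + 1)) (Q.eval z ^ j)
      rw [norm_sub_rev, norm_pow, norm_pow] at h2
      linarith
    have h2 : ρ ^ (j + 1) ≤ ‖P.eval z‖ ^ (j + 1) := pow_le_pow_left₀ hρ.le (hρ₂ z hz) _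
    have h3 : ‖Q.eval z‖ ^ j ≤ ‖Q.eval z‖ ^ (j - 1) :=
      pow_le_pow_of_le_one (norm_nonneg _) (hQ z hz10) (Nat.sub_le _ _)
    linarith
  have hQpos : 0 < ‖Q.eval z‖ ^ (j - 1) := lt_of_lt_of_le (by positivity) hQlow
  have hQne : Q.eval z ^ (j - 1) ≠ 0 := by
    rw [← norm_pos_iff, norm_pow]; exact hQpos
  have hid : j * (Q.derivative.eval z * P.eval z) - (j + 1) * (Q.eval z * P.derivative.eval z) =
      (R.derivative.eval z * P.eval z - (j + 1) * R.eval z * P.derivative.eval z) /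
        Q.eval z ^ (j - 1) := by
    rw [eq_div_iff hQne, hR]
    obtain ⟨i, rfl⟩ : ∃ i, j = i + 1 := ⟨j - 1, by omega⟩
    simp [Polynomial.derivative_pow]
    ring
  have hlast : ‖(j * (Q.derivative.eval z * P.eval z) -
      (j + 1) * (Q.eval z * P.derivative.eval z)) / P.eval z ^ 2‖ ≤
      2 * (j + 2) * η / ρ ^ (j + 3) := by
    rw [hid, norm_div, norm_div, norm_pow, norm_pow]
    have hnum : ‖R.derivative.eval z * P.eval z - (j + 1) * R.eval z * P.derivative.eval z‖
        ≤ (j + 2) * η := by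
      have a1 := norm_eval_derivative_le hη hz9
      have a2 := hP z hz10
      have a3 := hη z hz10
      have a4 := norm_eval_derivative_le hP hz9
      have a5 : ‖(j + 1 : ℂ)‖ = j + 1 := by
        have : (j + 1 : ℂ) = ((j + 1 : ℕ) : ℂ) := by push_cast; rfl
        rw [this, Complex.norm_natCast]; push_cast; rfl
      refine (norm_sub_le _ _).trans ?_
      rw [norm_mul, norm_mul, norm_mul, a5]
      calc _ ≤ η * 1 + (j + 1) * η * 1 := by gcongr
        _ = _ := by ring
    calc _ ≤ (j + 2) * η / (ρ ^ (j + 1) / 2) / ρ ^ 2 := by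
          gcongr
          exact hρ₂ z hz
      _ = _ := by field_simp; ring
  have hjn : ‖(j : ℂ)⁻¹‖ ≤ 1 := by
    rw [norm_inv, Complex.norm_natCast]
    exact inv_le_one_of_one_le₀ (by exact_mod_cast hj)
  calc _ = ‖(j : ℂ)⁻¹ * ((K z - Q.eval z * P.derivative.eval z / P.eval z ^ 2) -
      (j * (Q.derivative.eval z * P.eval z) -
      (j + 1) * (Q.eval z * P.derivative.eval z)) / P.eval z ^ 2)‖ := by
        congr 1; field_simp; ring
    _ ≤ 1 * ((12 * r / ρ ^ 3 + 4 * N * σ / ρ) + 2 * (j + 2) * η / ρ ^ (j + 3)) := by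
        rw [norm_mul]
        refine mul_le_mul hjn ((norm_sub_le _ _).trans (add_le_add (hK z hz) hlast))
          (norm_nonneg _) zero_le_one
    _ = _ := one_mul _

theorem norm_pow_sub_pow_le_of_norm_le {a b : ℂ} {c : ℝ} (hc : 1 ≤ c) (ha : ‖a‖ ≤ c) (hb : ‖b‖ ≤ c)
    (n : ℕ) : ‖a ^ n - b ^ n‖ ≤ n * c ^ n * ‖a - b‖ := by
  induction n with
  | zero => simp
  | succ n ih =>
    calc ‖a ^ (n + 1) - b ^ (n + 1)‖ = ‖a * (a ^ n - b ^ n) + (a - b) * b ^ n‖ := by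
          congr 1; ring
      _ ≤ c * (n * c ^ n * ‖a - b‖) + ‖a - b‖ * c ^ n := by
          refine (norm_add_le _ _).trans ?_
          rw [norm_mul, norm_mul, norm_pow]
          gcongr
      _ ≤ c * (n * c ^ n * ‖a - b‖) + ‖a - b‖ * c ^ (n + 1) := by
          gcongr
          exact n.le_succ
      _ = _ := by push_cast; ring

/-- If `F` is close to `Q / P` on a circle, where `Q ^ j` is close to `P ^ (j + 1)`, then
`F ^ j` and `F ^ (j + 1)` are close to `P` and `Q` inside. -/
theorem norm_pow_sub_le_of_near_quotient {j : ℕ} (hj : 1 ≤ j) {P Q : Polynomial ℂ} {F : ℂ → ℂ}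
    {x₀ : ℂ} (hx₀ : ‖x₀‖ ≤ 1) {s₂ s₁ ρ η ε : ℝ} (hs₂ : s₂ ∈ Icc (2 : ℝ) 3)
    (hs₁ : s₁ ∈ Icc (4 : ℝ) 5) (hρ : 0 < ρ)
    (hP : ∀ z ∈ closedBall (0 : ℂ) 10, ‖P.eval z‖ ≤ 1)
    (hQ : ∀ z ∈ closedBall (0 : ℂ) 10, ‖Q.eval z‖ ≤ 1)
    (hρ₂ : ∀ z ∈ sphere x₀ s₂, ρ ≤ ‖P.eval z‖)
    (hη : ∀ z ∈ closedBall (0 : ℂ) 10, ‖(Q ^ j - P ^ (j + 1)).eval z‖ ≤ η)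
    (hηρ : η ≤ ρ ^ (j + 1)) (hF : DifferentiableOn ℂ F (ball x₀ s₁)) (hε1 : ε ≤ 1)
    (hFG : ∀ ζ ∈ sphere x₀ s₂, ‖F ζ - Q.eval ζ / P.eval ζ‖ ≤ ε) :
    ∀ z ∈ closedBall (0 : ℂ) 1, ‖F z‖ ≤ 3 ∧
      ‖F z ^ j - P.eval z‖ ≤ (j + 1) * 3 ^ (j + 1) * ε + η / ρ ^ (j + 1) ∧
      ‖F z ^ (j + 1) - Q.eval z‖ ≤ (j + 1) * 3 ^ (j + 1) * ε + η / ρ ^ (j + 1) := by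
  have hs₂0 : s₂ ≠ 0 := by linarith [hs₂.1]
  have hFc : DiffContOnCl ℂ F (ball x₀ s₂) :=
    (hF.mono (closedBall_subset_ball (by linarith [hs₂.2, hs₁.1]))).diffContOnCl_ball subset_rfl
  have hmax : ∀ (H : ℂ → ℂ) (C : ℝ), DiffContOnCl ℂ H (ball x₀ s₂) →
      (∀ ζ ∈ sphere x₀ s₂, ‖H ζ‖ ≤ C) → ∀ z ∈ closedBall (0 : ℂ) 1, ‖H z‖ ≤ C := by
    intro H C hH hb z hz
    refine Complex.norm_le_of_forall_mem_frontier_norm_le isBounded_ball hH ?_ ?_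
    · rwa [frontier_ball _ hs₂0]
    · rw [closure_ball _ hs₂0, mem_closedBall_iff_norm]
      rw [mem_closedBall_zero_iff] at hz
      linarith [norm_sub_le z x₀, hs₂.1]
  have hFpow : ∀ n, DiffContOnCl ℂ (fun z => F z ^ n) (ball x₀ s₂) := fun n =>
    ⟨hFc.1.pow n, hFc.2.pow n⟩
  have hpoly : ∀ p : Polynomial ℂ, DiffContOnCl ℂ (fun z => p.eval z) (ball x₀ s₂) := fun p =>
    p.differentiable.diffContOnCl
  have hpt : ∀ ζ ∈ sphere x₀ s₂, ‖F ζ‖ ≤ 3 ∧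
      ‖F ζ ^ j - P.eval ζ‖ ≤ (j + 1) * 3 ^ (j + 1) * ε + η / ρ ^ (j + 1) ∧
      ‖F ζ ^ (j + 1) - Q.eval ζ‖ ≤ (j + 1) * 3 ^ (j + 1) * ε + η / ρ ^ (j + 1) := by
    intro ζ hζ
    have hζ6 : ‖ζ‖ ≤ 6 := mem_closedBall_of_mem_closedBall_of_norm_le hx₀ (by linarith [hs₂.2])
      (sphere_subset_closedBall hζ)
    have hζ10 : ζ ∈ closedBall (0 : ℂ) 10 := by rw [mem_closedBall_zero_iff]; linarith
    have hη0 : 0 ≤ η := (norm_nonneg _).trans (hη ζ hζ10)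
    have hε0 : 0 ≤ ε := (norm_nonneg _).trans (hFG ζ hζ)
    have hPpos : 0 < ‖P.eval ζ‖ := hρ.trans_le (hρ₂ ζ hζ)
    have hPne : P.eval ζ ≠ 0 := norm_pos_iff.mp hPpos
    have hρ1 : ρ ≤ 1 := (hρ₂ ζ hζ).trans (hP ζ hζ10)
    set G := Q.eval ζ / P.eval ζ with hG
    have hRb := hη ζ hζ10
    simp only [Polynomial.eval_sub, Polynomial.eval_pow] at hRb
    have hG1 : ‖G ^ j - P.eval ζ‖ ≤ η / ρ ^ (j + 1) := by
      have : G ^ j - P.eval ζ = (Q.eval ζ ^ j - P.eval ζ ^ (j + 1)) / P.eval ζ ^ j := by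
        rw [hG, div_pow]; field_simp; ring
      rw [this, norm_div, norm_pow]
      calc _ ≤ η / ρ ^ j := by
            gcongr; exact hρ₂ ζ hζ
        _ ≤ _ := by
            gcongr η / ?_
            exact pow_le_pow_of_le_one hρ.le hρ1 j.le_succ
    have hG2 : ‖G ^ (j + 1) - Q.eval ζ‖ ≤ η / ρ ^ (j + 1) := by
      have : G ^ (j + 1) - Q.eval ζ =
          Q.eval ζ * (Q.eval ζ ^ j - P.eval ζ ^ (j + 1)) / P.eval ζ ^ (j + 1) := by
        rw [hG, div_pow]; field_simp; ring
      rw [this, norm_div, norm_mul, norm_pow]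
      calc _ ≤ 1 * η / ρ ^ (j + 1) := by
            gcongr
            · exact hQ ζ hζ10
            · exact hρ₂ ζ hζ
        _ = _ := by rw [one_mul]
    have hGle : ‖G‖ ≤ 2 := by
      have h1 : ‖G‖ ^ j ≤ 2 ^ j := by
        have h2 : η / ρ ^ (j + 1) ≤ 1 := (div_le_one (by positivity)).mpr hηρ
        have h3 := norm_sub_norm_le (G ^ j) (P.eval ζ)
        rw [norm_pow] at h3
        have h4 : (2 : ℝ) ^ 1 ≤ 2 ^ j := pow_le_pow_right₀ (by norm_num) hj
        linarith [hP ζ hζ10]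
      exact le_of_pow_le_pow_left₀ (by omega) (by norm_num) h1
    have hFle : ‖F ζ‖ ≤ 3 := by
      have := norm_sub_norm_le (F ζ) G
      linarith [hFG ζ hζ]
    have hdiff : ∀ n, n ≤ j + 1 → ‖F ζ ^ n - G ^ n‖ ≤ (j + 1) * 3 ^ (j + 1) * ε := by
      intro n hn
      refine (norm_pow_sub_pow_le_of_norm_le (c := 3) (by norm_num) hFle (by linarith) n).trans ?_
      have : (n : ℝ) ≤ j + 1 := by exact_mod_cast hn
      gcongr
      · norm_num
      · exact hFG ζ hζ
    refine ⟨hFle, ?_, ?_⟩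
    · have := norm_add_le (F ζ ^ j - G ^ j) (G ^ j - P.eval ζ)
      rw [sub_add_sub_cancel] at this
      linarith [hdiff j j.le_succ]
    · have := norm_add_le (F ζ ^ (j + 1) - G ^ (j + 1)) (G ^ (j + 1) - Q.eval ζ)
      rw [sub_add_sub_cancel] at this
      linarith [hdiff (j + 1) le_rfl]
  intro z hz
  exact ⟨hmax F 3 hFc (fun ζ hζ => (hpt ζ hζ).1) z hz,
    hmax (fun z => F z ^ j - P.eval z) _ ((hFpow j).sub (hpoly P)) (fun ζ hζ => (hpt ζ hζ).2.1) z hz,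
    hmax (fun z => F z ^ (j + 1) - Q.eval z) _ ((hFpow (j + 1)).sub (hpoly Q))
      (fun ζ hζ => (hpt ζ hζ).2.2) z hz⟩

/-- Two numbers with close `j`-th and `(j+1)`-st powers are close. -/
theorem norm_sub_le_of_pow_close {j : ℕ} (hj : 1 ≤ j) {a b : ℂ} {g ε : ℝ} (hg : 0 < g)
    (ha : ‖a‖ ≤ 3) (hε : ε ≤ g ^ (j + 1)) (hg1 : g ≤ 1)
    (h1 : ‖a ^ j - b ^ j‖ ≤ ε) (h2 : ‖a ^ (j + 1) - b ^ (j + 1)‖ ≤ ε) : ‖b - a‖ ≤ 4 * g := by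
  rcases le_total g ‖b‖ with h | h
  · have h3 : ‖b‖ ^ j * ‖b - a‖ ≤ 4 * ε := by
      rw [← norm_pow, ← norm_mul]
      calc ‖b ^ j * (b - a)‖ = ‖(a ^ j - b ^ j) * a - (a ^ (j + 1) - b ^ (j + 1))‖ := by
            congr 1; ring
        _ ≤ ε * 3 + ε := by
            refine (norm_sub_le _ _).trans ?_
            rw [norm_mul]
            have := (norm_nonneg _).trans h1
            gcongr
        _ = 4 * ε := by ring
    have h4 : g ^ j * ‖b - a‖ ≤ g ^ j * (4 * g) := by
      calc g ^ j * ‖b - a‖ ≤ ‖b‖ ^ j * ‖b - a‖ := by gcongr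
        _ ≤ 4 * g ^ (j + 1) := by linarith
        _ = _ := by ring
    exact le_of_mul_le_mul_left h4 (by positivity)
  · have h3 : ‖a‖ ^ j ≤ (2 * g) ^ j := by
      have h4 := norm_sub_norm_le (a ^ j) (b ^ j)
      rw [norm_pow, norm_pow] at h4
      have h5 : ‖b‖ ^ j ≤ g ^ j := by gcongr
      have h6 : g ^ (j + 1) ≤ g ^ j := pow_le_pow_of_le_one hg.le hg1 j.le_succ
      have h7 : (2 : ℝ) ^ 1 ≤ 2 ^ j := pow_le_pow_right₀ (by norm_num) hj
      rw [mul_pow]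
      have : 2 * g ^ j ≤ 2 ^ j * g ^ j := by gcongr; simpa using h7
      linarith
    have h4 : ‖a‖ ≤ 2 * g := le_of_pow_le_pow_left₀ (by omega) (by positivity) h3
    linarith [norm_sub_le b a]

set_option maxHeartbeats 2000000 in
/-- If `u ^ j` and `u ^ (j + 1)` are exponentially close to polynomials on `[-1, 1]`, then `u` is
exponentially close to a bounded holomorphic function. -/
theorem exists_holomorphic_approx_of_pow {j : ℕ} (hj : 1 ≤ j) {τ : ℝ} (hτ : 0 < τ) (hτ1 : τ < 1) :
    ∃ θ : ℝ, 0 < θ ∧ θ < 1 ∧ ∀ (N : ℕ) (P Q : Polynomial ℂ) (u : ℝ → ℂ),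
      P.natDegree ≤ N → Q.natDegree ≤ N →
      (∀ z ∈ closedBall (0 : ℂ) 10, ‖P.eval z‖ ≤ 1) →
      (∀ z ∈ closedBall (0 : ℂ) 10, ‖Q.eval z‖ ≤ 1) →
      (∀ x : ℝ, |x| ≤ 1 → ‖u x‖ ≤ 1) →
      (∀ x : ℝ, |x| ≤ 1 → ‖u x ^ j - P.eval (x : ℂ)‖ ≤ θ ^ N) →
      (∀ x : ℝ, |x| ≤ 1 → ‖u x ^ (j + 1) - Q.eval (x : ℂ)‖ ≤ θ ^ N) →
      ∃ F : ℂ → ℂ, DifferentiableOn ℂ F (ball 0 1) ∧ (∀ z ∈ ball (0 : ℂ) 1, ‖F z‖ ≤ 3) ∧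
        ∀ x : ℝ, |x| < 1 → ‖u x - F x‖ ≤ τ ^ N := by
  set γ : ℝ := τ / 4 with hγ
  set β : ℝ := τ ^ j / 2 with hβ
  set b : ℝ := β / 22 with hb
  set A : ℝ := 2 * (40 * j + 480) / b ^ (j + 3) with hA
  set B : ℝ := ((j + 1) * 3 ^ (j + 1) + 1) * A with hB
  set σ : ℝ := γ ^ (j + 1) / (2 * B) with hσ
  set θ : ℝ := σ ^ (j * (j + 1)) / ((2 * j + 1) * 21 ^ (j + 1)) with hθ
  have hγ0 : 0 < γ := by positivity
  have hγ1 : γ ≤ 1 := by rw [hγ]; linarith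
  have hβ0 : 0 < β := by positivity
  have hb0 : 0 < b := by positivity
  have hτj : τ ^ j ≤ 1 := pow_le_one₀ hτ.le hτ1.le
  have hb1 : b ≤ 1 := by rw [hb, hβ]; linarith
  have hA0 : 0 < A := by positivity
  have hA1 : 2 / b ≤ A := by
    rw [hA]
    gcongr
    · have : (0 : ℝ) ≤ j := by positivity
      linarith
    · calc b ^ (j + 3) ≤ b ^ 1 := pow_le_pow_of_le_one hb0.le hb1 (by omega)
        _ = b := pow_one b
  have hB0 : 0 < B := by positivity
  have hAB : A ≤ B := by
    rw [hB]
    have : 0 ≤ ((j : ℝ) + 1) * 3 ^ (j + 1) * A := by positivity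
    linarith
  have hσ0 : 0 < σ := by positivity
  have hBσ : 2 * B * σ = γ ^ (j + 1) := by rw [hσ]; field_simp
  have hγj : γ ^ (j + 1) ≤ 1 := pow_le_one₀ hγ0.le hγ1
  have hσb : σ ≤ b / 2 := by
    have h1 : 2 / b * σ ≤ B * σ := by gcongr; exact hA1.trans hAB
    have h2 : 2 / b * σ ≤ 1 := by
      have : 0 ≤ B * σ := by positivity
      linarith
    rw [div_mul_eq_mul_div, div_le_one hb0] at h2
    linarith
  have hσ1 : σ ≤ 1 := by linarith
  have hAσ1 : A * σ ≤ 1 := by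
    have : A * σ ≤ B * σ := by gcongr
    have : 0 ≤ B * σ := by positivity
    linarith
  have hθ0 : 0 < θ := by positivity
  clear_value θ σ B A b β γ
  have hden : (1 : ℝ) ≤ (2 * j + 1) * 21 ^ (j + 1) := by
    have : (1 : ℝ) ≤ 21 ^ (j + 1) := one_le_pow₀ (by norm_num)
    have h2 : (1 : ℝ) ≤ 2 * j + 1 := by linarith [(by positivity : (0 : ℝ) ≤ j)]
    exact one_le_mul_of_one_le_of_one_le h2 this
  have hθσ : θ ≤ σ := by
    calc θ ≤ σ ^ (j * (j + 1)) := by rw [hθ]; exact div_le_self (by positivity) hden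
      _ ≤ σ ^ 1 := pow_le_pow_of_le_one hσ0.le hσ1 (Nat.mul_pos (by omega) (by omega))
      _ = σ := pow_one σ
  have hθβ : θ ≤ β := by
    have : b ≤ β := by rw [hb]; exact div_le_self hβ0.le (by norm_num)
    linarith
  have hθ1 : θ < 1 := by linarith
  refine ⟨θ, hθ0, hθ1, ?_⟩
  intro N P Q u hPd hQd hP hQ hu huP huQ
  rcases Nat.eq_zero_or_pos N with rfl | hN
  · refine ⟨fun _ => 0, differentiableOn_const _, by simp, fun x hx => ?_⟩
    simpa using hu x hx.le
  have hbase : ∀ {a b : ℝ}, 0 ≤ a → a ≤ b → a ^ N ≤ b ^ N := fun ha hab =>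
    pow_le_pow_left₀ ha hab N
  have hself : ∀ {a : ℝ}, 1 ≤ a → a ≤ a ^ N := fun ha => le_self_pow₀ ha hN.ne'
  by_cases hsmall : ∀ x : ℝ, |x| ≤ 1 → ‖P.eval (x : ℂ)‖ ≤ β ^ N
  · refine ⟨fun _ => 0, differentiableOn_const _, by simp, fun x hx => ?_⟩
    rw [sub_zero]
    refine le_of_pow_le_pow_left₀ (n := j) (by omega) (by positivity) ?_
    have h1 := norm_sub_norm_le (u x ^ j) (P.eval (x : ℂ))
    rw [norm_pow] at h1
    have h2 := huP x hx.le
    have h3 := hsmall x hx.le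
    have h4 : θ ^ N ≤ β ^ N := hbase hθ0.le hθβ
    calc ‖u x‖ ^ j ≤ 2 * β ^ N := by linarith
      _ ≤ 2 ^ N * β ^ N := by gcongr; exact hself (by norm_num)
      _ = (2 * β) ^ N := (mul_pow _ _ _).symm
      _ = (τ ^ N) ^ j := by rw [hβ, mul_div_cancel₀ _ (two_ne_zero), ← pow_mul, ← pow_mul, mul_comm]
  push Not at hsmall
  obtain ⟨x₀, hx₀, hx₀P⟩ := hsmall
  have hx₀c : ‖(x₀ : ℂ)‖ ≤ 1 := by rwa [Complex.norm_real, Real.norm_eq_abs]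
  have hcirc : ∀ a : ℝ, 0 ≤ a → a ≤ 4 → ∃ s ∈ Icc a (a + 1), ∀ z ∈ sphere (x₀ : ℂ) s,
      b ^ N ≤ ‖P.eval z‖ := by
    intro a ha ha4
    obtain ⟨s, hs, h⟩ := exists_circle_norm_eval_ge hPd (x₀ : ℂ) ha ha4
    refine ⟨s, hs, fun z hz => le_trans ?_ (h z hz)⟩
    rw [hb, div_pow]
    gcongr
  obtain ⟨s₂, hs₂, hρ₂⟩ := hcirc 2 (by norm_num) (by norm_num)
  obtain ⟨s₁, hs₁, hρ₁⟩ := hcirc 4 (by norm_num) (by norm_num)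
  norm_num at hs₁ hs₂
  set ρ : ℝ := b ^ N with hρ
  have hρ0 : 0 < ρ := by positivity
  have hρ1 : ρ ≤ 1 := pow_le_one₀ hb0.le hb1
  set r : ℝ := σ ^ (j * N) with hr
  have hr0 : 0 < r := by positivity
  have hrσ : r ≤ σ ^ N := pow_le_pow_of_le_one hσ0.le hσ1 (Nat.le_mul_of_pos_left N (by omega))
  have hrρ : r ≤ ρ / 2 := by
    calc r ≤ σ ^ N := hrσ
      _ ≤ (b / 2) ^ N := hbase hσ0.le hσb
      _ = ρ / 2 ^ N := by rw [div_pow]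
      _ ≤ ρ / 2 := by gcongr; exact hself (by norm_num)
  set η : ℝ := (2 * j + 1) * θ ^ N * 21 ^ ((j + 1) * N) with hη
  have hηr : η ≤ r ^ (j + 1) := by
    have h1 : ((2 * j + 1) * 21 ^ (j + 1) * θ) ^ N = r ^ (j + 1) := by
      rw [hθ, mul_div_cancel₀ _ (by positivity), hr, ← pow_mul, ← pow_mul]
      congr 1; ring
    rw [← h1, mul_pow, mul_pow, ← pow_mul, hη]
    have h2 : (2 * (j : ℝ) + 1) ≤ (2 * j + 1) ^ N :=
      hself (by linarith [(by positivity : (0 : ℝ) ≤ j)])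
    calc (2 * (j : ℝ) + 1) * θ ^ N * 21 ^ ((j + 1) * N)
        = (2 * (j : ℝ) + 1) * 21 ^ ((j + 1) * N) * θ ^ N := by ring
      _ ≤ _ := by gcongr
  have hRb : ∀ z ∈ closedBall (0 : ℂ) 10, ‖(Q ^ j - P ^ (j + 1)).eval z‖ ≤ η := by
    intro z hz
    rw [mem_closedBall_zero_iff] at hz
    refine norm_eval_le_of_norm_eval_real_le (N := (j + 1) * N) ?_ (fun x hx => ?_) hz
    · refine (Polynomial.natDegree_sub_le _ _).trans (max_le ?_ ?_)
      · refine Polynomial.natDegree_pow_le.trans ?_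
        exact Nat.mul_le_mul (by omega) hQd
      · exact Polynomial.natDegree_pow_le.trans (Nat.mul_le_mul le_rfl hPd)
    · have hx10 : (x : ℂ) ∈ closedBall (0 : ℂ) 10 := by
        rw [mem_closedBall_zero_iff, Complex.norm_real, Real.norm_eq_abs]; linarith
      have a1 := norm_pow_sub_pow_le_of_norm_le (c := 1) le_rfl (a := Q.eval (x : ℂ))
        (b := u x ^ (j + 1)) (hQ _ hx10)
        (by rw [norm_pow]; exact pow_le_one₀ (norm_nonneg _) (hu x hx)) j
      have a2 := norm_pow_sub_pow_le_of_norm_le (c := 1) le_rfl (a := u x ^ j)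
        (b := P.eval (x : ℂ))
        (by rw [norm_pow]; exact pow_le_one₀ (norm_nonneg _) (hu x hx)) (hP _ hx10) (j + 1)
      rw [norm_sub_rev (Q.eval (x : ℂ))] at a1
      rw [one_pow, mul_one] at a1 a2
      have b1 : (j : ℝ) * ‖u x ^ (j + 1) - Q.eval (x : ℂ)‖ ≤ j * θ ^ N := by
        gcongr; exact huQ x hx
      have b2 : ((j + 1 : ℕ) : ℝ) * ‖u x ^ j - P.eval (x : ℂ)‖ ≤ (j + 1 : ℕ) * θ ^ N := by
        gcongr; exact huP x hx
      have a3 := norm_add_le (Q.eval (x : ℂ) ^ j - (u x ^ (j + 1)) ^ j)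
        ((u x ^ j) ^ (j + 1) - P.eval (x : ℂ) ^ (j + 1))
      rw [show (u x ^ (j + 1)) ^ j = (u x ^ j) ^ (j + 1) by rw [← pow_mul, ← pow_mul, mul_comm],
        sub_add_sub_cancel] at a3
      rw [show (u x ^ (j + 1)) ^ j = (u x ^ j) ^ (j + 1) by rw [← pow_mul, ← pow_mul, mul_comm]] at a1
      simp only [Polynomial.eval_sub, Polynomial.eval_pow]
      push_cast at b2 a2
      linarith
  have hη0 : 0 ≤ η := by positivity
  clear_value η r ρ
  have hηρ' : r ^ (j + 1) ≤ ρ ^ (j + 1) / 2 := by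
    calc r ^ (j + 1) ≤ (ρ / 2) ^ (j + 1) := by gcongr
      _ = ρ ^ (j + 1) / 2 ^ (j + 1) := div_pow _ _ _
      _ ≤ _ := by
        gcongr
        exact le_self_pow₀ (by norm_num) (by omega)
  have hηρ : η ≤ ρ ^ (j + 1) / 2 := hηr.trans hηρ'
  have hQsmall : ∀ z ∈ closedBall (0 : ℂ) 10, ‖P.eval z‖ ≤ r → ‖Q.eval z‖ ≤ r * (2 * σ ^ N) := by
    intro z hz hPz
    refine le_of_pow_le_pow_left₀ (n := j) (by omega) (by positivity) ?_
    have h1 := hRb z hz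
    simp only [Polynomial.eval_sub, Polynomial.eval_pow] at h1
    have h2 := norm_sub_norm_le (Q.eval z ^ j) (P.eval z ^ (j + 1))
    rw [norm_pow, norm_pow] at h2
    have h3 : ‖P.eval z‖ ^ (j + 1) ≤ r ^ (j + 1) := by gcongr
    have h4 : (σ ^ N) ^ j = r := by rw [hr, ← pow_mul, mul_comm]
    have h5 : (2 : ℝ) ≤ 2 ^ j := le_self_pow₀ (by norm_num) (by omega)
    calc ‖Q.eval z‖ ^ j ≤ 2 * r ^ (j + 1) := by linarith
      _ ≤ 2 ^ j * r ^ (j + 1) := by gcongr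
      _ = _ := by rw [mul_pow, mul_pow, h4]; ring
  obtain ⟨F, hFd, hF⟩ := exists_holomorphic_near_quotient hj hPd hP hQ hx₀c hs₂ hs₁ hρ0 hρ₁ hρ₂ hr0
    hrρ (σ := 2 * σ ^ N) (by positivity) hQsmall hRb hηρ
  have hησ : η ≤ σ ^ N := by
    calc η ≤ r ^ (j + 1) := hηr
      _ ≤ r ^ 1 := pow_le_pow_of_le_one hr0.le (by linarith) (by omega)
      _ ≤ σ ^ N := by rwa [pow_one]
  have hN2 : (N : ℝ) ≤ 2 ^ N := by exact_mod_cast Nat.lt_two_pow_self.le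
  have h12 : (1 : ℝ) ≤ 2 ^ N := one_le_pow₀ (by norm_num)
  have h2σ : σ ^ N ≤ 2 ^ N * σ ^ N := le_mul_of_one_le_left (pow_pos hσ0 N).le h12
  have hNσ : N * σ ^ N ≤ 2 ^ N * σ ^ N := mul_le_mul_of_nonneg_right hN2 (pow_pos hσ0 N).le
  have hε : 20 * (12 * r / ρ ^ 3 + 4 * N * (2 * σ ^ N) / ρ + 2 * (j + 2) * η / ρ ^ (j + 3))
      ≤ (A * σ) ^ N := by
    have t1 : 12 * r / ρ ^ 3 ≤ 12 * (2 ^ N * σ ^ N) / ρ ^ (j + 3) := by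
      gcongr ?_ / ?_
      · linarith
      · exact pow_le_pow_of_le_one hρ0.le hρ1 (by omega)
    have t2 : 4 * N * (2 * σ ^ N) / ρ ≤ 8 * (2 ^ N * σ ^ N) / ρ ^ (j + 3) := by
      gcongr ?_ / ?_
      · linarith
      · calc ρ ^ (j + 3) ≤ ρ ^ 1 := pow_le_pow_of_le_one hρ0.le hρ1 (by omega)
          _ = ρ := pow_one _
    have t3 : 2 * (j + 2) * η / ρ ^ (j + 3) ≤ 2 * (j + 2) * (2 ^ N * σ ^ N) / ρ ^ (j + 3) := by
      gcongr
      linarith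
    have hfac : (40 * (j : ℝ) + 480) ≤ (40 * j + 480) ^ N :=
      hself (by linarith [(by positivity : (0 : ℝ) ≤ j)])
    calc _ ≤ 20 * (12 * (2 ^ N * σ ^ N) / ρ ^ (j + 3) + 8 * (2 ^ N * σ ^ N) / ρ ^ (j + 3)
          + 2 * (j + 2) * (2 ^ N * σ ^ N) / ρ ^ (j + 3)) := by linarith
      _ = (40 * j + 480) * (2 ^ N * σ ^ N / ρ ^ (j + 3)) := by ring
      _ ≤ (40 * j + 480) ^ N * (2 ^ N * σ ^ N / ρ ^ (j + 3)) := by gcongr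
      _ = (A * σ) ^ N := by
        rw [hA, hρ, ← pow_mul b N, mul_comm N, pow_mul b (j + 3), ← mul_pow, ← div_pow, ← mul_pow]
        congr 1
        ring
  have hAσN : (A * σ) ^ N ≤ 1 := pow_le_one₀ (by positivity) hAσ1
  have hin := norm_pow_sub_le_of_near_quotient hj hx₀c hs₂ hs₁ hρ0 hP hQ hρ₂ hRb
    (by linarith [(by positivity : 0 < ρ ^ (j + 1))]) hFd (hε.trans hAσN) hF
  set ε := 20 * (12 * r / ρ ^ 3 + 4 * N * (2 * σ ^ N) / ρ + 2 * (j + 2) * η / ρ ^ (j + 3)) with hεdef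
  clear_value ε
  have hηε : η / ρ ^ (j + 1) ≤ ε := by
    have t1 : η / ρ ^ (j + 1) ≤ η / ρ ^ (j + 3) := by
      gcongr η / ?_
      exact pow_le_pow_of_le_one hρ0.le hρ1 (by omega)
    have t2 : 0 ≤ η / ρ ^ (j + 3) := by positivity
    have t3 : 0 ≤ (j : ℝ) * (η / ρ ^ (j + 3)) := by positivity
    have t4 : 0 ≤ 12 * r / ρ ^ 3 := by positivity
    have t5 : 0 ≤ 4 * N * (2 * σ ^ N) / ρ := by positivity
    have t6 : 2 * (j + 2) * η / ρ ^ (j + 3) = 2 * (j * (η / ρ ^ (j + 3))) + 4 * (η / ρ ^ (j + 3)) := by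
      ring
    rw [hεdef, t6]
    linarith
  have htot : (j + 1) * 3 ^ (j + 1) * ε + η / ρ ^ (j + 1) + θ ^ N ≤ (γ ^ N) ^ (j + 1) := by
    have hpos : (1 : ℝ) ≤ (j + 1) * 3 ^ (j + 1) + 1 := by
      linarith [(by positivity : (0 : ℝ) ≤ (j + 1) * 3 ^ (j + 1))]
    have u1 : (j + 1) * 3 ^ (j + 1) * ε + η / ρ ^ (j + 1) ≤ (B * σ) ^ N := by
      calc _ ≤ ((j + 1) * 3 ^ (j + 1) + 1) * ε := by linarith
        _ ≤ ((j + 1) * 3 ^ (j + 1) + 1) ^ N * (A * σ) ^ N := by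
          refine mul_le_mul (hself hpos) hε (le_trans (by positivity) hηε) (by positivity)
        _ = (B * σ) ^ N := by rw [hB, ← mul_pow, mul_assoc]
    have hB1 : 1 ≤ B := by
      have : 2 ≤ 2 / b := by rw [le_div_iff₀ hb0]; linarith
      linarith
    have u2 : θ ^ N ≤ (B * σ) ^ N := hbase hθ0.le (hθσ.trans (le_mul_of_one_le_left hσ0.le hB1))
    calc _ ≤ 2 * (B * σ) ^ N := by linarith
      _ ≤ 2 ^ N * (B * σ) ^ N := by gcongr; exact hself (by norm_num)
      _ = (γ ^ N) ^ (j + 1) := by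
        rw [← mul_pow, ← mul_assoc, hBσ, ← pow_mul, ← pow_mul, mul_comm]
  have hsub : ball (0 : ℂ) 1 ⊆ ball (x₀ : ℂ) s₁ := by
    intro z hz
    rw [mem_ball_zero_iff] at hz
    rw [mem_ball_iff_norm]
    linarith [norm_sub_le z (x₀ : ℂ), hs₁.1]
  refine ⟨F, hFd.mono hsub, fun z hz => (hin z (ball_subset_closedBall hz)).1, fun x hx => ?_⟩
  have hxm : (x : ℂ) ∈ closedBall (0 : ℂ) 1 := by
    rw [mem_closedBall_zero_iff, Complex.norm_real, Real.norm_eq_abs]; exact hx.le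
  obtain ⟨f1, f2, f3⟩ := hin x hxm
  have hclose := norm_sub_le_of_pow_close hj (a := F x) (b := u x) (g := γ ^ N)
    (ε := (j + 1) * 3 ^ (j + 1) * ε + η / ρ ^ (j + 1) + θ ^ N) (by positivity) f1 htot
    (pow_le_one₀ hγ0.le hγ1) (by
      have := norm_sub_le (F x ^ j - P.eval (x : ℂ)) (u x ^ j - P.eval (x : ℂ))
      rw [sub_sub_sub_cancel_right] at this
      linarith [huP x hx.le]) (by
      have := norm_sub_le (F x ^ (j + 1) - Q.eval (x : ℂ)) (u x ^ (j + 1) - Q.eval (x : ℂ))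
      rw [sub_sub_sub_cancel_right] at this
      linarith [huQ x hx.le])
  calc ‖u x - F x‖ ≤ 4 * γ ^ N := hclose
    _ ≤ 4 ^ N * γ ^ N := by gcongr; exact hself (by norm_num)
    _ = τ ^ N := by rw [← mul_pow, hγ, mul_div_cancel₀ _ (by norm_num)]

/-- Truncation of a rescaled power series with controlled coefficients. -/
theorem exists_polynomial_truncation {c : ℕ → ℂ} {t κ A : ℝ} (ht : 0 < t) (hκ : 0 < κ)
    (hκ1 : κ ≤ 1 / 20) (hc : ∀ k, ‖c k‖ * t ^ k ≤ A) (N : ℕ) :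
    ∃ P : Polynomial ℂ, P.natDegree ≤ N ∧ (∀ z ∈ closedBall (0 : ℂ) 10, ‖P.eval z‖ ≤ 2 * A) ∧
      ∀ x : ℂ, ‖x‖ ≤ 1 → ∀ g : ℂ, HasSum (fun k => c k * ((κ * t : ℝ) * x) ^ k) g →
        ‖g - P.eval x‖ ≤ 2 * A * κ ^ (N + 1) := by
  have hA : 0 ≤ A := le_trans (by positivity) (hc 0)
  set P : Polynomial ℂ := ∑ k ∈ Finset.range (N + 1),
    Polynomial.monomial k (c k * ((κ * t : ℝ) : ℂ) ^ k) with hP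
  have heval : ∀ z : ℂ, P.eval z =
      ∑ k ∈ Finset.range (N + 1), c k * ((κ * t : ℝ) * z) ^ k := by
    intro z
    rw [hP, Polynomial.eval_finsetSum]
    refine Finset.sum_congr rfl fun k _ => ?_
    rw [Polynomial.eval_monomial, mul_pow, mul_assoc]
  have hterm : ∀ (k : ℕ) (z : ℂ) (R : ℝ), ‖z‖ ≤ R →
      ‖c k * ((κ * t : ℝ) * z) ^ k‖ ≤ A * (κ * R) ^ k := by
    intro k z R hz
    rw [norm_mul, norm_pow, norm_mul, Complex.norm_real, Real.norm_of_nonneg (by positivity)]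
    calc ‖c k‖ * (κ * t * ‖z‖) ^ k = (‖c k‖ * t ^ k) * (κ * ‖z‖) ^ k := by
          rw [mul_pow, mul_pow, mul_pow]; ring
      _ ≤ A * (κ * R) ^ k := by gcongr; exact hc k
  refine ⟨P, ?_, ?_, ?_⟩
  · refine Polynomial.natDegree_sum_le_of_forall_le _ _ fun k hk => ?_
    exact (Polynomial.natDegree_monomial_le _).trans (Nat.lt_succ_iff.mp (Finset.mem_range.mp hk))
  · intro z hz
    rw [mem_closedBall_zero_iff] at hz
    rw [heval]
    calc _ ≤ ∑ k ∈ Finset.range (N + 1), A * (1 / 2) ^ k := by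
          refine norm_sum_le_of_le _ fun k _ => (hterm k z 10 hz).trans ?_
          gcongr
          linarith
      _ = A * ∑ k ∈ Finset.range (N + 1), (1 / 2 : ℝ) ^ k := by rw [Finset.mul_sum]
      _ ≤ A * 2 := by
          gcongr
          rw [geom_sum_eq (by norm_num)]
          have : (0 : ℝ) ≤ (1 / 2) ^ (N + 1) := by positivity
          rw [div_le_iff_of_neg (by norm_num)]
          linarith
      _ = 2 * A := mul_comm _ _
  · intro x hx g hg
    have := dist_le_of_le_geometric_of_tendsto κ A (by linarith)
      (f := fun n => ∑ k ∈ Finset.range n, c k * ((κ * t : ℝ) * x) ^ k) (a := g) (fun n => by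
        rw [dist_comm, dist_eq_norm, Finset.sum_range_succ, add_sub_cancel_left]
        simpa using hterm n x 1 hx) hg.tendsto_sum_nat (N + 1)
    rw [← heval, dist_comm, dist_eq_norm] at this
    refine this.trans ?_
    rw [div_le_iff₀ (by linarith)]
    have h2 : 0 ≤ A * κ ^ (N + 1) := by positivity
    nlinarith

theorem exists_half_pow_near {ε : ℝ} (hε : 0 < ε) (hε1 : ε < 1 / 2) :
    ∃ N : ℕ, 1 ≤ N ∧ (1 / 2 : ℝ) ^ (N + 1) < ε ∧ ε ≤ (1 / 2) ^ N := by
  obtain ⟨N, h1, h2⟩ := exists_nat_pow_near_of_lt_one hε (by linarith)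
    (by norm_num : (0 : ℝ) < 1 / 2) (by norm_num)
  refine ⟨N, ?_, h1, h2⟩
  by_contra h
  have : N = 0 := by omega
  subst this
  norm_num at h1
  linarith

/-- A two-constants type estimate. -/
theorem norm_le_of_norm_le_on_real {H : ℂ → ℂ} {t ε : ℝ} (ht : 0 < t) (hε : 0 < ε)
    (hH : DifferentiableOn ℂ H (ball 0 t)) (hb : ∀ z ∈ ball (0 : ℂ) t, ‖H z‖ ≤ 1)
    (hr : ∀ s : ℝ, |s| ≤ t / 168 → ‖H s‖ ≤ ε ^ 8) {z : ℂ} (hz : ‖z‖ ≤ t / 168) :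
    ‖H z‖ ≤ 2 * ε := by
  rcases le_or_gt (1 / 2) ε with hε1 | hε1
  · have := hb z (by rw [mem_ball_zero_iff]; linarith)
    linarith
  obtain ⟨N, hN, hN1, hN2⟩ := exists_half_pow_near hε hε1
  have hcoef : ∀ k, ‖iteratedDeriv k H 0 / (k.factorial : ℂ)‖ * (t / 2) ^ k ≤ 1 := by
    intro k
    have := Complex.norm_iteratedDeriv_le_of_forall_mem_sphere_norm_le (c := (0 : ℂ)) (C := 1) k
      (half_pos ht) ((hH.mono (closedBall_subset_ball (by linarith))).diffContOnCl_ball subset_rfl)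
      (fun z hz => hb z (by
        rw [mem_sphere_zero_iff_norm] at hz; rw [mem_ball_zero_iff]; linarith))
    rw [norm_div, Complex.norm_natCast, div_mul_eq_mul_div, div_le_one (by positivity)]
    rwa [mul_one, le_div_iff₀ (by positivity)] at this
  obtain ⟨P, hPd, -, hP⟩ := exists_polynomial_truncation (half_pos ht)
    (by norm_num : (0 : ℝ) < 1 / 84) (by norm_num) hcoef N
  have hsum : ∀ x : ℂ, ‖x‖ ≤ 1 → ‖H ((1 / 84 * (t / 2) : ℝ) * x) - P.eval x‖
      ≤ 2 * 1 * (1 / 84) ^ (N + 1) := by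
    intro x hx
    refine hP x hx _ ?_
    have hmem : ((1 / 84 * (t / 2) : ℝ) : ℂ) * x ∈ ball (0 : ℂ) t := by
      rw [mem_ball_zero_iff, norm_mul, Complex.norm_real, Real.norm_of_nonneg (by positivity)]
      nlinarith
    have := Complex.hasSum_taylorSeries_on_ball hH hmem
    have heq : (fun k => iteratedDeriv k H 0 / (k.factorial : ℂ) *
        (((1 / 84 * (t / 2) : ℝ) : ℂ) * x) ^ k) = fun n : ℕ => ((n.factorial : ℂ)⁻¹) •
        (((1 / 84 * (t / 2) : ℝ) : ℂ) * x - 0) ^ n • iteratedDeriv n H 0 := by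
      funext k
      simp only [smul_eq_mul, sub_zero, div_eq_mul_inv]
      ring
    rw [heq]
    exact this
  have hreal : ∀ x : ℝ, |x| ≤ 1 → ‖P.eval (x : ℂ)‖ ≤ ε ^ 8 + 2 * 1 * (1 / 84) ^ (N + 1) := by
    intro x hx
    have h1 := hsum x (by rwa [Complex.norm_real, Real.norm_eq_abs])
    have h2 := hr (1 / 84 * (t / 2) * x) (by
      rw [abs_mul, abs_of_nonneg (by positivity)]; nlinarith)
    rw [Complex.ofReal_mul] at h2
    have h3 := norm_sub_norm_le (P.eval (x : ℂ)) (H ((1 / 84 * (t / 2) : ℝ) * x))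
    rw [norm_sub_rev] at h3
    linarith
  set x : ℂ := z / (1 / 84 * (t / 2) : ℝ) with hx
  have htne : ((1 / 84 * (t / 2) : ℝ) : ℂ) ≠ 0 := Complex.ofReal_ne_zero.mpr (by positivity)
  have hx1 : ‖x‖ ≤ 1 := by
    rw [hx, norm_div, Complex.norm_real, Real.norm_of_nonneg (by positivity),
      div_le_one (by positivity)]
    linarith
  have hzx : ((1 / 84 * (t / 2) : ℝ) : ℂ) * x = z := by rw [hx, mul_div_cancel₀ _ htne]
  have h1 := hsum x hx1
  have h2 := norm_eval_le_of_norm_eval_real_le hPd hreal (z := x) (by linarith)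
  rw [hzx] at h1
  have h3 := norm_sub_norm_le (H z) (P.eval x)
  have e1 : ε ^ 8 * 21 ^ N ≤ (1 / 4) ^ N := by
    calc ε ^ 8 * 21 ^ N ≤ ((1 / 2) ^ N) ^ 8 * 21 ^ N := by gcongr
      _ = (21 / 256) ^ N := by
        rw [← pow_mul, mul_comm N 8, pow_mul, ← mul_pow]; norm_num
      _ ≤ (1 / 4) ^ N := pow_le_pow_left₀ (by norm_num) (by norm_num) N
  have e2 : (1 / 84 : ℝ) ^ (N + 1) * 21 ^ N = 1 / 84 * (1 / 4) ^ N := by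
    rw [pow_succ, mul_comm ((1 / 84 : ℝ) ^ N), mul_assoc, ← mul_pow]; norm_num
  have e3 : (1 / 84 : ℝ) ^ (N + 1) ≤ 1 / 84 * (1 / 4) ^ N := by
    rw [pow_succ, mul_comm]
    gcongr; norm_num
  have e4 : (1 / 4 : ℝ) ^ N ≤ 1 / 4 * (1 / 2) ^ N * 2 := by
    have : (1 / 4 : ℝ) ^ N = (1 / 2) ^ N * (1 / 2) ^ N := by rw [← mul_pow]; norm_num
    rw [this]
    have : (1 / 2 : ℝ) ^ N ≤ (1 / 2) ^ 1 := pow_le_pow_of_le_one (by norm_num) (by norm_num) hN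
    have h0 : (0 : ℝ) < (1 / 2) ^ N := by positivity
    nlinarith
  rw [pow_succ (1 / 2 : ℝ)] at hN1
  have h0 : (0 : ℝ) < (1 / 2) ^ N := by positivity
  rw [add_mul, mul_assoc _ _ ((21 : ℝ) ^ N), e2] at h2
  linarith

/-- Joris-type approximation at scale `t`. -/
theorem exists_holomorphic_approx_scaled {j : ℕ} (hj : 1 ≤ j) :
    ∃ (l : ℕ) (κ : ℝ), 0 < κ ∧ κ ≤ 1 / 20 ∧ ∀ (t ε : ℝ) (u : ℝ → ℂ) (c c' : ℕ → ℂ) (q q' : ℕ),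
      0 < t → 0 < ε → (∀ k < q, ‖c k‖ * t ^ k ≤ 1 / 2) → (∀ k < q', ‖c' k‖ * t ^ k ≤ 1 / 2) →
      (∀ s, |s| ≤ t → ‖u s‖ ≤ 1) →
      (∀ s, |s| ≤ t → ‖u s ^ j - ∑ k ∈ Finset.range q, c k * (s : ℂ) ^ k‖ ≤ ε ^ 2 ^ l) →
      (∀ s, |s| ≤ t → ‖u s ^ (j + 1) - ∑ k ∈ Finset.range q', c' k * (s : ℂ) ^ k‖ ≤ ε ^ 2 ^ l) →
      ∃ F : ℂ → ℂ, DifferentiableOn ℂ F (ball 0 (κ * t)) ∧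
        (∀ z ∈ ball (0 : ℂ) (κ * t), ‖F z‖ ≤ 3) ∧
        ∀ s : ℝ, |s| < κ * t → ‖u s - F s‖ ≤ 2 * ε := by
  obtain ⟨θ, hθ0, hθ1, hθ⟩ := exists_holomorphic_approx_of_pow hj
    (by norm_num : (0 : ℝ) < 1 / 2) (by norm_num)
  obtain ⟨l, hl⟩ : ∃ l : ℕ, (1 / 2 : ℝ) ^ l < θ / 2 :=
    exists_pow_lt_of_lt_one (by positivity) (by norm_num)
  set κ : ℝ := θ / 20 with hκ
  have hκ0 : 0 < κ := by positivity
  have hκ1 : κ ≤ 1 / 20 := by rw [hκ]; linarith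
  refine ⟨l, κ, hκ0, hκ1, ?_⟩
  intro t ε u c c' q q' ht hε hc hc' hu h1 h2
  have hκt : κ * t ≤ t := by nlinarith
  rcases le_or_gt (1 / 2) ε with hε1 | hε1
  · refine ⟨fun _ => 0, differentiableOn_const _, by simp, fun s hs => ?_⟩
    have := hu s (hs.le.trans hκt)
    rw [sub_zero]; linarith
  obtain ⟨N, hN, hN1, hN2⟩ := exists_half_pow_near hε hε1
  have hκθ : κ ^ (N + 1) ≤ θ ^ N / 20 := by
    have : κ ^ N ≤ θ ^ N := pow_le_pow_left₀ hκ0.le (by rw [hκ]; linarith) N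
    rw [pow_succ]
    calc κ ^ N * κ ≤ θ ^ N * (1 / 20) := by gcongr
      _ = _ := by ring
  have hεθ : ε ^ 2 ^ l ≤ θ ^ N / 2 := by
    have hl2 : l ≤ 2 ^ l := Nat.lt_two_pow_self.le
    calc ε ^ 2 ^ l ≤ ((1 / 2) ^ N) ^ 2 ^ l := by gcongr
      _ = ((1 / 2) ^ 2 ^ l) ^ N := by rw [← pow_mul, ← pow_mul, mul_comm]
      _ ≤ ((1 / 2) ^ l) ^ N := by
        refine pow_le_pow_left₀ (by positivity) ?_ N
        exact pow_le_pow_of_le_one (by norm_num) (by norm_num) hl2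
      _ ≤ (θ / 2) ^ N := by gcongr
      _ = θ ^ N / 2 ^ N := div_pow _ _ _
      _ ≤ θ ^ N / 2 := by gcongr; exact le_self_pow₀ (by norm_num) (by omega)
  -- polynomial approximations of the rescaled data
  have hpoly : ∀ (n : ℕ) (c : ℕ → ℂ) (q : ℕ), (∀ k < q, ‖c k‖ * t ^ k ≤ 1 / 2) →
      (∀ s, |s| ≤ t → ‖u s ^ n - ∑ k ∈ Finset.range q, c k * (s : ℂ) ^ k‖ ≤ ε ^ 2 ^ l) →
      ∃ P : Polynomial ℂ, P.natDegree ≤ N ∧ (∀ z ∈ closedBall (0 : ℂ) 10, ‖P.eval z‖ ≤ 1) ∧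
        ∀ x : ℝ, |x| ≤ 1 → ‖u (κ * t * x) ^ n - P.eval (x : ℂ)‖ ≤ θ ^ N := by
    intro n c q hc hn
    obtain ⟨P, hPd, hPb, hP⟩ := exists_polynomial_truncation (c := fun k => if k < q then c k else 0)
      (A := 1 / 2) ht hκ0 hκ1 (fun k => by
        split_ifs with h
        · exact hc k h
        · simp) N
    refine ⟨P, hPd, by simpa using hPb, fun x hx => ?_⟩
    have hs : |κ * t * x| ≤ t := by
      rw [abs_mul, abs_of_nonneg (by positivity)]
      calc κ * t * |x| ≤ t * 1 := by gcongr
        _ = t := mul_one t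
    have a1 := hn (κ * t * x) hs
    have a2 := hP x (by rwa [Complex.norm_real, Real.norm_eq_abs])
      (∑ k ∈ Finset.range q, c k * ((κ * t * x : ℝ) : ℂ) ^ k) (by
        have : ∀ k ∉ Finset.range q,
            (if k < q then c k else 0) * (((κ * t : ℝ) : ℂ) * (x : ℂ)) ^ k = 0 := by
          intro k hk
          rw [Finset.mem_range] at hk
          simp [hk]
        have h : HasSum (fun k => (if k < q then c k else 0) * (((κ * t : ℝ) : ℂ) * (x : ℂ)) ^ k)
            (∑ k ∈ Finset.range q, (if k < q then c k else 0) *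
              (((κ * t : ℝ) : ℂ) * (x : ℂ)) ^ k) := hasSum_sum_of_ne_finset_zero this
        convert h using 1
        refine Finset.sum_congr rfl fun k hk => ?_
        rw [if_pos (Finset.mem_range.mp hk)]
        push_cast
        rfl)
    have a3 := norm_add_le (u (κ * t * x) ^ n - ∑ k ∈ Finset.range q,
      c k * ((κ * t * x : ℝ) : ℂ) ^ k) ((∑ k ∈ Finset.range q,
      c k * ((κ * t * x : ℝ) : ℂ) ^ k) - P.eval (x : ℂ))
    rw [sub_add_sub_cancel] at a3
    have : 0 < θ ^ N := by positivity
    linarith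
  obtain ⟨P, hPd, hPb, hP⟩ := hpoly j c q hc h1
  obtain ⟨Q, hQd, hQb, hQ⟩ := hpoly (j + 1) c' q' hc' h2
  obtain ⟨F, hFd, hFb, hF⟩ := hθ N P Q (fun x => u (κ * t * x)) hPd hQd hPb hQb
    (fun x hx => hu _ (by
      rw [abs_mul, abs_of_nonneg (by positivity)]
      calc κ * t * |x| ≤ t * 1 := by gcongr
        _ = t := mul_one t)) hP hQ
  have hκtc : ((κ * t : ℝ) : ℂ) ≠ 0 := Complex.ofReal_ne_zero.mpr (by positivity)
  have hmap : ∀ z ∈ ball (0 : ℂ) (κ * t), z / (κ * t : ℝ) ∈ ball (0 : ℂ) 1 := by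
    intro z hz
    rw [mem_ball_zero_iff] at hz ⊢
    rwa [norm_div, Complex.norm_real, Real.norm_of_nonneg (by positivity),
      div_lt_one (by positivity)]
  refine ⟨fun z => F (z / (κ * t : ℝ)), ?_, fun z hz => hFb _ (hmap z hz), fun s hs => ?_⟩
  · exact hFd.comp (differentiable_id.div_const _).differentiableOn hmap
  · have := hF (s / (κ * t)) (by
      rwa [abs_div, abs_of_nonneg (by positivity : 0 ≤ κ * t), div_lt_one (by positivity)])
    rw [mul_div_cancel₀ _ (by positivity)] at this
    push_cast at this ⊢
    refine this.trans ?_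
    rw [pow_succ] at hN1
    linarith

/-- Mean value theorem for iterated forward differences. -/
theorem norm_fwdDiff_iter_sub_le {a : ℝ} (ha : 0 < a) (k : ℕ) :
    ∀ (V : ℕ → ℝ → ℂ) (x M : ℝ) (c : ℂ),
      (∀ i < k, ∀ s ∈ Icc x (x + k * a), HasDerivAt (V i) (V (i + 1) s) s) →
      (∀ s ∈ Icc x (x + k * a), ‖V k s - c‖ ≤ M) →
      ‖(fwdDiff a)^[k] (V 0) x - (a : ℂ) ^ k * c‖ ≤ M * a ^ k := by
  induction k with
  | zero =>
    intro V x M c _ hM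
    simpa using hM x (by simp)
  | succ k ih =>
    intro V x M c hV hM
    have hsub : ∀ s ∈ Icc x (x + k * a), s ∈ Icc x (x + (k + 1 : ℕ) * a) ∧
        s + a ∈ Icc x (x + (k + 1 : ℕ) * a) := by
      intro s hs
      push_cast
      exact ⟨⟨hs.1, by nlinarith [hs.2]⟩, ⟨by linarith [hs.1], by nlinarith [hs.2]⟩⟩
    have h := ih (fun i => fwdDiff a (V i)) x (M * a) (a * c) ?_ ?_
    · rw [Function.iterate_succ_apply]
      rw [show (a : ℂ) ^ (k + 1) * c = a ^ k * (a * c) by ring,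
        show M * a ^ (k + 1) = M * a * a ^ k by ring]
      exact h
    · intro i hi s hs
      exact ((hV i (by omega) _ (hsub s hs).2).comp_add_const s a).sub
        (hV i (by omega) _ (hsub s hs).1)
    · intro s hs
      have hd : ∀ y ∈ Icc s (s + a), HasDerivWithinAt (fun y : ℝ => V k y - (y : ℂ) * c)
          (V (k + 1) y - c) (Icc s (s + a)) y := by
        intro y hy
        have h1 := hV k (by omega) y
          ⟨(hsub s hs).1.1.trans hy.1, hy.2.trans (hsub s hs).2.2⟩
        have h2 := (Complex.ofRealCLM.hasDerivAt (x := y)).mul_const c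
        simp only [Complex.ofRealCLM_apply, Complex.ofReal_one, one_mul] at h2
        exact (h1.sub h2).hasDerivWithinAt
      have := Convex.norm_image_sub_le_of_norm_hasDerivWithin_le hd
        (fun y hy => hM y ⟨(hsub s hs).1.1.trans hy.1, hy.2.trans (hsub s hs).2.2⟩)
        (convex_Icc _ _) (left_mem_Icc.mpr (by linarith)) (right_mem_Icc.mpr (by linarith))
      rw [add_sub_cancel_left, Real.norm_of_nonneg ha.le] at this
      rw [show fwdDiff a (V k) s - a * c
        = V k (s + a) - ((s + a : ℝ) : ℂ) * c - (V k s - (s : ℂ) * c) by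
          simp only [fwdDiff]; push_cast; ring]
      exact this

theorem norm_fwdDiff_iter_le_two_pow {a : ℝ} (k : ℕ) :
    ∀ (w : ℝ → ℂ) (x M : ℝ), (∀ i ≤ k, ‖w (x + i * a)‖ ≤ M) →
      ‖(fwdDiff a)^[k] w x‖ ≤ 2 ^ k * M := by
  induction k with
  | zero => intro w x M h; simpa using h 0 le_rfl
  | succ k ih =>
    intro w x M h
    rw [Function.iterate_succ_apply, pow_succ, mul_assoc]
    refine ih _ x _ fun i hi => ?_
    have h1 := h i (by omega)
    have h2 := h (i + 1) (by omega)
    have h3 : x + ↑(i + 1) * a = x + i * a + a := by push_cast; ring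
    rw [h3] at h2
    simp only [fwdDiff]
    linarith [norm_sub_le (w (x + i * a + a)) (w (x + i * a))]

theorem norm_fwdDiff_iter_le_of_differentiableOn {H : ℂ → ℂ} {R M a : ℝ} {k : ℕ} (hR : 0 < R)
    (ha : 0 < a) (hH : DifferentiableOn ℂ H (ball 0 R)) (hM : ∀ z ∈ ball (0 : ℂ) R, ‖H z‖ ≤ M)
    (hk : k * a ≤ R / 4) :
    ‖(fwdDiff a)^[k] (fun s : ℝ => H s) 0‖ ≤ k.factorial * M * (2 / R) ^ k * a ^ k := by
  have hmem : ∀ s ∈ Icc (0 : ℝ) (0 + k * a), ‖(s : ℂ)‖ ≤ R / 4 := by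
    intro s hs
    rw [Complex.norm_real, Real.norm_of_nonneg hs.1]
    linarith [hs.2]
  have h := norm_fwdDiff_iter_sub_le ha k (fun i s => iteratedDeriv i H s) 0
    (k.factorial * M * (2 / R) ^ k) 0 ?_ ?_
  · simpa using h
  · intro i _ s hs
    have hsm : (s : ℂ) ∈ ball (0 : ℂ) R := by
      rw [mem_ball_zero_iff]; linarith [hmem s hs]
    have han : AnalyticAt ℂ H s := (hH.analyticOnNhd isOpen_ball) _ hsm
    have := (han.iterated_deriv i).differentiableAt.hasDerivAt
    rw [← iteratedDeriv_eq_iterate, ← iteratedDeriv_succ] at this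
    exact this.comp_ofReal
  · intro s hs
    rw [sub_zero]
    have hball : closedBall (s : ℂ) (R / 2) ⊆ ball 0 R := by
      intro z hz
      rw [mem_closedBall, dist_eq_norm] at hz
      rw [mem_ball_zero_iff]
      have := norm_add_le (z - s) (s : ℂ)
      rw [sub_add_cancel] at this
      linarith [hmem s hs]
    have := Complex.norm_iteratedDeriv_le_of_forall_mem_sphere_norm_le (c := (s : ℂ)) (C := M) k
      (half_pos hR) ((hH.mono hball).diffContOnCl_ball subset_rfl)
      (fun z hz => hM z (hball (sphere_subset_closedBall hz)))
    refine this.trans_eq ?_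
    rw [div_eq_mul_inv _ ((R / 2) ^ k), ← inv_pow, inv_div]

theorem pow_self_le_three_pow_mul_factorial (k : ℕ) : (k : ℝ) ^ k ≤ 3 ^ k * k.factorial := by
  have h := Real.pow_div_factorial_le_exp (k : ℝ) (by positivity) k
  rw [div_le_iff₀ (by positivity)] at h
  refine h.trans ?_
  gcongr
  rw [← mul_one (k : ℝ), Real.exp_nat_mul]
  gcongr
  exact Real.exp_one_lt_three.le

/-- Dyadic chaining: approximating `u ^ j` and `u ^ (j + 1)` by polynomials at every scale
controls the iterated differences of `u`. -/
theorem norm_fwdDiff_iter_le_of_pow_approx {j : ℕ} (hj : 1 ≤ j) :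
    ∃ (A : ℝ) (r : ℕ), 1 ≤ A ∧ ∀ (k : ℕ) (t₀ B : ℝ) (u : ℝ → ℂ), 0 < t₀ → 0 < B →
      (∀ s, |s| ≤ t₀ → ‖u s‖ ≤ 1) →
      (∀ n, n = j ∨ n = j + 1 → ∀ t, 0 < t → t ≤ t₀ → ∃ (c : ℕ → ℂ) (q : ℕ),
        (∀ i < q, ‖c i‖ * t ^ i ≤ 1 / 2) ∧ ∀ s, |s| ≤ t →
          ‖u s ^ n - ∑ i ∈ Finset.range q, c i * (s : ℂ) ^ i‖ ≤ (B * t ^ (k + 1)) ^ 2 ^ r) →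
      ∀ a, 0 < a → A * k * a ≤ t₀ →
        ‖(fwdDiff a)^[k] u 0‖ ≤ A ^ (k + 1) * k.factorial * ((1 / t₀) ^ k + B * t₀) * a ^ k := by
  obtain ⟨l, κ, hκ0, hκ1, hD⟩ := exists_holomorphic_approx_scaled hj
  set κ₂ : ℝ := κ / 336 with hκ₂
  have hκ₂0 : 0 < κ₂ := by positivity
  have hκ₂1 : κ₂ ≤ 1 := by rw [hκ₂]; linarith
  have hκκ₂ : κ₂ ≤ κ := by rw [hκ₂]; linarith
  have hA48 : 48 ≤ 48 / κ₂ := by rw [le_div_iff₀ hκ₂0]; nlinarith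
  refine ⟨48 / κ₂, l + 3, by linarith, ?_⟩
  intro k t₀ B u ht₀ hB hu happ a ha hAka
  rcases Nat.eq_zero_or_pos k with rfl | hk
  · simp only [Function.iterate_zero, id, Nat.factorial_zero, Nat.cast_one, pow_zero, zero_add,
      pow_one, mul_one]
    have := hu 0 (by simpa using ht₀.le)
    have : 0 ≤ B * t₀ := by positivity
    nlinarith
  have hk0 : (0 : ℝ) < k := by exact_mod_cast hk
  set T : ℕ → ℝ := fun i => t₀ * (1 / 2) ^ i with hT
  set e : ℕ → ℝ := fun i => B * T i ^ (k + 1) with he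
  have hT0 : ∀ i, 0 < T i := fun i => by positivity
  have hTle : ∀ i, T i ≤ t₀ := fun i =>
    mul_le_of_le_one_right ht₀.le (pow_le_one₀ (by norm_num) (by norm_num))
  have hTs : ∀ i, T (i + 1) = T i / 2 := fun i => by simp only [hT, pow_succ]; ring
  have he0 : ∀ i, 0 < e i := fun i => mul_pos hB (pow_pos (hT0 i) _)
  have hes : ∀ i, e (i + 1) ≤ e i := fun i => by
    simp only [he]
    have := hT0 (i + 1)
    have := hT0 i
    gcongr
    rw [hTs]; linarith
  have hT00 : T 0 = t₀ := by simp [hT]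
  have hTsum : ∀ I, ∑ i ∈ Finset.range I, T i ≤ 2 * t₀ := by
    intro I
    have : ∑ i ∈ Finset.range I, T i = 2 * t₀ - 2 * T I := by
      induction I with
      | zero => simp [hT]
      | succ I ih => rw [Finset.sum_range_succ, ih, hTs]; ring
    linarith [hT0 I]
  -- the local holomorphic approximations
  have hF : ∀ i, ∃ F : ℂ → ℂ, DifferentiableOn ℂ F (ball 0 (κ * T i)) ∧
      (∀ z ∈ ball (0 : ℂ) (κ * T i), ‖F z‖ ≤ 3) ∧
      ∀ s : ℝ, |s| < κ * T i → ‖u s - F s‖ ≤ 2 * e i ^ 8 := by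
    intro i
    obtain ⟨c, q, hc, hcq⟩ := happ j (Or.inl rfl) (T i) (hT0 i) (hTle i)
    obtain ⟨c', q', hc', hcq'⟩ := happ (j + 1) (Or.inr rfl) (T i) (hT0 i) (hTle i)
    have hee : (B * T i ^ (k + 1)) ^ 2 ^ (l + 3) = (e i ^ 8) ^ 2 ^ l := by
      simp only [he]
      rw [← pow_mul (B * T i ^ (k + 1)) 8 (2 ^ l)]
      congr 1
      ring
    rw [hee] at hcq hcq'
    exact hD (T i) (e i ^ 8) u c c' q q' (hT0 i) (pow_pos (he0 i) 8) hc hc'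
      (fun s hs => hu s (hs.trans (hTle i))) hcq hcq'
  choose F hFd hFb hFu using hF
  obtain ⟨I, hI1, hI2⟩ := exists_nat_pow_near_of_lt_one
    (x := 4 * k * a / (κ₂ * t₀)) (y := (1 / 2 : ℝ)) (by positivity)
    (by
      rw [div_le_one (by positivity)]
      have : 48 / κ₂ * k * a = 48 * k * a / κ₂ := by ring
      rw [this, div_le_iff₀ hκ₂0] at hAka
      have : 0 < (k : ℝ) * a := by positivity
      linarith) (by norm_num) (by norm_num)
  rw [div_le_iff₀ (by positivity)] at hI2
  rw [lt_div_iff₀ (by positivity)] at hI1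
  have hI2' : k * a ≤ κ₂ * T I / 4 := by simp only [hT]; linarith
  have hI1' : κ₂ * T I < 8 * (k * a) := by
    simp only [hT]
    rw [pow_succ] at hI1
    linarith
  clear_value T
  have hTanti : ∀ n i, T (i + n) ≤ T i := by
    intro n i
    induction n with
    | zero => exact le_rfl
    | succ n ih => rw [← add_assoc, hTs]; linarith [hT0 (i + n)]
  have hTi : ∀ i ≤ I, k * a ≤ κ₂ * T i / 4 := by
    intro i hi
    have := hTanti (I - i) i
    rw [Nat.add_sub_cancel' hi] at this
    have := mul_le_mul_of_nonneg_left this hκ₂0.le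
    linarith
  -- differences of consecutive approximations
  have hG : ∀ i, ∀ z : ℂ, ‖z‖ ≤ κ₂ * T i → ‖F (i + 1) z - F i z‖ ≤ 12 * e i := by
    intro i z hz
    have hmul : κ * T (i + 1) = κ * T i / 2 := by rw [hTs]; ring
    have hpos : 0 < κ * T i := mul_pos hκ0 (hT0 i)
    have hsub : ball (0 : ℂ) (κ * T (i + 1)) ⊆ ball 0 (κ * T i) :=
      ball_subset_ball (by linarith)
    have hrad : κ₂ * T i = κ * T (i + 1) / 168 := by rw [hmul, hκ₂]; ring
    have := norm_le_of_norm_le_on_real (H := fun z => (F (i + 1) z - F i z) / 6) (ε := e i)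
      (t := κ * T (i + 1)) (by linarith) (he0 i)
      (((hFd (i + 1)).sub ((hFd i).mono hsub)).div_const 6)
      (fun z hz => by
        rw [norm_div, div_le_one (by simp)]
        have h1 := hFb (i + 1) z hz
        have h2 := hFb i z (hsub hz)
        have h3 := norm_sub_le (F (i + 1) z) (F i z)
        have h4 : ‖(6 : ℂ)‖ = 6 := by simp
        linarith)
      (fun s hs => by
        have h1 := hFu (i + 1) s (by linarith)
        have h2 := hFu i s (by linarith)
        have h3 : e (i + 1) ^ 8 ≤ e i ^ 8 := pow_le_pow_left₀ (he0 _).le (hes i) 8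
        have h4 : ‖(6 : ℂ)‖ = 6 := by simp
        rw [norm_div, h4, div_le_iff₀ (by norm_num)]
        have h5 := norm_sub_le (u s - F i s) (u s - F (i + 1) s)
        rw [sub_sub_sub_cancel_left] at h5
        linarith [pow_pos (he0 i) 8]) (z := z) (by rw [← hrad]; exact hz)
    have h4 : ‖(6 : ℂ)‖ = 6 := by simp
    rw [norm_div, h4, div_le_iff₀ (by norm_num)] at this
    linarith
  have hdec : ∀ n, (fwdDiff a)^[k] u 0 = (fwdDiff a)^[k] (fun s : ℝ => F 0 s) 0
      + ∑ i ∈ Finset.range n, (fwdDiff a)^[k] (fun s : ℝ => F (i + 1) s - F i s) 0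
      + (fwdDiff a)^[k] (fun s : ℝ => u s - F n s) 0 := by
    have hadd : ∀ v w : ℝ → ℂ, (fwdDiff a)^[k] (fun s => v s + w s) 0
        = (fwdDiff a)^[k] v 0 + (fwdDiff a)^[k] w 0 := by
      intro v w
      have := congrFun (fwdDiff_iter_add a v w k) 0
      exact this
    intro n
    induction n with
    | zero =>
      rw [Finset.sum_range_zero, add_zero, ← hadd]
      simp
    | succ n ih =>
      rw [ih, Finset.sum_range_succ]
      have := hadd (fun s => F (n + 1) s - F n s) (fun s => u s - F (n + 1) s)
      simp only [add_comm, sub_add_sub_cancel] at this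
      simp only [add_comm]
      rw [this]
      ring
  have hfact : (0 : ℝ) < k.factorial := by exact_mod_cast k.factorial_pos
  have hb0 : ‖(fwdDiff a)^[k] (fun s : ℝ => F 0 s) 0‖
      ≤ k.factorial * 3 * (2 / (κ * t₀)) ^ k * a ^ k := by
    have := hTi 0 (Nat.zero_le _)
    rw [hT00] at this
    refine norm_fwdDiff_iter_le_of_differentiableOn (by positivity) ha (hT00 ▸ hFd 0)
      (hT00 ▸ hFb 0) (this.trans ?_)
    gcongr
  have hbi : ∀ i ∈ Finset.range I, ‖(fwdDiff a)^[k] (fun s : ℝ => F (i + 1) s - F i s) 0‖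
      ≤ k.factorial * 12 * B * (2 / κ₂) ^ k * a ^ k * T i := by
    intro i hi
    have hball : ball (0 : ℂ) (κ₂ * T i) ⊆ ball 0 (κ * T (i + 1)) := by
      refine ball_subset_ball ?_
      rw [hTs, hκ₂]
      nlinarith [mul_pos hκ0 (hT0 i)]
    have hball' : ball (0 : ℂ) (κ₂ * T i) ⊆ ball 0 (κ * T i) :=
      ball_subset_ball (mul_le_mul_of_nonneg_right hκκ₂ (hT0 i).le)
    refine (norm_fwdDiff_iter_le_of_differentiableOn (H := fun z => F (i + 1) z - F i z)
      (mul_pos hκ₂0 (hT0 i)) ha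
      (((hFd (i + 1)).mono hball).sub ((hFd i).mono hball'))
      (fun z hz => hG i z (mem_ball_zero_iff.mp hz).le)
      (hTi i (Finset.mem_range.mp hi).le)).trans_eq ?_
    simp only [he]
    have := (hT0 i).ne'
    rw [div_mul_eq_div_div, div_pow (2 / κ₂), pow_succ (T i)]
    generalize (2 / κ₂) ^ k = g
    field_simp
  have hbI : ‖(fwdDiff a)^[k] (fun s : ℝ => u s - F I s) 0‖
      ≤ 4 * B * t₀ * (48 / κ₂) ^ k * k.factorial * a ^ k := by
    have hpt : ∀ i ≤ k, ‖u (0 + i * a) - F I ((0 + i * a : ℝ) : ℂ)‖ ≤ 4 * e I := by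
      intro i hi
      have hia : (i : ℝ) * a ≤ k * a := by gcongr
      have hs0 : 0 ≤ (i : ℝ) * a := by positivity
      have hκT : κ₂ * T I ≤ κ * T I := mul_le_mul_of_nonneg_right hκκ₂ (hT0 I).le
      have hpos : 0 < κ₂ * T I := mul_pos hκ₂0 (hT0 I)
      have hκT1 : κ * T I ≤ t₀ := by nlinarith [hTle I, hT0 I]
      rw [zero_add]
      have hs : |(i : ℝ) * a| < κ * T I := by rw [abs_of_nonneg hs0]; linarith
      rcases le_or_gt (e I) 1 with h1 | h1
      · refine (hFu I _ hs).trans ?_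
        have : e I ^ 8 ≤ e I := pow_le_of_le_one (he0 I).le h1 (by norm_num)
        linarith [he0 I]
      · have h2 := hu _ (hs.le.trans hκT1)
        have h3 := hFb I ((i * a : ℝ) : ℂ) (by
          rwa [mem_ball_zero_iff, Complex.norm_real, Real.norm_eq_abs])
        linarith [norm_sub_le (u (i * a)) (F I ((i * a : ℝ) : ℂ))]
    refine (norm_fwdDiff_iter_le_two_pow k _ 0 _ hpt).trans ?_
    have h1 : T I ≤ 8 / κ₂ * (k * a) := by
      rw [div_mul_eq_mul_div, le_div_iff₀ hκ₂0]; linarith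
    have h2 : T I ^ k ≤ (8 / κ₂) ^ k * (3 ^ k * k.factorial) * a ^ k := by
      calc T I ^ k ≤ (8 / κ₂ * (k * a)) ^ k := pow_le_pow_left₀ (hT0 I).le h1 k
        _ = (8 / κ₂) ^ k * (k : ℝ) ^ k * a ^ k := by rw [mul_pow, mul_pow]; ring
        _ ≤ _ := by gcongr; exact pow_self_le_three_pow_mul_factorial k
    have h3 : T I ^ (k + 1) ≤ (8 / κ₂) ^ k * (3 ^ k * k.factorial) * a ^ k * t₀ := by
      rw [pow_succ]
      have := hTle I
      have := hT0 I
      gcongr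
    calc 2 ^ k * (4 * e I) = 4 * B * 2 ^ k * T I ^ (k + 1) := by simp only [he]; ring
      _ ≤ 4 * B * 2 ^ k * ((8 / κ₂) ^ k * (3 ^ k * k.factorial) * a ^ k * t₀) := by gcongr
      _ = 4 * B * t₀ * ((2 * 3 * (8 / κ₂)) ^ k) * k.factorial * a ^ k := by
        rw [mul_pow, mul_pow]; ring
      _ = _ := by congr 4; ring
  have hsum : ‖∑ i ∈ Finset.range I, (fwdDiff a)^[k] (fun s : ℝ => F (i + 1) s - F i s) 0‖
      ≤ k.factorial * 12 * B * (2 / κ₂) ^ k * a ^ k * (2 * t₀) := by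
    refine (norm_sum_le_of_le _ hbi).trans ?_
    rw [← Finset.mul_sum]
    have := hTsum I
    gcongr
  rw [hdec I]
  have h3 := norm_add₃_le (a := (fwdDiff a)^[k] (fun s : ℝ => F 0 s) 0)
    (b := ∑ i ∈ Finset.range I, (fwdDiff a)^[k] (fun s : ℝ => F (i + 1) s - F i s) 0)
    (c := (fwdDiff a)^[k] (fun s : ℝ => u s - F I s) 0)
  have hp1 : (2 / (κ * t₀)) ^ k ≤ (48 / κ₂) ^ k * (1 / t₀) ^ k := by
    rw [← mul_pow]
    gcongr
    rw [div_mul_div_comm, mul_one]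
    gcongr
    norm_num
  have hp2 : (2 / κ₂) ^ k ≤ (48 / κ₂) ^ k := by gcongr; norm_num
  have hAk : 0 < (48 / κ₂) ^ k := by positivity
  refine h3.trans ?_
  calc _ ≤ k.factorial * 3 * ((48 / κ₂) ^ k * (1 / t₀) ^ k) * a ^ k
        + k.factorial * 12 * B * (48 / κ₂) ^ k * a ^ k * (2 * t₀)
        + 4 * B * t₀ * (48 / κ₂) ^ k * k.factorial * a ^ k := by
        refine add_le_add (add_le_add (hb0.trans ?_) (hsum.trans ?_)) hbI
        · gcongr
        · gcongr
    _ = (3 * (1 / t₀) ^ k + 28 * (B * t₀)) * ((48 / κ₂) ^ k * k.factorial * a ^ k) := by ring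
    _ ≤ (48 / κ₂ * (1 / t₀) ^ k + 48 / κ₂ * (B * t₀))
          * ((48 / κ₂) ^ k * k.factorial * a ^ k) := by
        gcongr <;> linarith
    _ = _ := by rw [pow_succ]; ring

theorem card_bijective_fin (k : ℕ) :
    (Finset.univ.filter fun φ : Fin k → Fin k => Function.Bijective φ).card = k.factorial := by
  classical
  rw [← Fintype.card_subtype]
  have hp : Fintype.card (Equiv.Perm (Fin k)) = k.factorial := by
    rw [Fintype.card_perm, Fintype.card_fin]
  rw [← hp]
  exact Fintype.card_congr
    { toFun := fun φ => Equiv.ofBijective φ.1 φ.2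
      invFun := fun σ => ⟨σ, σ.bijective⟩
      left_inv := fun _ => rfl
      right_inv := fun _ => by ext; rfl }

theorem sum_neg_one_pow_of_forall_mem {k : ℕ} (φ : Fin k → Fin k) :
    (∑ S : Finset (Fin k), (-1 : ℂ) ^ Sᶜ.card * if ∀ i, φ i ∈ S then 1 else 0) =
      if Function.Bijective φ then 1 else 0 := by
  classical
  have h := Finset.prod_add (fun _ : Fin k => (1 : ℂ))
    (fun i => if i ∈ Set.range φ then 0 else -1) Finset.univ
  rw [Finset.powerset_univ] at h
  have h1 : ∀ S : Finset (Fin k), (∏ i ∈ S, (1 : ℂ)) *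
      ∏ i ∈ Finset.univ \ S, (if i ∈ Set.range φ then 0 else -1 : ℂ) =
      (-1 : ℂ) ^ Sᶜ.card * if ∀ i, φ i ∈ S then 1 else 0 := by
    intro S
    rw [Finset.prod_const_one, one_mul]
    split_ifs with hS
    · rw [mul_one, ← Finset.compl_eq_univ_sdiff, ← Finset.prod_const]
      refine Finset.prod_congr rfl fun i hi => ?_
      rw [if_neg]
      rintro ⟨m, rfl⟩
      exact (Finset.mem_compl.mp hi) (hS m)
    · push Not at hS
      obtain ⟨i, hi⟩ := hS
      rw [mul_zero]
      exact Finset.prod_eq_zero (i := φ i) (by simpa using hi) (by simp)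
  rw [Finset.sum_congr rfl fun S _ => h1 S] at h
  rw [← h]
  split_ifs with hb
  · refine Finset.prod_eq_one fun i _ => ?_
    have : i ∈ Set.range φ := hb.2 i
    rw [if_pos this, add_zero]
  · rw [← Finite.surjective_iff_bijective] at hb
    obtain ⟨i, hi⟩ := not_forall.mp hb
    exact Finset.prod_eq_zero (Finset.mem_univ i) (by
      rw [if_neg]
      · ring
      · exact hi)

/-- The polarization formula for symmetric multilinear forms. -/
theorem factorial_mul_eq_sum_of_symmetric {E : Type*} [AddCommGroup E] [Module ℝ E] {k : ℕ}
    (T : MultilinearMap ℝ (fun _ : Fin k => E) ℂ)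
    (hT : ∀ (σ : Equiv.Perm (Fin k)) (v : Fin k → E), T (v ∘ σ) = T v) (v : Fin k → E) :
    (k.factorial : ℂ) * T v =
      ∑ S : Finset (Fin k), (-1 : ℂ) ^ Sᶜ.card * T (fun _ => ∑ i ∈ S, v i) := by
  classical
  have h1 : ∀ S : Finset (Fin k), T (fun _ => ∑ i ∈ S, v i) =
      ∑ φ : Fin k → Fin k, (if ∀ i, φ i ∈ S then 1 else 0) * T (v ∘ φ) := by
    intro S
    rw [T.map_sum_finset (fun _ => v) (fun _ => S)]
    simp_rw [ite_mul, one_mul, zero_mul]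
    rw [← Finset.sum_filter]
    refine Finset.sum_congr ?_ fun _ _ => rfl
    ext φ
    simp [Fintype.mem_piFinset]
  simp_rw [h1, Finset.mul_sum]
  rw [Finset.sum_comm]
  simp_rw [← mul_assoc, ← Finset.sum_mul, sum_neg_one_pow_of_forall_mem, ite_mul, one_mul,
    zero_mul]
  rw [← Finset.sum_filter, ← card_bijective_fin, ← nsmul_eq_mul, ← Finset.sum_const]
  refine Finset.sum_congr rfl fun φ hφ => ?_
  exact (hT (Equiv.ofBijective φ (Finset.mem_filter.mp hφ).2) v).symm

/-- The norm of a symmetric multilinear form is controlled by its values on the diagonal. -/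
theorem norm_le_of_norm_diagonal_le {E : Type*} [NormedAddCommGroup E] [NormedSpace ℝ E] {k : ℕ}
    (T : ContinuousMultilinearMap ℝ (fun _ : Fin k => E) ℂ)
    (hT : ∀ (σ : Equiv.Perm (Fin k)) (v : Fin k → E), T (v ∘ σ) = T v) {C : ℝ} (hC : 0 ≤ C)
    (h : ∀ v : E, ‖v‖ ≤ 1 → ‖T (fun _ => v)‖ ≤ C) : ‖T‖ ≤ 6 ^ k * C := by
  have hdiag : ∀ v : E, ‖v‖ ≤ k → ‖T (fun _ => v)‖ ≤ k ^ k * C := by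
    intro v hv
    have hv' : (fun _ : Fin k => v) = fun _ => (k : ℝ) • ((k : ℝ)⁻¹ • v) := by
      funext i
      have : (k : ℝ) ≠ 0 := by
        have := i.pos
        positivity
      rw [smul_smul, mul_inv_cancel₀ this, one_smul]
    rw [hv', T.map_smul_univ (fun _ => (k : ℝ)), Finset.prod_const, Finset.card_univ,
      Fintype.card_fin, norm_smul, norm_pow, Real.norm_natCast]
    gcongr
    refine h _ ?_
    rw [norm_smul, norm_inv, Real.norm_natCast]
    exact inv_mul_le_one_of_le₀ hv (by positivity)
  have hunit : ∀ v : Fin k → E, (∀ i, ‖v i‖ ≤ 1) → ‖T v‖ ≤ 6 ^ k * C := by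
    intro v hv
    have hpol := factorial_mul_eq_sum_of_symmetric T.toMultilinearMap hT v
    have hn : (k.factorial : ℝ) * ‖T v‖ ≤ 2 ^ k * (k ^ k * C) := by
      calc (k.factorial : ℝ) * ‖T v‖ = ‖(k.factorial : ℂ) * T v‖ := by
            rw [norm_mul, Complex.norm_natCast]
        _ ≤ ∑ S : Finset (Fin k), (k ^ k * C : ℝ) := by
            rw [show T v = T.toMultilinearMap v from rfl, hpol]
            refine norm_sum_le_of_le _ fun S _ => ?_
            rw [norm_mul, norm_pow, norm_neg, norm_one, one_pow, one_mul]
            refine hdiag _ ?_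
            refine (norm_sum_le_of_le _ fun i _ => hv i).trans ?_
            rw [Finset.sum_const, nsmul_eq_mul, mul_one]
            exact_mod_cast (Finset.card_le_univ S).trans_eq (Fintype.card_fin k)
        _ = 2 ^ k * (k ^ k * C) := by
            rw [Finset.sum_const, Finset.card_univ, Fintype.card_finset, Fintype.card_fin,
              nsmul_eq_mul]
            push_cast
            rfl
    have hf : (0 : ℝ) < k.factorial := by exact_mod_cast k.factorial_pos
    refine le_of_mul_le_mul_left (hn.trans ?_) hf
    calc 2 ^ k * ((k : ℝ) ^ k * C) ≤ 2 ^ k * (3 ^ k * k.factorial * C) := by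
          gcongr; exact pow_self_le_three_pow_mul_factorial k
      _ = k.factorial * ((2 * 3) ^ k * C) := by rw [mul_pow]; ring
      _ = _ := by norm_num
  refine ContinuousMultilinearMap.opNorm_le_bound (by positivity) fun m => ?_
  have hm : m = fun i => ‖m i‖ • (‖m i‖⁻¹ • m i) := by
    funext i
    by_cases h0 : m i = 0
    · simp [h0]
    · rw [smul_smul, mul_inv_cancel₀ (norm_ne_zero_iff.mpr h0), one_smul]
  have := hunit (fun i => ‖m i‖⁻¹ • m i) (fun i => by
    rw [norm_smul, norm_inv, norm_norm]
    exact inv_mul_le_one)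
  calc ‖T m‖ = (∏ i, ‖m i‖) * ‖T (fun i => ‖m i‖⁻¹ • m i)‖ := by
        conv_lhs => rw [hm]
        rw [T.map_smul_univ, norm_smul, Real.norm_of_nonneg (by positivity)]
    _ ≤ (∏ i, ‖m i‖) * (6 ^ k * C) := by gcongr
    _ = _ := mul_comm _ _

theorem contDiff_iteratedFDeriv_of_contDiff {E : Type*} [NormedAddCommGroup E] [NormedSpace ℝ E]
    {f : E → ℂ} (hf : ContDiff ℝ (⊤ : ℕ∞) f) (n : ℕ) :
    ContDiff ℝ (⊤ : ℕ∞) (iteratedFDeriv ℝ n f) :=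
  hf.iteratedFDeriv_right (m := (⊤ : ℕ∞)) (by exact_mod_cast (le_top : (⊤ : ℕ∞) + (n : ℕ∞) ≤ ⊤))

theorem hasFDerivAt_iteratedFDeriv_apply {E : Type*} [NormedAddCommGroup E] [NormedSpace ℝ E]
    {f : E → ℂ} (hf : ContDiff ℝ (⊤ : ℕ∞) f) (n : ℕ) (x : E) (u : Fin n → E) :
    HasFDerivAt (fun y => iteratedFDeriv ℝ n f y u)
      ((ContinuousMultilinearMap.apply ℝ (fun _ : Fin n => E) ℂ u).comp
        (fderiv ℝ (iteratedFDeriv ℝ n f) x)) x :=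
  (ContinuousMultilinearMap.apply ℝ (fun _ : Fin n => E) ℂ u).hasFDerivAt.comp x
    ((contDiff_iteratedFDeriv_of_contDiff hf n).differentiable (by simp) x).hasFDerivAt

theorem iteratedFDeriv_succ_apply_eq_fderiv {E : Type*} [NormedAddCommGroup E] [NormedSpace ℝ E]
    {f : E → ℂ} (hf : ContDiff ℝ (⊤ : ℕ∞) f) (n : ℕ) (x : E) (v : Fin (n + 1) → E) :
    iteratedFDeriv ℝ (n + 1) f x v =
      fderiv ℝ (fun y => iteratedFDeriv ℝ n f y (Fin.tail v)) x (v 0) := by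
  rw [iteratedFDeriv_succ_apply_left, (hasFDerivAt_iteratedFDeriv_apply hf n x _).fderiv]
  rfl

theorem iteratedFDeriv_add_two_apply {E : Type*} [NormedAddCommGroup E] [NormedSpace ℝ E]
    {f : E → ℂ} (hf : ContDiff ℝ (⊤ : ℕ∞) f) (n : ℕ) (x : E) (v : Fin (n + 2) → E) :
    iteratedFDeriv ℝ (n + 2) f x v = fderiv ℝ (fderiv ℝ
      (fun y => iteratedFDeriv ℝ n f y (fun i => v i.succ.succ))) x (v 0) (v 1) := by
  have hg : ContDiff ℝ (⊤ : ℕ∞) (fun y => iteratedFDeriv ℝ n f y (fun i => v i.succ.succ)) :=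
    (ContinuousMultilinearMap.apply ℝ (fun _ : Fin n => E) ℂ _).contDiff.comp
      (contDiff_iteratedFDeriv_of_contDiff hf n)
  have hd : DifferentiableAt ℝ (fderiv ℝ
      (fun y => iteratedFDeriv ℝ n f y (fun i => v i.succ.succ))) x :=
    ((contDiff_infty_iff_fderiv.mp hg).2).differentiable (by simp) x
  rw [iteratedFDeriv_succ_apply_eq_fderiv hf]
  simp_rw [iteratedFDeriv_succ_apply_eq_fderiv hf]
  have h := hd.hasFDerivAt.clm_apply (hasFDerivAt_const (v 1) x)
  have h2 : (fun y => fderiv ℝ (fun z => iteratedFDeriv ℝ n f z (Fin.tail (Fin.tail v))) y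
      (Fin.tail v 0)) = fun y => fderiv ℝ
      (fun y => iteratedFDeriv ℝ n f y (fun i => v i.succ.succ)) y (v 1) := rfl
  rw [h2, h.fderiv]
  simp

/-- Symmetry of the iterated derivatives of a smooth function. -/
theorem iteratedFDeriv_comp_perm_of_contDiff {E : Type*} [NormedAddCommGroup E] [NormedSpace ℝ E]
    {f : E → ℂ} (hf : ContDiff ℝ (⊤ : ℕ∞) f) (n : ℕ) :
    ∀ (x : E) (σ : Equiv.Perm (Fin n)) (v : Fin n → E),
      iteratedFDeriv ℝ n f x (v ∘ σ) = iteratedFDeriv ℝ n f x v := by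
  induction n with
  | zero =>
    intro x σ v
    congr 1
    exact Subsingleton.elim _ _
  | succ n ih =>
    intro x σ
    let Q : Submonoid (Equiv.Perm (Fin (n + 1))) :=
      { carrier := {σ | ∀ v : Fin (n + 1) → E,
          iteratedFDeriv ℝ (n + 1) f x (v ∘ σ) = iteratedFDeriv ℝ (n + 1) f x v}
        one_mem' := fun v => rfl
        mul_mem' := by
          intro a b ha hb v
          rw [Equiv.Perm.coe_mul, ← Function.comp_assoc, hb, ha] }
    suffices h : Q = ⊤ by
      have : σ ∈ Q := by rw [h]; trivial
      exact this
    rw [eq_top_iff, ← Equiv.Perm.mclosure_swap_castSucc_succ, Submonoid.closure_le]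
    rintro _ ⟨i, rfl⟩ v
    cases n with
    | zero => exact i.elim0
    | succ n =>
      induction i using Fin.cases with
      | zero =>
        rw [iteratedFDeriv_add_two_apply hf, iteratedFDeriv_add_two_apply hf]
        have hsymm : IsSymmSndFDerivAt ℝ
            (fun y => iteratedFDeriv ℝ n f y (fun i => v i.succ.succ)) x :=
          (contDiff_infty.mp ((ContinuousMultilinearMap.apply ℝ (fun _ : Fin n => E) ℂ
            _).contDiff.comp (contDiff_iteratedFDeriv_of_contDiff hf n)) 2).contDiffAt.isSymmSndFDerivAt (by simp)
        have h2 : (fun i : Fin n => (v ∘ Equiv.swap (Fin.castSucc 0) (Fin.succ 0)) i.succ.succ)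
            = fun i => v i.succ.succ := by
          funext i
          rw [Function.comp_apply, Equiv.swap_apply_of_ne_of_ne]
          · simp [Fin.ext_iff]
          · simp [Fin.ext_iff]
        rw [h2]
        have h0 : (v ∘ Equiv.swap (Fin.castSucc (0 : Fin (n + 1))) (Fin.succ 0)) 0 = v 1 := by
          simp
        have h1 : (v ∘ Equiv.swap (Fin.castSucc (0 : Fin (n + 1))) (Fin.succ 0)) 1 = v 0 := by
          have : (1 : Fin (n + 2)) = Fin.succ 0 := rfl
          rw [this]
          simp
        rw [h0, h1, hsymm.eq]
      | succ i =>
        rw [iteratedFDeriv_succ_apply_eq_fderiv hf, iteratedFDeriv_succ_apply_eq_fderiv hf]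
        have h0 : (v ∘ Equiv.swap i.succ.castSucc i.succ.succ) 0 = v 0 := by
          rw [Function.comp_apply, Equiv.swap_apply_of_ne_of_ne]
          · simp [Fin.ext_iff]
          · simp [Fin.ext_iff]
        have ht : Fin.tail (v ∘ Equiv.swap i.succ.castSucc i.succ.succ) =
            Fin.tail v ∘ Equiv.swap i.castSucc i.succ := by
          funext m
          simp only [Fin.tail, Function.comp_apply]
          congr 1
          rw [← Fin.succ_castSucc]
          exact ((Fin.succ_injective _).swap_apply _ _ _)
        rw [h0, ht]
        congr 2
        funext y
        exact ih y _ _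

/-- Taylor's formula with remainder for a family of successive derivatives on `[0, t]`. -/
theorem norm_sub_taylor_le_of_nonneg {t M : ℝ} (q : ℕ) : ∀ V : ℕ → ℝ → ℂ,
    (∀ i < q, ∀ s ∈ Icc 0 t, HasDerivAt (V i) (V (i + 1) s) s) →
    (∀ s ∈ Icc 0 t, ‖V q s‖ ≤ M) → ∀ s ∈ Icc 0 t,
      ‖V 0 s - ∑ i ∈ Finset.range q, V i 0 / (i.factorial : ℂ) * (s : ℂ) ^ i‖
        ≤ M * s ^ q / q.factorial := by
  induction q with
  | zero => intro V _ h s hs; simpa using h s hs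
  | succ q ih =>
    intro V hV hM
    have h := ih (fun i => V (i + 1)) (fun i hi s hs => hV (i + 1) (by omega) s hs) hM
    have hpoly : ∀ s : ℝ, HasDerivAt (fun s : ℝ => ∑ i ∈ Finset.range (q + 1),
        V i 0 / (i.factorial : ℂ) * (s : ℂ) ^ i)
        (∑ i ∈ Finset.range q, V (i + 1) 0 / (i.factorial : ℂ) * (s : ℂ) ^ i) s := by
      intro s
      have h1 : ∀ i ∈ Finset.range (q + 1), HasDerivAt (fun s : ℝ =>
          V i 0 / (i.factorial : ℂ) * (s : ℂ) ^ i)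
          (V i 0 / (i.factorial : ℂ) * (i * (s : ℂ) ^ (i - 1))) s := by
        intro i _
        exact (hasDerivAt_pow i (s : ℂ)).comp_ofReal.const_mul _
      have h2 := HasDerivAt.fun_sum h1
      rw [Finset.sum_range_succ'] at h2
      simp only [Nat.cast_zero, zero_mul, mul_zero, add_zero] at h2
      refine h2.congr_deriv ?_
      refine Finset.sum_congr rfl fun i _ => ?_
      rw [Nat.factorial_succ, Nat.add_sub_cancel]
      have : (i.factorial : ℂ) ≠ 0 := by exact_mod_cast i.factorial_ne_zero
      have : ((i + 1 : ℕ) : ℂ) ≠ 0 := by exact_mod_cast i.succ_ne_zero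
      push_cast at this ⊢
      field_simp
    have hder : ∀ s ∈ Icc 0 t, HasDerivAt (fun s : ℝ => V 0 s - ∑ i ∈ Finset.range (q + 1),
        V i 0 / (i.factorial : ℂ) * (s : ℂ) ^ i)
        (V 1 s - ∑ i ∈ Finset.range q, V (i + 1) 0 / (i.factorial : ℂ) * (s : ℂ) ^ i) s :=
      fun s hs => (hV 0 (by omega) s hs).sub (hpoly s)
    intro s hs
    refine image_norm_le_of_norm_deriv_right_le_deriv_boundary (a := 0) (b := t)
      (B := fun s => M * s ^ (q + 1) / (q + 1).factorial) (B' := fun s => M * s ^ q / q.factorial)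
      (fun s hs => (hder s hs).continuousAt.continuousWithinAt)
      (fun s hs => (hder s (Ico_subset_Icc_self hs)).hasDerivWithinAt) ?_ ?_
      (fun s hs => h s (Ico_subset_Icc_self hs)) hs
    · rw [Finset.sum_range_succ']
      simp
    · intro x
      have h3 := ((hasDerivAt_pow (q + 1) x).const_mul M).div_const ((q + 1).factorial : ℝ)
      refine h3.congr_deriv ?_
      rw [Nat.factorial_succ, Nat.add_sub_cancel]
      have : (q.factorial : ℝ) ≠ 0 := by exact_mod_cast q.factorial_ne_zero
      push_cast
      field_simp

/-- Taylor's formula with remainder for a family of successive derivatives on `[-t, t]`. -/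
theorem norm_sub_taylor_le {t M : ℝ} (q : ℕ) (V : ℕ → ℝ → ℂ)
    (hV : ∀ i < q, ∀ s, |s| ≤ t → HasDerivAt (V i) (V (i + 1) s) s)
    (hM : ∀ s, |s| ≤ t → ‖V q s‖ ≤ M) (s : ℝ) (hs : |s| ≤ t) :
    ‖V 0 s - ∑ i ∈ Finset.range q, V i 0 / (i.factorial : ℂ) * (s : ℂ) ^ i‖
      ≤ M * t ^ q / q.factorial := by
  have hM0 : 0 ≤ M := (norm_nonneg _).trans (hM s hs)
  have habs : ∀ y ∈ Icc (0 : ℝ) t, |y| ≤ t := fun y hy => by rw [abs_of_nonneg hy.1]; exact hy.2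
  have hmono : M * |s| ^ q / q.factorial ≤ M * t ^ q / q.factorial := by gcongr
  refine le_trans ?_ hmono
  rcases le_total 0 s with h0 | h0
  · rw [abs_of_nonneg h0] at hs ⊢
    exact norm_sub_taylor_le_of_nonneg q V (fun i hi y hy => hV i hi y (habs y hy))
      (fun y hy => hM y (habs y hy)) s ⟨h0, hs⟩
  · rw [abs_of_nonpos h0] at hs ⊢
    have h := norm_sub_taylor_le_of_nonneg (t := t) (M := M) q (fun i y => (-1) ^ i * V i (-y))
      (fun i hi y hy => by
        have h1 := hV i hi (-y) (by rw [abs_neg]; exact habs y hy)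
        have h2 := (h1.scomp y (hasDerivAt_neg y)).const_mul ((-1 : ℂ) ^ i)
        refine h2.congr_deriv ?_
        rw [pow_succ]
        simp)
      (fun y hy => by
        rw [norm_mul, norm_pow, norm_neg, norm_one, one_pow, one_mul]
        exact hM _ (by rw [abs_neg]; exact habs y hy)) (-s) ⟨by linarith, hs⟩
    have e : ∑ i ∈ Finset.range q, V i 0 / (i.factorial : ℂ) * (s : ℂ) ^ i
        = ∑ i ∈ Finset.range q, (-1) ^ i * V i (-0) / (i.factorial : ℂ) * ((-s : ℝ) : ℂ) ^ i := by
      refine Finset.sum_congr rfl fun i _ => ?_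
      rw [neg_zero, Complex.ofReal_neg, neg_pow (s : ℂ)]
      have : (-1 : ℂ) ^ i * (-1) ^ i = 1 := by rw [← mul_pow]; simp
      linear_combination (-(V i 0 / (i.factorial : ℂ) * (s : ℂ) ^ i)) * this
    have e0 : V 0 s = (-1) ^ 0 * V 0 (- -s) := by rw [neg_neg, pow_zero, one_mul]
    rw [e, e0]
    exact h

section
variable {d : ℕ}
local notation "𝔼" => EuclideanSpace ℝ (Fin d)

theorem exists_smooth_cutoff {U : Set 𝔼} (hU : IsOpen U) {x : 𝔼} (hx : x ∈ U) :
    ∃ χ : 𝔼 → ℝ, ContDiff ℝ (⊤ : ℕ∞) χ ∧ HasCompactSupport χ ∧ tsupport χ ⊆ U ∧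
      χ =ᶠ[𝓝 x] fun _ => 1 := by
  obtain ⟨r, hr, hrU⟩ := Metric.isOpen_iff.mp hU x hx
  let χ : ContDiffBump x := ⟨r / 4, r / 2, by positivity, by linarith⟩
  refine ⟨χ, χ.contDiff, χ.hasCompactSupport, ?_, χ.eventuallyEq_one⟩
  rw [χ.tsupport_eq]
  exact (closedBall_subset_ball (by change r / 2 < r; linarith)).trans hrU

theorem contDiff_cutoff_mul {U : Set 𝔼} (hU : IsOpen U) {χ : 𝔼 → ℝ}
    (hχ : ContDiff ℝ (⊤ : ℕ∞) χ) (hχU : tsupport χ ⊆ U) {g : 𝔼 → ℂ}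
    (hg : ContDiffOn ℝ (⊤ : ℕ∞) g U) : ContDiff ℝ (⊤ : ℕ∞) fun x => (χ x : ℂ) * g x := by
  refine contDiff_iff_contDiffAt.mpr fun x => ?_
  by_cases hx : x ∈ tsupport χ
  swap
  · refine (contDiffAt_const (c := (0 : ℂ))).congr_of_eventuallyEq ?_
    filter_upwards [notMem_tsupport_iff_eventuallyEq.mp hx] with y hy
    simp [hy]
  have hxU : x ∈ U := hχU hx
  exact (Complex.ofRealCLM.contDiff.comp hχ).contDiffAt.mul (hg.contDiffAt (hU.mem_nhds hxU))

theorem exists_contDiff_eventuallyEq {U : Set 𝔼} (hU : IsOpen U) {g : 𝔼 → ℂ}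
    (hg : ContDiffOn ℝ (⊤ : ℕ∞) g U) {x : 𝔼} (hx : x ∈ U) :
    ∃ G : 𝔼 → ℂ, ContDiff ℝ (⊤ : ℕ∞) G ∧ g =ᶠ[𝓝 x] G := by
  obtain ⟨χ, h1, -, h3, h4⟩ := exists_smooth_cutoff hU hx
  refine ⟨_, contDiff_cutoff_mul hU h1 h3 hg, ?_⟩
  filter_upwards [h4] with y hy
  simp [hy]

/-- Differentiating the diagonal values of the iterated derivatives along a line. -/
theorem hasDerivAt_iteratedFDeriv_line {U : Set 𝔼} (hU : IsOpen U) {g : 𝔼 → ℂ}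
    (hg : ContDiffOn ℝ (⊤ : ℕ∞) g U) (x v : 𝔼) (i : ℕ) {s : ℝ} (hs : x + s • v ∈ U) :
    HasDerivAt (fun s : ℝ => iteratedFDeriv ℝ i g (x + s • v) fun _ => v)
      (iteratedFDeriv ℝ (i + 1) g (x + s • v) fun _ => v) s := by
  obtain ⟨G, hG, hgG⟩ := exists_contDiff_eventuallyEq hU hg hs
  have hline : HasDerivAt (fun s : ℝ => x + s • v) v s := by
    have := ((hasDerivAt_id s).smul_const v).const_add x
    rwa [one_smul] at this
  have h := (hasFDerivAt_iteratedFDeriv_apply hG i (x + s • v) (fun _ => v)).comp_hasDerivAt s hline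
  have heq : (fun s : ℝ => iteratedFDeriv ℝ i g (x + s • v) fun _ => v) =ᶠ[𝓝 s]
      fun s : ℝ => iteratedFDeriv ℝ i G (x + s • v) fun _ => v := by
    filter_upwards [hline.continuousAt.eventually (hgG.iteratedFDeriv (𝕜 := ℝ) i)] with y hy
    rw [hy]
  rw [(hgG.iteratedFDeriv (𝕜 := ℝ) (i + 1)).eq_of_nhds, iteratedFDeriv_succ_apply_left]
  exact h.congr_of_eventuallyEq heq

theorem norm_iteratedFDeriv_le_of_diagonal {U : Set 𝔼} (hU : IsOpen U) {g : 𝔼 → ℂ}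
    (hg : ContDiffOn ℝ (⊤ : ℕ∞) g U) {x : 𝔼} (hx : x ∈ U) {k : ℕ} {C : ℝ} (hC : 0 ≤ C)
    (h : ∀ v : 𝔼, ‖v‖ ≤ 1 → ‖iteratedFDeriv ℝ k g x fun _ => v‖ ≤ C) :
    ‖iteratedFDeriv ℝ k g x‖ ≤ 6 ^ k * C := by
  obtain ⟨G, hG, hgG⟩ := exists_contDiff_eventuallyEq hU hg hx
  rw [(hgG.iteratedFDeriv (𝕜 := ℝ) k).eq_of_nhds] at h ⊢
  exact norm_le_of_norm_diagonal_le _ (iteratedFDeriv_comp_perm_of_contDiff hG k x) hC h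

/-- Taylor approximation along a line inside `U`. -/
theorem norm_sub_taylor_line_le {U : Set 𝔼} (hU : IsOpen U) {g : 𝔼 → ℂ}
    (hg : ContDiffOn ℝ (⊤ : ℕ∞) g U) {x v : 𝔼} (hv : ‖v‖ ≤ 1) {t M : ℝ} (q : ℕ)
    (hball : closedBall x t ⊆ U) (hM : ∀ y ∈ closedBall x t, ‖iteratedFDeriv ℝ q g y‖ ≤ M)
    (s : ℝ) (hs : |s| ≤ t) :
    ‖g (x + s • v) - ∑ i ∈ Finset.range q,
      (iteratedFDeriv ℝ i g x fun _ => v) / (i.factorial : ℂ) * (s : ℂ) ^ i‖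
      ≤ M * t ^ q / q.factorial := by
  have hmem : ∀ s : ℝ, |s| ≤ t → x + s • v ∈ closedBall x t := by
    intro s hs
    rw [mem_closedBall_iff_norm, add_sub_cancel_left, norm_smul, Real.norm_eq_abs]
    nlinarith [abs_nonneg s, norm_nonneg v]
  have h := norm_sub_taylor_le (t := t) (M := M) q
    (fun i s => iteratedFDeriv ℝ i g (x + s • v) fun _ => v)
    (fun i _ s hs => hasDerivAt_iteratedFDeriv_line hU hg x v i (hball (hmem s hs)))
    (fun s hs => by
      refine (ContinuousMultilinearMap.le_opNorm _ _).trans ?_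
      rw [Finset.prod_const]
      exact (mul_le_of_le_one_right (norm_nonneg _) (pow_le_one₀ (norm_nonneg _) hv)).trans
        (hM _ (hmem s hs))) s hs
  simpa using h

end

section
variable {d : ℕ}
local notation "𝔼" => EuclideanSpace ℝ (Fin d)

/-- Bound for the differences of `f` along a line, given control of the derivatives of `f ^ j` and
`f ^ (j + 1)` up to an order that may depend on the scale. -/
theorem norm_fwdDiff_line_le {j : ℕ} (hj : 1 ≤ j) :
    ∃ (A : ℝ) (r : ℕ), 1 ≤ A ∧ ∀ (d k : ℕ) (t₀ B Λ : ℝ) (U : Set (EuclideanSpace ℝ (Fin d)))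
      (f : EuclideanSpace ℝ (Fin d) → ℂ) (x v : EuclideanSpace ℝ (Fin d)),
      0 < t₀ → 0 < B → 1 ≤ Λ → IsOpen U → closedBall x t₀ ⊆ U → ‖v‖ ≤ 1 →
      (∀ n, n = j ∨ n = j + 1 → ContDiffOn ℝ (⊤ : ℕ∞) (fun y => f y ^ n) U) →
      (∀ y ∈ closedBall x t₀, ‖f y‖ ≤ Λ) →
      (∀ n, n = j ∨ n = j + 1 → ∀ t, 0 < t → t ≤ t₀ → ∃ q : ℕ,
        (∀ i < q, ‖iteratedFDeriv ℝ i (fun y => f y ^ n) x‖ / i.factorial * t ^ i ≤ Λ / 2) ∧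
        ∀ y ∈ closedBall x t, ‖iteratedFDeriv ℝ q (fun y => f y ^ n) y‖ * t ^ q / q.factorial
          ≤ Λ * (B * t ^ (k + 1)) ^ 2 ^ r) →
      ∀ a, 0 < a → A * k * a ≤ t₀ → ‖(fwdDiff a)^[k] (fun s : ℝ => f (x + s • v)) 0‖
        ≤ Λ * (A ^ (k + 1) * k.factorial * ((1 / t₀) ^ k + B * t₀) * a ^ k) := by
  obtain ⟨A, r, hA, h⟩ := norm_fwdDiff_iter_le_of_pow_approx hj
  refine ⟨A, r, hA, ?_⟩
  intro d k t₀ B Λ U f x v ht₀ hB hΛ hU hball hv hsm hf happ a ha hka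
  have hΛ0 : (0 : ℝ) < Λ := by linarith
  have hΛc : (Λ : ℂ) ≠ 0 := by exact_mod_cast hΛ0.ne'
  have hmem : ∀ t s : ℝ, |s| ≤ t → x + s • v ∈ closedBall x t := by
    intro t s hs
    rw [mem_closedBall_iff_norm, add_sub_cancel_left, norm_smul, Real.norm_eq_abs]
    nlinarith [abs_nonneg s, norm_nonneg v]
  have hΛn : ∀ n : ℕ, n = j ∨ n = j + 1 → Λ ≤ Λ ^ n := fun n hn =>
    le_self_pow₀ hΛ (by omega)
  have key := h k t₀ B (fun s => (Λ : ℂ)⁻¹ * f (x + s • v)) ht₀ hB ?_ ?_ a ha hka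
  · have e : (fwdDiff a)^[k] (fun s : ℝ => (Λ : ℂ)⁻¹ * f (x + s • v)) 0
        = (Λ : ℂ)⁻¹ * (fwdDiff a)^[k] (fun s : ℝ => f (x + s • v)) 0 := by
      have := congrFun (fwdDiff_iter_const_smul a (Λ : ℂ)⁻¹ (fun s : ℝ => f (x + s • v)) k) 0
      exact this
    rw [e, norm_mul, norm_inv, Complex.norm_real, Real.norm_of_nonneg hΛ0.le,
      inv_mul_le_iff₀ hΛ0] at key
    exact key
  · intro s hs
    rw [norm_mul, norm_inv, Complex.norm_real, Real.norm_of_nonneg hΛ0.le,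
      inv_mul_le_iff₀ hΛ0, mul_one]
    exact hf _ (hmem _ _ hs)
  · intro n hn t ht htt
    obtain ⟨q, hq1, hq2⟩ := happ n hn t ht htt
    have hpow : ‖((Λ : ℂ)⁻¹) ^ n‖ = (Λ ^ n)⁻¹ := by
      rw [norm_pow, norm_inv, Complex.norm_real, Real.norm_of_nonneg hΛ0.le, inv_pow]
    have hΛn0 : 0 < Λ ^ n := by positivity
    refine ⟨fun i => ((Λ : ℂ)⁻¹) ^ n *
      ((iteratedFDeriv ℝ i (fun y => f y ^ n) x fun _ => v) / (i.factorial : ℂ)), q, ?_, ?_⟩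
    · intro i hi
      have h1 : ‖iteratedFDeriv ℝ i (fun y => f y ^ n) x fun _ => v‖
          ≤ ‖iteratedFDeriv ℝ i (fun y => f y ^ n) x‖ := by
        refine (ContinuousMultilinearMap.le_opNorm _ _).trans ?_
        rw [Finset.prod_const]
        exact mul_le_of_le_one_right (norm_nonneg _) (pow_le_one₀ (norm_nonneg _) hv)
      rw [norm_mul, hpow, norm_div, Complex.norm_natCast, mul_assoc, inv_mul_le_iff₀ hΛn0]
      calc _ ≤ ‖iteratedFDeriv ℝ i (fun y => f y ^ n) x‖ / i.factorial * t ^ i := by gcongr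
        _ ≤ Λ / 2 := hq1 i hi
        _ ≤ Λ ^ n * (1 / 2) := by linarith [hΛn n hn]
    · intro s hs
      have hT := norm_sub_taylor_line_le hU (hsm n hn) hv
        (M := Λ * (B * t ^ (k + 1)) ^ 2 ^ r * q.factorial / t ^ q) q
        ((closedBall_subset_closedBall htt).trans hball) (fun y hy => by
          have := hq2 y hy
          rw [div_le_iff₀ (by positivity)] at this
          rwa [le_div_iff₀ (by positivity)]) s hs
      have e1 : Λ * (B * t ^ (k + 1)) ^ 2 ^ r * q.factorial / t ^ q * t ^ q / q.factorial
          = Λ * (B * t ^ (k + 1)) ^ 2 ^ r := by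
        have : (q.factorial : ℝ) ≠ 0 := by positivity
        field_simp
      rw [e1] at hT
      have e2 : ((Λ : ℂ)⁻¹ * f (x + s • v)) ^ n - ∑ i ∈ Finset.range q, ((Λ : ℂ)⁻¹) ^ n *
          ((iteratedFDeriv ℝ i (fun y => f y ^ n) x fun _ => v) / (i.factorial : ℂ)) * (s : ℂ) ^ i
          = ((Λ : ℂ)⁻¹) ^ n * (f (x + s • v) ^ n - ∑ i ∈ Finset.range q,
          (iteratedFDeriv ℝ i (fun y => f y ^ n) x fun _ => v) / (i.factorial : ℂ)
            * (s : ℂ) ^ i) := by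
        rw [mul_sub, Finset.mul_sum, mul_pow]
        simp only [mul_assoc]
      rw [e2, norm_mul, hpow, inv_mul_le_iff₀ hΛn0]
      refine hT.trans ?_
      gcongr
      exact hΛn n hn

theorem fwdDiff_iter_line (f : 𝔼 → ℂ) (x v : 𝔼) (a : ℝ) (k : ℕ) : ∀ s : ℝ,
    (fwdDiff a)^[k] (fun s : ℝ => f (x + s • v)) s = (fwdDiff (a • v))^[k] f (x + s • v) := by
  induction k with
  | zero => intro s; rfl
  | succ k ih =>
    intro s
    rw [Function.iterate_succ_apply', Function.iterate_succ_apply', fwdDiff, fwdDiff, ih, ih,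
      add_smul, add_assoc]

theorem norm_fwdDiff_iter_le_two_pow_mul (w : 𝔼) {f : 𝔼 → ℂ} {S : ℝ} (hf : ∀ x, ‖f x‖ ≤ S)
    (k : ℕ) : ∀ x, ‖(fwdDiff w)^[k] f x‖ ≤ 2 ^ k * S := by
  induction k with
  | zero => simpa using hf
  | succ k ih =>
    intro x
    rw [Function.iterate_succ_apply', fwdDiff, pow_succ]
    linarith [norm_sub_le ((fwdDiff w)^[k] f (x + w)) ((fwdDiff w)^[k] f x), ih x, ih (x + w)]

theorem continuous_of_continuous_pow {X : Type*} [TopologicalSpace X] {f : X → ℂ} {j : ℕ}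
    (hj : 1 ≤ j) (h1 : Continuous fun x => f x ^ j) (h2 : Continuous fun x => f x ^ (j + 1)) :
    Continuous f := by
  refine continuous_iff_continuousAt.mpr fun x => ?_
  by_cases hx : f x = 0
  · rw [ContinuousAt, hx, NormedAddGroup.tendsto_nhds_zero]
    intro ε hε
    have h := h1.norm.tendsto x
    simp only [hx, zero_pow (show j ≠ 0 by omega), norm_zero] at h
    filter_upwards [h.eventually (gt_mem_nhds (show 0 < ε ^ j by positivity))] with y hy
    rw [norm_pow] at hy
    exact lt_of_pow_lt_pow_left₀ j hε.le hy
  · have h := (h2.continuousAt (x := x)).div (h1.continuousAt (x := x)) (pow_ne_zero j hx)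
    refine h.congr ?_
    filter_upwards [h1.continuousAt.eventually_ne (pow_ne_zero j hx)] with y hy
    change f y ^ (j + 1) / f y ^ j = f y
    rw [pow_succ, mul_div_cancel_left₀ _ hy]

theorem exists_norm_fwdDiff_iter_le {j : ℕ} (hj : 1 ≤ j) {f : 𝔼 → ℂ} (hf : HasCompactSupport f)
    (hsm : ∀ n, n = j ∨ n = j + 1 → ContDiff ℝ (⊤ : ℕ∞) (fun y => f y ^ n)) (k : ℕ) :
    ∃ C, ∀ x w : 𝔼, w ≠ 0 → ‖(fwdDiff w)^[k] f x‖ ≤ C * ‖w‖ ^ k := by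
  obtain ⟨A, r, hA, h⟩ := norm_fwdDiff_line_le hj
  have hc : Continuous f := continuous_of_continuous_pow hj (hsm j (Or.inl rfl)).continuous
    (hsm (j + 1) (Or.inr rfl)).continuous
  obtain ⟨S, hS⟩ := hc.bounded_above_of_compact_support hf
  have hS0 : 0 ≤ S := (norm_nonneg _).trans (hS 0)
  have hder : ∀ n, ∃ C, (n = j ∨ n = j + 1) → ∀ i ≤ 2 ^ r * (k + 1), ∀ x,
      ‖iteratedFDeriv ℝ i (fun y => f y ^ n) x‖ ≤ C := by
    intro n
    by_cases hn : n = j ∨ n = j + 1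
    swap
    · exact ⟨0, fun h => absurd h hn⟩
    have hs : HasCompactSupport fun y => f y ^ n :=
      hf.comp_left (g := fun z : ℂ => z ^ n) (zero_pow (by omega))
    have : ∀ i, ∃ C, ∀ x, ‖iteratedFDeriv ℝ i (fun y => f y ^ n) x‖ ≤ C := fun i =>
      ((hsm n hn).continuous_iteratedFDeriv (by exact_mod_cast le_top)).bounded_above_of_compact_support
        (hs.iteratedFDeriv i)
    choose C hC using this
    refine ⟨∑ i ∈ Finset.range (2 ^ r * (k + 1) + 1), C i, fun _ i hi x => (hC i x).trans ?_⟩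
    exact Finset.single_le_sum (f := C) (fun i _ => (norm_nonneg _).trans (hC i x))
      (Finset.mem_range.mpr (by omega))
  choose D hD using hder
  have hD0 : ∀ n, n = j ∨ n = j + 1 → 0 ≤ D n := fun n hn =>
    (norm_nonneg _).trans (hD n hn 0 (by omega) 0)
  set Λ : ℝ := 1 + S + 2 * (D j + D (j + 1)) with hΛdef
  have hj0 := hD0 j (Or.inl rfl)
  have hj1 := hD0 (j + 1) (Or.inr rfl)
  have hΛ : 1 ≤ Λ := by rw [hΛdef]; linarith
  have hDΛ : ∀ n, n = j ∨ n = j + 1 → D n ≤ Λ / 2 := by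
    rintro n (rfl | rfl) <;> rw [hΛdef] <;> linarith
  have hSΛ : S ≤ Λ := by rw [hΛdef]; linarith
  clear_value Λ
  refine ⟨Λ * (A ^ (k + 1) * k.factorial * ((1 / 1) ^ k + 1 * 1)) + 2 ^ k * S * (A * k) ^ k,
    fun x w hw => ?_⟩
  have hw0 : 0 < ‖w‖ := norm_pos_iff.mpr hw
  rw [add_mul]
  by_cases hcase : A * k * ‖w‖ ≤ 1
  · have hv : ‖‖w‖⁻¹ • w‖ ≤ 1 := by
      rw [norm_smul, norm_inv, norm_norm, inv_mul_cancel₀ hw0.ne']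
    have hkey := h d k 1 1 Λ univ f x (‖w‖⁻¹ • w) one_pos one_pos hΛ isOpen_univ (subset_univ _) hv
      (fun n hn => (hsm n hn).contDiffOn) (fun y _ => (hS y).trans hSΛ) ?_ ‖w‖ hw0 hcase
    · rw [fwdDiff_iter_line, smul_smul, mul_inv_cancel₀ hw0.ne', one_smul, zero_smul, add_zero]
        at hkey
      have : 0 ≤ 2 ^ k * S * (A * k) ^ k * ‖w‖ ^ k := by positivity
      linarith
    · intro n hn t ht ht1
      refine ⟨2 ^ r * (k + 1), fun i hi => ?_, fun y _ => ?_⟩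
      · have h1 := (hD n hn i hi.le x).trans (hDΛ n hn)
        have h2 : (1 : ℝ) ≤ i.factorial := by exact_mod_cast i.factorial_pos
        calc _ ≤ ‖iteratedFDeriv ℝ i (fun y => f y ^ n) x‖ / 1 * 1 ^ i := by gcongr
          _ ≤ _ := by simpa using h1
      · have h1 := (hD n hn _ le_rfl y).trans (hDΛ n hn)
        have h2 : (1 : ℝ) ≤ (2 ^ r * (k + 1)).factorial := by
          exact_mod_cast (2 ^ r * (k + 1)).factorial_pos
        rw [one_mul, ← pow_mul, mul_comm (k + 1)]
        calc _ ≤ ‖iteratedFDeriv ℝ (2 ^ r * (k + 1)) (fun y => f y ^ n) y‖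
              * t ^ (2 ^ r * (k + 1)) / 1 := by gcongr
          _ ≤ Λ * t ^ (2 ^ r * (k + 1)) := by
            rw [div_one]
            gcongr
            linarith
  · push Not at hcase
    have h1 := norm_fwdDiff_iter_le_two_pow_mul w hS k x
    have h2 : 1 ≤ (A * k * ‖w‖) ^ k := one_le_pow₀ hcase.le
    have h3 : 0 ≤ Λ * (A ^ (k + 1) * k.factorial * ((1 / 1) ^ k + 1 * 1)) * ‖w‖ ^ k := by positivity
    have h4 : 2 ^ k * S * 1 ≤ 2 ^ k * S * (A * k * ‖w‖) ^ k := by gcongr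
    rw [mul_pow] at h4
    linarith

end

section
variable {d : ℕ}
local notation "𝔼" => EuclideanSpace ℝ (Fin d)
open MeasureTheory FourierTransform

theorem continuous_fwdDiff_iter (w : 𝔼) {f : 𝔼 → ℂ} (hf : Continuous f) (k : ℕ) :
    Continuous ((fwdDiff w)^[k] f) := by
  induction k with
  | zero => exact hf
  | succ k ih =>
    rw [Function.iterate_succ_apply']
    exact (ih.comp (continuous_id.add continuous_const)).sub ih

theorem fwdDiff_iter_eq_zero_of_norm_gt (w : 𝔼) {f : 𝔼 → ℂ} {R : ℝ}
    (hf : ∀ x, R < ‖x‖ → f x = 0) (k : ℕ) :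
    ∀ x, R + k * ‖w‖ < ‖x‖ → (fwdDiff w)^[k] f x = 0 := by
  induction k with
  | zero => intro x hx; exact hf x (by simpa using hx)
  | succ k ih =>
    intro x hx
    push_cast at hx
    rw [Function.iterate_succ_apply', fwdDiff, ih, ih, sub_zero]
    · linarith [norm_nonneg w]
    · have := norm_sub_le (x + w) w
      rw [add_sub_cancel_right] at this
      linarith

theorem integrable_of_eq_zero_of_norm_gt {f : 𝔼 → ℂ} (hc : Continuous f) {R : ℝ}
    (hf : ∀ x, R < ‖x‖ → f x = 0) : Integrable f :=
  hc.integrable_of_hasCompactSupport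
    (HasCompactSupport.intro (isCompact_closedBall (0 : 𝔼) R) fun x hx => hf x (by simpa using hx))

theorem fourier_fwdDiff {w ξ : 𝔼} (hw : inner ℝ w ξ = 1 / 2) {f : 𝔼 → ℂ} (hf : Integrable f) :
    𝓕 (fwdDiff w f) ξ = -2 * 𝓕 f ξ := by
  have hshift : 𝓕 (fun v => f (v + w)) ξ = -𝓕 f ξ := by
    have h := congrFun (VectorFourier.fourierIntegral_comp_add_right Real.fourierChar
      (volume : Measure 𝔼) (innerₗ 𝔼) f w) ξ
    have he : (Real.fourierChar (innerₗ 𝔼 w ξ) : ℂ) = -1 := by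
      rw [innerₗ_apply_apply, hw, Real.fourierChar_apply]
      rw [← Complex.exp_pi_mul_I]
      congr 2
      push_cast
      ring
    rw [Circle.smul_def, he, neg_smul, one_smul] at h
    exact h
  have hsub : 𝓕 (fwdDiff w f) ξ = 𝓕 (fun v => f (v + w)) ξ - 𝓕 f ξ := by
    simp only [Real.fourier_eq, fwdDiff, smul_sub]
    refine integral_sub ?_ ?_
    · exact (Real.fourierIntegral_convergent_iff ξ).mpr (hf.comp_add_right w)
    · exact (Real.fourierIntegral_convergent_iff ξ).mpr hf
  rw [hsub, hshift]
  ring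

theorem exists_norm_fourier_le {f : 𝔼 → ℂ} (hc : Continuous f) (hf : HasCompactSupport f) {k : ℕ}
    {C : ℝ} (hC : ∀ x w : 𝔼, w ≠ 0 → ‖(fwdDiff w)^[k] f x‖ ≤ C * ‖w‖ ^ k) :
    ∃ D, ∀ ξ : 𝔼, ‖ξ‖ ^ k * ‖𝓕 f ξ‖ ≤ D := by
  obtain ⟨R, hR⟩ : ∃ R : ℝ, ∀ x, R < ‖x‖ → f x = 0 := by
    obtain ⟨R, hR⟩ := hf.isCompact.isBounded.subset_closedBall (0 : 𝔼)
    refine ⟨R, fun x hx => image_eq_zero_of_notMem_tsupport fun h => ?_⟩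
    have := hR h
    rw [mem_closedBall_zero_iff] at this
    linarith
  have hbound : ∀ (g : 𝔼 → ℂ) ξ, ‖𝓕 g ξ‖ ≤ ∫ x, ‖g x‖ := fun g ξ =>
    VectorFourier.norm_fourierIntegral_le_integral_norm _ _ _ _ _
  have hiter : ∀ (w ξ : 𝔼), inner ℝ w ξ = 1 / 2 → ∀ i : ℕ,
      𝓕 ((fwdDiff w)^[i] f) ξ = (-2) ^ i * 𝓕 f ξ := by
    intro w ξ hw i
    induction i with
    | zero => simp
    | succ i ih =>
      rw [Function.iterate_succ_apply', fourier_fwdDiff hw, ih, pow_succ]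
      · ring
      · exact integrable_of_eq_zero_of_norm_gt (continuous_fwdDiff_iter w hc i)
          (fwdDiff_iter_eq_zero_of_norm_gt w hR i)
  refine ⟨(∫ x, ‖f x‖) + |C| * (volume.real (closedBall (0 : 𝔼) (R + k))), fun ξ => ?_⟩
  have hI : 0 ≤ ∫ x, ‖f x‖ := integral_nonneg fun _ => norm_nonneg _
  have hV : 0 ≤ |C| * (volume.real (closedBall (0 : 𝔼) (R + k))) := by positivity
  rcases le_or_gt ‖ξ‖ 1 with h1 | h1
  · have : ‖ξ‖ ^ k * ‖𝓕 f ξ‖ ≤ 1 * ∫ x, ‖f x‖ := by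
      gcongr
      · exact pow_le_one₀ (norm_nonneg _) h1
      · exact hbound f ξ
    linarith
  · have hξ0 : 0 < ‖ξ‖ := by linarith
    set w : 𝔼 := (1 / (2 * ‖ξ‖ ^ 2)) • ξ with hw
    have hwξ : inner ℝ w ξ = 1 / 2 := by
      rw [hw, real_inner_smul_left, real_inner_self_eq_norm_sq]
      field_simp
    have hwn : ‖w‖ = 1 / (2 * ‖ξ‖) := by
      rw [hw, norm_smul, Real.norm_of_nonneg (by positivity)]
      field_simp
    have hw0 : w ≠ 0 := by
      rw [← norm_pos_iff, hwn]
      positivity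
    have hw1 : ‖w‖ ≤ 1 := by
      rw [hwn, div_le_one (by positivity)]
      linarith
    have hsupp : ∀ x, x ∉ closedBall (0 : 𝔼) (R + k) → ‖(fwdDiff w)^[k] f x‖ = 0 := by
      intro x hx
      rw [norm_eq_zero]
      refine fwdDiff_iter_eq_zero_of_norm_gt w hR k x ?_
      rw [mem_closedBall_zero_iff, not_le] at hx
      nlinarith [show (0 : ℝ) ≤ k from k.cast_nonneg]
    have hInt : ∫ x, ‖(fwdDiff w)^[k] f x‖ ≤ |C| * ‖w‖ ^ k *
        volume.real (closedBall (0 : 𝔼) (R + k)) := by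
      rw [← setIntegral_eq_integral_of_forall_compl_eq_zero hsupp]
      refine (Real.le_norm_self _).trans ?_
      refine norm_setIntegral_le_of_norm_le_const measure_closedBall_lt_top fun x _ => ?_
      rw [norm_norm]
      refine (hC x w hw0).trans ?_
      gcongr
      exact le_abs_self C
    have h2 := (hbound ((fwdDiff w)^[k] f) ξ).trans hInt
    rw [hiter w ξ hwξ, norm_mul, norm_pow, norm_neg, Complex.norm_two, hwn] at h2
    have h3 : ‖ξ‖ ^ k * ‖𝓕 f ξ‖ ≤ 4 ^ k * ‖ξ‖ ^ k * ‖𝓕 f ξ‖ := by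
      have : (1 : ℝ) ≤ 4 ^ k := one_le_pow₀ (by norm_num)
      have h0 : 0 ≤ ‖ξ‖ ^ k * ‖𝓕 f ξ‖ := by positivity
      nlinarith
    have h4 : 4 ^ k * ‖ξ‖ ^ k * ‖𝓕 f ξ‖ = (2 * ‖ξ‖) ^ k * (2 ^ k * ‖𝓕 f ξ‖) := by
      rw [mul_pow, show (4 : ℝ) = 2 * 2 by norm_num, mul_pow]
      ring
    have h5 : (2 * ‖ξ‖) ^ k * (2 ^ k * ‖𝓕 f ξ‖) ≤ (2 * ‖ξ‖) ^ k * (|C| * (1 / (2 * ‖ξ‖)) ^ k *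
        volume.real (closedBall (0 : 𝔼) (R + k))) := by gcongr
    have h6 : (2 * ‖ξ‖) ^ k * (|C| * (1 / (2 * ‖ξ‖)) ^ k *
        volume.real (closedBall (0 : 𝔼) (R + k)))
        = |C| * volume.real (closedBall (0 : 𝔼) (R + k)) := by
      rw [div_pow, one_pow]
      field_simp
    linarith

theorem contDiff_of_norm_fourier_le {f : 𝔼 → ℂ} (hc : Continuous f) (hf : HasCompactSupport f)
    (h : ∀ k : ℕ, ∃ D, ∀ ξ : 𝔼, ‖ξ‖ ^ k * ‖𝓕 f ξ‖ ≤ D) : ContDiff ℝ (⊤ : ℕ∞) f := by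
  have hInt : Integrable f := hc.integrable_of_hasCompactSupport hf
  have hcF : Continuous (𝓕 f) := VectorFourier.fourierIntegral_continuous
    Real.continuous_fourierChar (innerSL ℝ).continuous₂ hInt
  have hdec : ∀ n : ℕ, Integrable fun ξ : 𝔼 => ‖ξ‖ ^ n * ‖𝓕 f ξ‖ := by
    intro n
    obtain ⟨D₀, hD₀⟩ := h n
    obtain ⟨D₁, hD₁⟩ := h (n + (d + 1))
    have hi := integrable_one_add_norm (E := 𝔼) (μ := volume) (r := (d + 1 : ℕ))
      (by rw [finrank_euclideanSpace_fin]; push_cast; linarith)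
    refine (hi.const_mul (2 ^ (d + 1) * (|D₀| + |D₁|))).mono'
      ((continuous_norm.pow n).mul hcF.norm).aestronglyMeasurable (Eventually.of_forall fun ξ => ?_)
    rw [Real.norm_of_nonneg (by positivity), Real.rpow_neg (by positivity), Real.rpow_natCast,
      ← div_eq_mul_inv, le_div_iff₀ (by positivity)]
    have h0 : 0 ≤ ‖ξ‖ ^ n * ‖𝓕 f ξ‖ := by positivity
    rcases le_total ‖ξ‖ 1 with h1 | h1
    · have : (1 + ‖ξ‖) ^ (d + 1) ≤ 2 ^ (d + 1) := by gcongr; linarith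
      calc _ ≤ |D₀| * 2 ^ (d + 1) := by
            gcongr
            exact (hD₀ ξ).trans (le_abs_self _)
        _ ≤ _ := by nlinarith [abs_nonneg D₁, show (0 : ℝ) < 2 ^ (d + 1) by positivity]
    · have : (1 + ‖ξ‖) ^ (d + 1) ≤ (2 * ‖ξ‖) ^ (d + 1) := by gcongr; linarith
      calc _ ≤ ‖ξ‖ ^ n * ‖𝓕 f ξ‖ * (2 * ‖ξ‖) ^ (d + 1) := by gcongr
        _ = 2 ^ (d + 1) * (‖ξ‖ ^ (n + (d + 1)) * ‖𝓕 f ξ‖) := by rw [mul_pow, pow_add]; ring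
        _ ≤ 2 ^ (d + 1) * |D₁| := by
            gcongr
            exact (hD₁ ξ).trans (le_abs_self _)
        _ ≤ _ := by nlinarith [abs_nonneg D₀, show (0 : ℝ) < 2 ^ (d + 1) by positivity]
  have hIntF : Integrable (𝓕 f) := by
    have := hdec 0
    simp only [pow_zero, one_mul] at this
    exact (integrable_norm_iff hcF.aestronglyMeasurable).mp this
  rw [← hc.fourierInv_fourier_eq hInt hIntF]
  have h2 : ContDiff ℝ (⊤ : ℕ∞) (𝓕 (𝓕 f)) := Real.contDiff_fourier fun n _ => hdec n
  have h3 : 𝓕⁻ (𝓕 f) = fun x => 𝓕 (𝓕 f) (-x) :=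
    funext fun x => Real.fourierInv_eq_fourier_neg _ _
  rw [h3]
  exact h2.comp contDiff_neg

/-- Joris' theorem: if two consecutive powers of `f` are smooth, so is `f`. -/
theorem contDiffOn_of_contDiffOn_pow {U : Set 𝔼} (hU : IsOpen U) {j : ℕ} (hj : 1 ≤ j) {f : 𝔼 → ℂ}
    (hsm : ∀ n, n = j ∨ n = j + 1 → ContDiffOn ℝ (⊤ : ℕ∞) (fun y => f y ^ n) U) :
    ContDiffOn ℝ (⊤ : ℕ∞) f U := by
  intro x hx
  obtain ⟨χ, h1, h2, h3, h4⟩ := exists_smooth_cutoff hU hx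
  set g : 𝔼 → ℂ := fun y => (χ y : ℂ) * f y with hg
  have hgs : HasCompactSupport g :=
    HasCompactSupport.intro h2.isCompact fun y hy => by
      simp [hg, image_eq_zero_of_notMem_tsupport hy]
  have hgn : ∀ n, n = j ∨ n = j + 1 → ContDiff ℝ (⊤ : ℕ∞) (fun y => g y ^ n) := by
    intro n hn
    have hsupp : tsupport (fun y => χ y ^ n) ⊆ U := by
      refine (closure_mono fun y hy => ?_).trans h3
      rw [Function.mem_support] at hy ⊢
      exact fun h0 => hy (by rw [h0, zero_pow (by omega)])
    have := contDiff_cutoff_mul hU (h1.pow n) hsupp (hsm n hn)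
    simpa only [hg, mul_pow, Complex.ofReal_pow] using this
  have hgc : Continuous g := continuous_of_continuous_pow hj (hgn j (Or.inl rfl)).continuous
    (hgn (j + 1) (Or.inr rfl)).continuous
  have hgsm : ContDiff ℝ (⊤ : ℕ∞) g := contDiff_of_norm_fourier_le hgc hgs fun k => by
    obtain ⟨C, hC⟩ := exists_norm_fwdDiff_iter_le hj hgs hgn k
    exact exists_norm_fourier_le hgc hgs hC
  refine (hgsm.contDiffAt.congr_of_eventuallyEq ?_).contDiffWithinAt
  filter_upwards [h4] with y hy
  simp [hg, hy]

end

theorem exists_pow_le_mul_of_rootsTendsto {m : ℕ → ℝ} (hm : ∀ k, 0 < m k) (h : RootsTendsto m)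
    {s : ℝ} (hs : 0 < s) : ∃ C, 0 < C ∧ ∀ k, s ^ k ≤ C * m k := by
  obtain ⟨N, hN⟩ := eventually_atTop.mp ((h.eventually_ge_atTop s).and (eventually_ge_atTop 1))
  have hpos : ∀ k, 0 < s ^ k / m k := fun k => by have := hm k; positivity
  refine ⟨1 + ∑ i ∈ Finset.range N, s ^ i / m i, ?_, fun k => ?_⟩
  · have : 0 ≤ ∑ i ∈ Finset.range N, s ^ i / m i := Finset.sum_nonneg fun i _ => (hpos i).le
    linarith
  rw [← div_le_iff₀ (hm k)]
  have hsum : 0 ≤ ∑ i ∈ Finset.range N, s ^ i / m i := Finset.sum_nonneg fun i _ => (hpos i).le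
  rcases lt_or_ge k N with hk | hk
  · have := Finset.single_le_sum (f := fun i => s ^ i / m i) (fun i _ => (hpos i).le)
      (Finset.mem_range.mpr hk)
    linarith
  · obtain ⟨h1, h2⟩ := hN k hk
    have h3 : s ^ k ≤ m k := by
      calc s ^ k ≤ (m k ^ ((1 : ℝ) / (k : ℝ))) ^ k := by gcongr
        _ = m k := by
          rw [one_div]
          exact Real.rpow_inv_natCast_pow (hm k).le (by omega)
    have : s ^ k / m k ≤ 1 := (div_le_one (hm k)).mpr h3
    linarith

theorem mul_pow_gammaUpper_le {m : ℕ → ℝ} (hm : ∀ k, 0 < m k) (h : RootsTendsto m) {t : ℝ}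
    (ht : 0 < t) (k : ℕ) : m (GammaUpper m t) * t ^ GammaUpper m t ≤ m k * t ^ k := by
  have hbdd : BddBelow (range fun k : ℕ => m k * t ^ k) :=
    ⟨0, by rintro _ ⟨k, rfl⟩; have := hm k; positivity⟩
  have hne : {k : ℕ | hfn m t = m k * t ^ k}.Nonempty := by
    obtain ⟨C, hC, hCk⟩ := exists_pow_le_mul_of_rootsTendsto hm h (s := 2 / t) (by positivity)
    have hgrow : ∀ k, 2 ^ k / C ≤ m k * t ^ k := by
      intro k
      have := hCk k
      rw [div_pow, div_le_iff₀ (by positivity)] at this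
      rw [div_le_iff₀ hC]
      linarith
    have htend : Tendsto (fun k : ℕ => m k * t ^ k) cofinite atTop := by
      rw [Nat.cofinite_eq_atTop]
      exact tendsto_atTop_mono hgrow
        ((tendsto_pow_atTop_atTop_of_one_lt (by norm_num)).atTop_div_const hC)
    obtain ⟨k₀, hk₀⟩ := htend.exists_forall_le
    refine ⟨k₀, ?_⟩
    rw [mem_ofPred_eq, hfn, if_neg (not_le.mpr ht)]
    exact le_antisymm (ciInf_le hbdd k₀) (le_ciInf hk₀)
  have hmem : hfn m t = m (GammaUpper m t) * t ^ GammaUpper m t := Nat.sInf_mem hne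
  rw [← hmem, hfn, if_neg (not_le.mpr ht)]
  exact ciInf_le hbdd k

theorem mul_pow_le_one_of_le_gammaLower {m : ℕ → ℝ} (hm : ∀ k, 0 < m k) (h0 : m 0 = 1) {t : ℝ}
    (ht : 0 < t) (k : ℕ) (hk : k ≤ GammaLower m t) : m k * t ^ k ≤ 1 := by
  induction k with
  | zero => simp [h0]
  | succ k ih =>
    have h1 := Nat.notMem_of_lt_sInf (show k < sInf {k : ℕ | 1 / t ≤ m (k + 1) / m k} from hk)
    rw [mem_ofPred_eq, not_le, div_lt_div_iff₀ (hm k) ht, one_mul] at h1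
    calc m (k + 1) * t ^ (k + 1) = m (k + 1) * t * t ^ k := by ring
      _ ≤ m k * t ^ k := by gcongr
      _ ≤ 1 := ih (by omega)

theorem lc_pos {M : ℕ → ℝ} (hM : IsWeightSeq M) (k : ℕ) : 0 < lc M k :=
  div_pos (hM.pos k) (by positivity)

theorem lc_zero {M : ℕ → ℝ} (hM : IsWeightSeq M) : lc M 0 = 1 := by
  simp [lc, hM.first]

theorem exists_lc_add_le_of_mg_lt_top {M N : ℕ → ℝ} (hM : IsWeightSeq M) (hN : IsWeightSeq N)
    (h : mg N M < ⊤) : ∃ C : ℝ, 1 ≤ C ∧ ∀ i k, lc N (i + k) ≤ C ^ (i + k) * (lc M i * lc M k) := by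
  refine ⟨max 1 (mg N M).toReal, le_max_left _ _, fun i k => ?_⟩
  have hMi := hM.pos i
  have hMk := hM.pos k
  have hNik := hN.pos (i + k)
  have hmain : N (i + k) ≤ max 1 (mg N M).toReal ^ (i + k) * (M i * M k) := by
    rcases Nat.eq_zero_or_pos (i + k) with h0 | h0
    · obtain ⟨rfl, rfl⟩ : i = 0 ∧ k = 0 := by omega
      simp [hM.first, hN.first]
    have h1 : ENNReal.ofReal ((N (i + k) / (M i * M k)) ^ (((i : ℝ) + (k : ℝ))⁻¹)) ≤ mg N M :=
      le_iSup₂_of_le i k (le_iSup_of_le h0 le_rfl)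
    have h2 := (ENNReal.ofReal_le_iff_le_toReal h.ne).mp h1
    have h3 : ((N (i + k) / (M i * M k)) ^ (((i : ℝ) + (k : ℝ))⁻¹)) ^ (i + k)
        = N (i + k) / (M i * M k) := by
      rw [← Nat.cast_add]
      exact Real.rpow_inv_natCast_pow (by positivity) (by omega)
    rw [← div_le_iff₀ (by positivity), ← h3]
    gcongr
    exact h2.trans (le_max_right _ _)
  have hfac : (i.factorial : ℝ) * k.factorial ≤ (i + k).factorial := by
    exact_mod_cast Nat.le_of_dvd (Nat.factorial_pos _) (Nat.factorial_mul_factorial_dvd_factorial_add i k)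
  calc lc N (i + k) ≤ max 1 (mg N M).toReal ^ (i + k) * (M i * M k) / (i + k).factorial := by
        rw [lc]; gcongr
    _ ≤ max 1 (mg N M).toReal ^ (i + k) * (M i * M k) / (i.factorial * k.factorial) := by gcongr
    _ = _ := by rw [lc, lc]; field_simp

theorem BAdmissible.exists_lc_two_pow_mul_le {W : Set (ℕ → ℝ)} (hW : BAdmissible W) (r : ℕ) :
    ∀ M ∈ W, ∃ N ∈ W, ∃ C : ℝ, 1 ≤ C ∧ ∀ k, lc N (2 ^ r * k) ≤ (C ^ k * lc M k) ^ 2 ^ r := by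
  induction r with
  | zero => exact fun M hM => ⟨M, hM, 1, le_rfl, fun k => by simp⟩
  | succ r ih =>
    intro M hM
    obtain ⟨N, hN, C, hC, h⟩ := ih M hM
    obtain ⟨P, hP, hmg⟩ := hW.mgrowth N hN
    obtain ⟨C₁, hC₁, h₁⟩ := exists_lc_add_le_of_mg_lt_top (hW.matrix.weight N hN)
      (hW.matrix.weight P hP) hmg
    refine ⟨P, hP, C₁ * C, one_le_mul_of_one_le_of_one_le hC₁ hC, fun k => ?_⟩
    have hpos := lc_pos (hW.matrix.weight N hN) (2 ^ r * k)
    have hMk := lc_pos (hW.matrix.weight M hM) k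
    rw [show 2 ^ (r + 1) * k = 2 ^ r * k + 2 ^ r * k by ring]
    refine (h₁ _ _).trans ?_
    calc C₁ ^ (2 ^ r * k + 2 ^ r * k) * (lc N (2 ^ r * k) * lc N (2 ^ r * k))
        ≤ C₁ ^ (2 ^ r * k + 2 ^ r * k) *
          ((C ^ k * lc M k) ^ 2 ^ r * (C ^ k * lc M k) ^ 2 ^ r) := by
          have := h k
          gcongr
      _ = ((C₁ * C) ^ k * lc M k) ^ 2 ^ (r + 1) := by
          rw [← pow_add, show 2 ^ r * k + 2 ^ r * k = k * 2 ^ (r + 1) by ring, pow_mul,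
            show 2 ^ r + 2 ^ r = 2 ^ (r + 1) by ring, ← mul_pow, mul_pow C₁ C, mul_assoc]

/-- The Taylor orders provided by admissibility. -/
theorem BAdmissible.exists_truncation {W : Set (ℕ → ℝ)} (hW : BAdmissible W) (r : ℕ)
    {M : ℕ → ℝ} (hM : M ∈ W) : ∃ N ∈ W, ∃ L ∈ W, ∃ C : ℝ, 1 ≤ C ∧ ∀ (k : ℕ) (T : ℝ), 0 < T →
      ∃ q : ℕ, (∀ i ≤ q, lc L i * T ^ i ≤ 1) ∧
        lc N q * T ^ q ≤ (lc M k * (C * T) ^ (k + 1)) ^ 2 ^ r := by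
  have hw := hW.matrix.weight
  obtain ⟨P, hP, hmg⟩ := hW.mgrowth M hM
  obtain ⟨C₀, hC₀, h₀⟩ := exists_lc_add_le_of_mg_lt_top (hw M hM) (hw P hP) hmg
  obtain ⟨N, hN, C₁, hC₁, h₁⟩ := hW.exists_lc_two_pow_mul_le r P hP
  obtain ⟨L, hL, C₂, hC₂, h₂⟩ := hW.gamma N hN
  have hM1 := lc_pos (hw M hM) 1
  have hM1' : 1 ≤ lc M 1 := by simpa [lc] using (hw M hM).one_le
  have hC : 1 ≤ C₀ * C₁ * C₂ * lc M 1 :=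
    one_le_mul_of_one_le_of_one_le (one_le_mul_of_one_le_of_one_le
      (one_le_mul_of_one_le_of_one_le hC₀ hC₁) hC₂) hM1'
  refine ⟨N, hN, L, hL, C₀ * C₁ * C₂ * lc M 1, hC, fun k T hT => ?_⟩
  refine ⟨GammaUpper (lc N) (C₂ * T), fun i hi => ?_, ?_⟩
  · exact mul_pow_le_one_of_le_gammaLower (lc_pos (hw L hL)) (lc_zero (hw L hL)) hT i
      (hi.trans (h₂ T hT))
  · set q := GammaUpper (lc N) (C₂ * T) with hq
    have hmin := mul_pow_gammaUpper_le (lc_pos (hw N hN)) (hW.roots N hN)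
      (t := C₂ * T) (by positivity) (2 ^ r * (k + 1))
    rw [← hq] at hmin
    have hNq := lc_pos (hw N hN) q
    have hMk := lc_pos (hw M hM) k
    have hPk := lc_pos (hw P hP) (k + 1)
    calc lc N q * T ^ q ≤ lc N q * (C₂ * T) ^ q := by
          gcongr
          nlinarith
      _ ≤ lc N (2 ^ r * (k + 1)) * (C₂ * T) ^ (2 ^ r * (k + 1)) := hmin
      _ ≤ (C₁ ^ (k + 1) * lc P (k + 1)) ^ 2 ^ r * (C₂ * T) ^ (2 ^ r * (k + 1)) := by
          gcongr
          exact h₁ (k + 1)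
      _ = (lc P (k + 1) * (C₁ * C₂ * T) ^ (k + 1)) ^ 2 ^ r := by
          rw [mul_comm (2 ^ r) (k + 1), pow_mul (C₂ * T), ← mul_pow, mul_assoc C₁, mul_pow C₁]
          ring
      _ ≤ (C₀ ^ (k + 1) * (lc M k * lc M 1) * (C₁ * C₂ * T) ^ (k + 1)) ^ 2 ^ r := by
          gcongr
          exact h₀ k 1
      _ = (lc M k * lc M 1 * (C₀ * C₁ * C₂ * T) ^ (k + 1)) ^ 2 ^ r := by
          rw [show C₀ * C₁ * C₂ * T = C₀ * (C₁ * C₂ * T) by ring, mul_pow C₀]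
          ring
      _ ≤ (lc M k * lc M 1 ^ (k + 1) * (C₀ * C₁ * C₂ * T) ^ (k + 1)) ^ 2 ^ r := by
          have := le_self_pow₀ hM1' (show k + 1 ≠ 0 by omega)
          gcongr
      _ = _ := by
          rw [mul_assoc (lc M k), ← mul_pow]
          ring

section
variable {d : ℕ}
local notation "𝔼" => EuclideanSpace ℝ (Fin d)

theorem norm_iteratedFDeriv_diagonal_le_of_fwdDiff {U : Set 𝔼} (hU : IsOpen U) {f : 𝔼 → ℂ}
    (hf : ContDiffOn ℝ (⊤ : ℕ∞) f U) {x v : 𝔼} {k : ℕ} {t₀ A C : ℝ} (ht₀ : 0 < t₀) (hA : 1 ≤ A)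
    (hv : ‖v‖ ≤ 1) (hball : closedBall x t₀ ⊆ U)
    (h : ∀ a, 0 < a → A * k * a ≤ t₀ →
      ‖(fwdDiff a)^[k] (fun s : ℝ => f (x + s • v)) 0‖ ≤ C * a ^ k) :
    ‖iteratedFDeriv ℝ k f x fun _ => v‖ ≤ C := by
  set V : ℕ → ℝ → ℂ := fun i s => iteratedFDeriv ℝ i f (x + s • v) fun _ => v with hVdef
  have hmem : ∀ s : ℝ, |s| ≤ t₀ → x + s • v ∈ U := by
    intro s hs
    refine hball ?_
    rw [mem_closedBall_iff_norm, add_sub_cancel_left, norm_smul, Real.norm_eq_abs]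
    nlinarith [abs_nonneg s, norm_nonneg v]
  have hder : ∀ i s, |s| ≤ t₀ → HasDerivAt (V i) (V (i + 1) s) s := fun i s hs =>
    hasDerivAt_iteratedFDeriv_line hU hf x v i (hmem s hs)
  have hV0 : V 0 = fun s : ℝ => f (x + s • v) := by
    funext s
    simp [hVdef]
  have hVk : (iteratedFDeriv ℝ k f x fun _ => v) = V k 0 := by simp [hVdef]
  rw [hVk]
  refine le_of_forall_pos_le_add fun ε hε => ?_
  have hcont : ContinuousAt (V k) 0 := (hder k 0 (by simpa using ht₀.le)).continuousAt
  obtain ⟨δ, hδ, hδV⟩ := Metric.continuousAt_iff.mp hcont ε hε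
  set τ := min t₀ (δ / 2) with hτ
  have hτ0 : 0 < τ := lt_min ht₀ (by positivity)
  have hτ1 : τ ≤ t₀ := min_le_left _ _
  have hτ2 : τ < δ := (min_le_right _ _).trans_lt (by linarith)
  clear_value τ
  have hA0 : 0 < A := by linarith
  set a := τ / (A * (k + 1)) with ha
  have ha0 : 0 < a := by positivity
  have hka : A * (k + 1) * a = τ := by rw [ha]; field_simp
  clear_value a
  have hAka : A * k * a ≤ τ := by nlinarith [mul_pos hA0 ha0]
  have hka' : k * a ≤ τ := by
    refine le_trans ?_ hAka
    have : 0 ≤ k * a := by positivity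
    nlinarith
  have habs : ∀ s ∈ Icc (0 : ℝ) (0 + k * a), |s| ≤ τ := fun s hs => by
    rw [abs_of_nonneg hs.1]
    linarith [hs.2]
  have h1 := norm_fwdDiff_iter_sub_le ha0 k V 0 ε (V k 0)
    (fun i _ s hs => hder i s ((habs s hs).trans hτ1))
    (fun s hs => by
      rw [← dist_eq_norm]
      refine (hδV ?_).le
      rw [Real.dist_eq, sub_zero]
      exact (habs s hs).trans_lt hτ2)
  have h2 := h a ha0 (hAka.trans hτ1)
  rw [← hV0] at h2
  have h3 : ‖(a : ℂ) ^ k * V k 0‖ ≤ (C + ε) * a ^ k := by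
    have := norm_sub_norm_le ((a : ℂ) ^ k * V k 0) ((fwdDiff a)^[k] (V 0) 0)
    rw [norm_sub_rev] at this
    linarith
  rw [norm_mul, norm_pow, Complex.norm_real, Real.norm_of_nonneg ha0.le, mul_comm] at h3
  exact le_of_mul_le_mul_right h3 (by positivity)

theorem SeqBoundedOn.exists_norm_iteratedFDeriv_le {M : ℕ → ℝ} {ρ : ℝ} {g : 𝔼 → ℂ} {U K : Set 𝔼}
    (hU : IsOpen U) (hK : K ⊆ U) (hM : ∀ k, 0 < M k) (hρ : 0 < ρ) (h : SeqBoundedOn M ρ g U K) :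
    ∃ C, 0 ≤ C ∧ ∀ x ∈ K, ∀ k, ‖iteratedFDeriv ℝ k g x‖ / k.factorial ≤ C * (lc M k * ρ ^ k) := by
  obtain ⟨C, hC⟩ := h
  refine ⟨|C|, abs_nonneg C, fun x hx k => ?_⟩
  have h1 := hC x hx k
  rw [iteratedFDerivWithin_of_isOpen k hU (hK hx)] at h1
  have hMk := hM k
  calc ‖iteratedFDeriv ℝ k g x‖ / k.factorial ≤ (C * ρ ^ k * M k) / k.factorial := by gcongr
    _ ≤ (|C| * ρ ^ k * M k) / k.factorial := by
      gcongr
      exact le_abs_self C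
    _ = _ := by rw [lc]; ring

end

/-- Joris' theorem for Beurling classes given by a B-admissible weight matrix. -/
theorem statement1 {d : ℕ} (W : Set (ℕ → ℝ)) (hW : BAdmissible W)
    (U : Set (EuclideanSpace ℝ (Fin d))) (hU : IsOpen U)
    (j : ℕ) (hj : 1 ≤ j) (f : EuclideanSpace ℝ (Fin d) → ℂ)
    (h1 : Beurling W U (fun x => f x ^ j))
    (h2 : Beurling W U (fun x => f x ^ (j + 1))) :
    Beurling W U f := by
  have hB : ∀ n, n = j ∨ n = j + 1 → Beurling W U (fun x => f x ^ n) := by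
    rintro n (rfl | rfl)
    exacts [h1, h2]
  have hsm := contDiffOn_of_contDiffOn_pow hU hj fun n hn => (hB n hn).1
  refine ⟨hsm, fun K hKU hK M hM ρ hρ => ?_⟩
  have hw := hW.matrix.weight
  obtain ⟨A, r, hA, hline⟩ := norm_fwdDiff_line_le hj
  obtain ⟨N, hN, L, hL, C, hC, htrunc⟩ := hW.exists_truncation r hM
  obtain ⟨δ, hδ, hδU⟩ := hK.exists_cthickening_subset_open hU hKU
  have hK' : IsCompact (cthickening δ K) := hK.cthickening
  have hA0 : 0 < A := by linarith
  have hC0 : 0 < C := by linarith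
  set σ := ρ / (6 * A * C) with hσ
  have hσ0 : 0 < σ := by positivity
  have hσC : 6 * A * (C * σ) = ρ := by rw [hσ]; field_simp
  clear_value σ
  have hbd : ∀ n, ∃ D, (n = j ∨ n = j + 1) → 0 ≤ D ∧ ∀ P, P = N ∨ P = L →
      ∀ x ∈ cthickening δ K, ∀ i, ‖iteratedFDeriv ℝ i (fun y => f y ^ n) x‖ / i.factorial
        ≤ D * (lc P i * σ ^ i) := by
    intro n
    by_cases hn : n = j ∨ n = j + 1
    swap
    · exact ⟨0, fun h => absurd h hn⟩
    obtain ⟨D₁, hD₁, hb₁⟩ := ((hB n hn).2 _ hδU hK' N hN σ hσ0).exists_norm_iteratedFDeriv_le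
      hU hδU (hw N hN).pos hσ0
    obtain ⟨D₂, hD₂, hb₂⟩ := ((hB n hn).2 _ hδU hK' L hL σ hσ0).exists_norm_iteratedFDeriv_le
      hU hδU (hw L hL).pos hσ0
    refine ⟨D₁ + D₂, fun _ => ⟨by positivity, ?_⟩⟩
    rintro P (rfl | rfl) x hx i
    · refine (hb₁ x hx i).trans ?_
      have := lc_pos (hw P hN) i
      gcongr
      linarith
    · refine (hb₂ x hx i).trans ?_
      have := lc_pos (hw P hL) i
      gcongr
      linarith
  choose D hD using hbd
  obtain ⟨S, hS⟩ := hK'.exists_bound_of_continuousOn (hsm.continuousOn.mono hδU)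
  have hD0 := (hD j (Or.inl rfl)).1
  have hD1 := (hD (j + 1) (Or.inr rfl)).1
  set Λ : ℝ := 1 + |S| + 2 * (D j + D (j + 1)) with hΛdef
  have hΛ : 1 ≤ Λ := by rw [hΛdef]; linarith [abs_nonneg S]
  have hSΛ : S ≤ Λ := by rw [hΛdef]; linarith [le_abs_self S]
  have hDΛ : ∀ n, n = j ∨ n = j + 1 → D n ≤ Λ / 2 := by
    rintro n (rfl | rfl) <;> rw [hΛdef] <;> linarith [abs_nonneg S]
  clear_value Λ
  obtain ⟨C₃, hC₃, hroot⟩ := exists_pow_le_mul_of_rootsTendsto (lc_pos (hw M hM)) (hW.roots M hM)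
    (s := 6 * A / (δ * ρ)) (by positivity)
  refine ⟨Λ * A * (C₃ + C * σ * δ), fun x hx k => ?_⟩
  rw [iteratedFDerivWithin_of_isOpen k hU (hKU hx)]
  have hball : closedBall x δ ⊆ cthickening δ K := closedBall_subset_cthickening hx δ
  have hMk := lc_pos (hw M hM) k
  have hdiag : ∀ v : EuclideanSpace ℝ (Fin d), ‖v‖ ≤ 1 → ‖iteratedFDeriv ℝ k f x fun _ => v‖
      ≤ Λ * (A ^ (k + 1) * k.factorial * ((1 / δ) ^ k + lc M k * (C * σ) ^ (k + 1) * δ)) := by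
    intro v hv
    refine norm_iteratedFDeriv_diagonal_le_of_fwdDiff hU hsm hδ hA hv (hball.trans hδU) ?_
    intro a ha hka
    refine (hline d k δ (lc M k * (C * σ) ^ (k + 1)) Λ U f x v hδ (by positivity) hΛ hU
      (hball.trans hδU) hv (fun n hn => (hB n hn).1) (fun y hy => (hS y (hball hy)).trans hSΛ)
      ?_ a ha hka).trans_eq (by ring)
    intro n hn t ht htδ
    obtain ⟨hDn, hDb⟩ := hD n hn
    obtain ⟨q, hq1, hq2⟩ := htrunc k (σ * t) (by positivity)
    refine ⟨q, fun i hi => ?_, fun y hy => ?_⟩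
    · have hb := hDb L (Or.inr rfl) x (hball (mem_closedBall_self hδ.le)) i
      calc _ ≤ D n * (lc L i * σ ^ i) * t ^ i := by gcongr
        _ = D n * (lc L i * (σ * t) ^ i) := by rw [mul_pow]; ring
        _ ≤ D n * 1 := by gcongr; exact hq1 i hi.le
        _ ≤ Λ / 2 := by rw [mul_one]; exact hDΛ n hn
    · have hb := hDb N (Or.inl rfl) y (hball (closedBall_subset_closedBall htδ hy)) q
      have hNq := lc_pos (hw N hN) q
      calc _ = ‖iteratedFDeriv ℝ q (fun y => f y ^ n) y‖ / q.factorial * t ^ q := by ring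
        _ ≤ D n * (lc N q * σ ^ q) * t ^ q := by gcongr
        _ = D n * (lc N q * (σ * t) ^ q) := by rw [mul_pow]; ring
        _ ≤ Λ * (lc M k * (C * (σ * t)) ^ (k + 1)) ^ 2 ^ r := by
          gcongr
          linarith [hDΛ n hn]
        _ = Λ * (lc M k * (C * σ) ^ (k + 1) * t ^ (k + 1)) ^ 2 ^ r := by
          rw [← mul_assoc C, mul_pow (C * σ), mul_assoc (lc M k)]
  have hnorm := norm_iteratedFDeriv_le_of_diagonal hU hsm (hKU hx) (by positivity) hdiag
  have hr := hroot k
  have hMfac : M k = k.factorial * lc M k := by rw [lc]; field_simp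
  have e1 : (6 * A) ^ k * (1 / δ) ^ k = (6 * A / (δ * ρ)) ^ k * ρ ^ k := by
    rw [← mul_pow, ← mul_pow]
    congr 1
    field_simp
  have e2 : (6 * A) ^ k * (C * σ) ^ (k + 1) = ρ ^ k * (C * σ) := by
    rw [pow_succ, ← mul_assoc, ← mul_pow, hσC]
  calc _ ≤ 6 ^ k * (Λ * (A ^ (k + 1) * k.factorial
        * ((1 / δ) ^ k + lc M k * (C * σ) ^ (k + 1) * δ))) := hnorm
    _ = Λ * A * k.factorial * ((6 * A) ^ k * (1 / δ) ^ k
        + lc M k * ((6 * A) ^ k * (C * σ) ^ (k + 1)) * δ) := by rw [mul_pow 6 A]; ring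
    _ = Λ * A * k.factorial * ((6 * A / (δ * ρ)) ^ k * ρ ^ k
        + lc M k * (ρ ^ k * (C * σ)) * δ) := by rw [e1, e2]
    _ ≤ Λ * A * k.factorial * (C₃ * lc M k * ρ ^ k
        + lc M k * (ρ ^ k * (C * σ)) * δ) := by gcongr
    _ = _ := by rw [hMfac]; ring

end JorisPaper
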